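/- For all k ≥ 0, the pairing B/(B⁺)^{k+1} ⊗ Ū_k → ℂ is nondegenerate; in particular dim B/(B⁺)^{k+1} = dim Ū_k = Σ_{l=0}^{k} C(2r(N−r)+l−1, l). -/

import Mathlib

noncomputable section

open scoped TensorProduct

/-- Cartan integers of `sl_N`. -/
def cartanSL (i j : ℕ) : ℤ :=
  if i = j then 2 else if ((i : ℤ) - j).natAbs = 1 then -1 else 0

/-- The defining relations of `U_q(sl_N)` for a candidate family of generators. -/
def UqslRels (q : ℝ) (N : ℕ) {V : Type} [Ring V] [Algebra ℂ V]
    (e f kg ki : ℕ → V) : Prop :=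
  (∀ i ∈ Finset.Icc 1 (N - 1), kg i * ki i = 1 ∧ ki i * kg i = 1) ∧
  (∀ i ∈ Finset.Icc 1 (N - 1), ∀ j ∈ Finset.Icc 1 (N - 1),
      kg i * kg j = kg j * kg i) ∧
  (∀ i ∈ Finset.Icc 1 (N - 1), ∀ j ∈ Finset.Icc 1 (N - 1),
      kg i * e j = ((q : ℂ) ^ (cartanSL i j)) • (e j * kg i)) ∧
  (∀ i ∈ Finset.Icc 1 (N - 1), ∀ j ∈ Finset.Icc 1 (N - 1),
      kg i * f j = ((q : ℂ) ^ (-cartanSL i j)) • (f j * kg i)) ∧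
  (∀ i ∈ Finset.Icc 1 (N - 1), ∀ j ∈ Finset.Icc 1 (N - 1),
      e i * f j - f j * e i =
        if i = j then (((q : ℂ) - (q : ℂ)⁻¹)⁻¹) • (kg i - ki i) else 0) ∧
  (∀ i ∈ Finset.Icc 1 (N - 1), ∀ j ∈ Finset.Icc 1 (N - 1), ((i : ℤ) - j).natAbs = 1 →
      e i * e i * e j - ((q : ℂ) + (q : ℂ)⁻¹) • (e i * e j * e i) + e j * e i * e i = 0) ∧
  (∀ i ∈ Finset.Icc 1 (N - 1), ∀ j ∈ Finset.Icc 1 (N - 1), 2 ≤ ((i : ℤ) - j).natAbs →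
      e i * e j = e j * e i) ∧
  (∀ i ∈ Finset.Icc 1 (N - 1), ∀ j ∈ Finset.Icc 1 (N - 1), ((i : ℤ) - j).natAbs = 1 →
      f i * f i * f j - ((q : ℂ) + (q : ℂ)⁻¹) • (f i * f j * f i) + f j * f i * f i = 0) ∧
  (∀ i ∈ Finset.Icc 1 (N - 1), ∀ j ∈ Finset.Icc 1 (N - 1), 2 ≤ ((i : ℤ) - j).natAbs →
      f i * f j = f j * f i)

/-- The quantized enveloping algebra `U_q(sl_N)` together with its Hopf algebra
structure, generators, defining relations and universal property. -/
structure UqslData (q : ℝ) (N : ℕ) where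
  U : Type
  [instRing : Ring U]
  [instHopf : HopfAlgebra ℂ U]
  E : ℕ → U
  F : ℕ → U
  Kg : ℕ → U
  Ki : ℕ → U
  rels : UqslRels q N E F Kg Ki
  comul_E : ∀ i ∈ Finset.Icc 1 (N - 1),
    Coalgebra.comul (R := ℂ) (E i) = E i ⊗ₜ[ℂ] 1 + Kg i ⊗ₜ[ℂ] E i
  comul_F : ∀ i ∈ Finset.Icc 1 (N - 1),
    Coalgebra.comul (R := ℂ) (F i) = F i ⊗ₜ[ℂ] Ki i + 1 ⊗ₜ[ℂ] F i
  comul_Kg : ∀ i ∈ Finset.Icc 1 (N - 1),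
    Coalgebra.comul (R := ℂ) (Kg i) = Kg i ⊗ₜ[ℂ] Kg i
  comul_Ki : ∀ i ∈ Finset.Icc 1 (N - 1),
    Coalgebra.comul (R := ℂ) (Ki i) = Ki i ⊗ₜ[ℂ] Ki i
  counit_E : ∀ i ∈ Finset.Icc 1 (N - 1), Coalgebra.counit (R := ℂ) (E i) = 0
  counit_F : ∀ i ∈ Finset.Icc 1 (N - 1), Coalgebra.counit (R := ℂ) (F i) = 0
  counit_Kg : ∀ i ∈ Finset.Icc 1 (N - 1), Coalgebra.counit (R := ℂ) (Kg i) = 1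
  counit_Ki : ∀ i ∈ Finset.Icc 1 (N - 1), Coalgebra.counit (R := ℂ) (Ki i) = 1
  gen : Algebra.adjoin ℂ
      {x : U | ∃ i ∈ Finset.Icc 1 (N - 1), x = E i ∨ x = F i ∨ x = Kg i ∨ x = Ki i} = ⊤
  univ : ∀ (V : Type) [Ring V] [Algebra ℂ V] (e f kg ki : ℕ → V),
      UqslRels q N e f kg ki → ∃ φ : U →ₐ[ℂ] V,
        ∀ i ∈ Finset.Icc 1 (N - 1),
          φ (E i) = e i ∧ φ (F i) = f i ∧ φ (Kg i) = kg i ∧ φ (Ki i) = ki i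

attribute [instance] UqslData.instRing UqslData.instHopf

namespace UqslData

variable {q : ℝ} {N : ℕ} (D : UqslData q N)

/-- Root vectors `E_{α_{i,i+d}}` (iterated `q`-commutators with respect to the
standard reduced decomposition of the longest Weyl group element). -/
def Ev : ℕ → ℕ → D.U
  | 0, i => D.E i
  | d + 1, i => D.E i * Ev d (i + 1) - (q : ℂ)⁻¹ • (Ev d (i + 1) * D.E i)

/-- Root vectors `F_{α_{i,i+d}}`. -/
def Fv : ℕ → ℕ → D.U
  | 0, i => D.F i
  | d + 1, i => Fv d (i + 1) * D.F i - (q : ℂ)⁻¹ • (D.F i * Fv d (i + 1))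

/-- The Hopf subalgebra `K` generated by `E_i, F_i (i ≠ r)` and all `K_j^{±1}`. -/
def Ksub (r : ℕ) : Subalgebra ℂ D.U :=
  Algebra.adjoin ℂ
    ({x : D.U | ∃ i ∈ Finset.Icc 1 (N - 1), i ≠ r ∧ (x = D.E i ∨ x = D.F i)} ∪
     {x : D.U | ∃ j ∈ Finset.Icc 1 (N - 1), x = D.Kg j ∨ x = D.Ki j})

/-- The subspace `K⁺U ⊆ U`. -/
def Jsub (r : ℕ) : Submodule ℂ D.U :=
  Submodule.span ℂ
    {x : D.U | ∃ k ∈ D.Ksub r, Coalgebra.counit (R := ℂ) k = 0 ∧ ∃ u : D.U, x = k * u}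

/-- The subspace `K⁺U ⊗ U + U ⊗ K⁺U` of `U ⊗ U`, i.e. the kernel of `π ⊗ π` where
`π : U → U/K⁺U` is the canonical projection. -/
def JUU (r : ℕ) : Submodule ℂ (D.U ⊗[ℂ] D.U) :=
  LinearMap.range (TensorProduct.map (D.Jsub r).subtype LinearMap.id) ⊔
  LinearMap.range (TensorProduct.map LinearMap.id (D.Jsub r).subtype)

/-- `x ∈ U` represents a primitive element of the quotient coalgebra `Ū = U/K⁺U`. -/
def IsPrimitiveMod (r : ℕ) (x : D.U) : Prop :=
  Coalgebra.comul (R := ℂ) x - x ⊗ₜ[ℂ] 1 - 1 ⊗ₜ[ℂ] x ∈ D.JUU r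

end UqslData

/-- Membership of the pair `(i,j)` in (the index set of) `Φ⁺_r`, the set of positive
roots `α_{ij} = α_i + ⋯ + α_j` of `sl_N` with `i ≤ r ≤ j`. -/
def inPhiR (N r : ℕ) (p : ℕ × ℕ) : Prop :=
  1 ≤ p.1 ∧ p.1 ≤ r ∧ r ≤ p.2 ∧ p.2 ≤ N - 1



/-- The quantized function algebra `A = O_q(SL_N)` together with the nondegenerate Hopf
pairing with `U = U_q(sl_N)`:  `A` is a Hopf algebra generated by the matrix coefficients
`u^i_j` of the fundamental corepresentation, and the pairing is fixed by its values on
the generators (the fundamental representation of `U_q(sl_N)`). -/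
structure QslnFun (q : ℝ) (N : ℕ) (D : UqslData q N) where
  A : Type
  [instRingA : Ring A]
  [instHopfA : HopfAlgebra ℂ A]
  u : ℕ → ℕ → A
  genA : Algebra.adjoin ℂ
      {x : A | ∃ i ∈ Finset.Icc 1 N, ∃ j ∈ Finset.Icc 1 N, x = u i j} = ⊤
  comul_u : ∀ i ∈ Finset.Icc 1 N, ∀ j ∈ Finset.Icc 1 N,
    Coalgebra.comul (R := ℂ) (u i j) = ∑ k ∈ Finset.Icc 1 N, u i k ⊗ₜ[ℂ] u k j
  counit_u : ∀ i ∈ Finset.Icc 1 N, ∀ j ∈ Finset.Icc 1 N,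
    Coalgebra.counit (R := ℂ) (u i j) = if i = j then 1 else 0
  pair : D.U →ₗ[ℂ] A →ₗ[ℂ] ℂ
  pair_mulU : ∀ (x y : D.U) (a : A), pair (x * y) a =
    LinearMap.mul' ℂ ℂ (TensorProduct.map (pair x) (pair y) (Coalgebra.comul (R := ℂ) a))
  pair_mulA : ∀ (x : D.U) (a b : A), pair x (a * b) =
    LinearMap.mul' ℂ ℂ (TensorProduct.map (pair.flip a) (pair.flip b)
      (Coalgebra.comul (R := ℂ) x))
  pair_oneU : ∀ a : A, pair 1 a = Coalgebra.counit (R := ℂ) a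
  pair_oneA : ∀ x : D.U, pair x 1 = Coalgebra.counit (R := ℂ) x
  pair_antipode : ∀ (x : D.U) (a : A),
    pair (HopfAlgebra.antipode (R := ℂ) x) a = pair x (HopfAlgebra.antipode (R := ℂ) a)
  pair_E : ∀ l ∈ Finset.Icc 1 (N - 1), ∀ i ∈ Finset.Icc 1 N, ∀ j ∈ Finset.Icc 1 N,
    pair (D.E l) (u i j) = if i = l ∧ j = l + 1 then 1 else 0
  pair_F : ∀ l ∈ Finset.Icc 1 (N - 1), ∀ i ∈ Finset.Icc 1 N, ∀ j ∈ Finset.Icc 1 N,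
    pair (D.F l) (u i j) = if i = l + 1 ∧ j = l then 1 else 0
  pair_Kg : ∀ l ∈ Finset.Icc 1 (N - 1), ∀ i ∈ Finset.Icc 1 N, ∀ j ∈ Finset.Icc 1 N,
    pair (D.Kg l) (u i j) =
      if i = j then (if i = l then (q : ℂ) else if i = l + 1 then (q : ℂ)⁻¹ else 1) else 0
  pair_Ki : ∀ l ∈ Finset.Icc 1 (N - 1), ∀ i ∈ Finset.Icc 1 N, ∀ j ∈ Finset.Icc 1 N,
    pair (D.Ki l) (u i j) =
      if i = j then (if i = l then (q : ℂ)⁻¹ else if i = l + 1 then (q : ℂ) else 1) else 0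
  nondegU : ∀ x : D.U, (∀ a : A, pair x a = 0) → x = 0
  nondegA : ∀ a : A, (∀ x : D.U, pair x a = 0) → a = 0

attribute [instance] QslnFun.instRingA QslnFun.instHopfA

namespace QslnFun

variable {q : ℝ} {N : ℕ} {D : UqslData q N} (P : QslnFun q N D)

/-- For `k : U`, the operator `a ↦ ⟨k, a₍₁₎⟩ a₍₂₎` on `A`. -/
def hitL (k : D.U) : P.A →ₗ[ℂ] P.A :=
  TensorProduct.lift ((LinearMap.lsmul ℂ P.A).comp (P.pair k)) ∘ₗ
    Coalgebra.comul (R := ℂ)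

/-- The quantum Grassmannian `B = O_q(Gr(r,N))` inside `A`, as the subspace
`{b ∈ A | ⟨k, b₍₁₎⟩ b₍₂₎ = 0 for all k ∈ K⁺}`. -/
def Bmod (r : ℕ) : Submodule ℂ P.A :=
  ⨅ k : ↥(D.Ksub r),
    LinearMap.ker (P.hitL ((k : D.U) - algebraMap ℂ D.U
      (Coalgebra.counit (R := ℂ) (k : D.U))))

end QslnFun



/-- The span in `U` of the monomials `∏ F_{β_i}^{n_i} ∏ E_{β'_j}^{m_j}` of total degree
`Σ n_i + Σ m_j ≤ k`; its image in `Ū = U/K⁺U` is the term `Ū_k` of the filtration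
`F₁` (equivalently, of the coradical filtration). -/
noncomputable def monSpanLe {q : ℝ} {N : ℕ} (D : UqslData q N)
    (lF lE : List (ℕ × ℕ)) (k : ℕ) : Submodule ℂ D.U :=
  Submodule.span ℂ
    {x : D.U | ∃ n m : (ℕ × ℕ) → ℕ,
      (lF.map n).sum + (lE.map m).sum ≤ k ∧
      x = (lF.map fun p => D.Fv (p.2 - p.1) p.1 ^ n p).prod *
          (lE.map fun p => D.Ev (p.2 - p.1) p.1 ^ m p).prod}

local notation "ε" => Coalgebra.counit (R := ℂ)

local notation "Δ" => Coalgebra.comul (R := ℂ)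

namespace UqslData

variable {q : ℝ} {N : ℕ} (D : UqslData q N)

lemma mem_Icc_pred {c : ℕ} (h1 : 1 ≤ c) (h2 : c < N) : c ∈ Finset.Icc 1 (N - 1) := by
  simp; omega

/-- The Chevalley generators. -/
def gens : Set D.U := {x | ∃ i ∈ Finset.Icc 1 (N - 1),
  x = D.E i ∨ x = D.F i ∨ x = D.Kg i ∨ x = D.Ki i}

lemma forall_mem_gens {p : D.U → Prop} (hE : ∀ c, 1 ≤ c → c < N → p (D.E c))
    (hF : ∀ c, 1 ≤ c → c < N → p (D.F c)) (hK : ∀ c, 1 ≤ c → c < N → p (D.Kg c))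
    (hK' : ∀ c, 1 ≤ c → c < N → p (D.Ki c)) : ∀ x ∈ D.gens, p x := by
  rintro x ⟨i, hi, h⟩
  simp only [Finset.mem_Icc] at hi
  rcases h with rfl | rfl | rfl | rfl
  exacts [hE i hi.1 (by omega), hF i hi.1 (by omega), hK i hi.1 (by omega), hK' i hi.1 (by omega)]

lemma mem_of_gens_subset {S : Subalgebra ℂ D.U} (h : D.gens ⊆ S) (x : D.U) : x ∈ S := by
  have : Algebra.adjoin ℂ D.gens ≤ S := Algebra.adjoin_le h
  exact this (by rw [show Algebra.adjoin ℂ D.gens = ⊤ from D.gen]; trivial)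

lemma Kg_mul_Ki {c : ℕ} (h1 : 1 ≤ c) (h2 : c < N) : D.Kg c * D.Ki c = 1 :=
  (D.rels.1 c (mem_Icc_pred h1 h2)).1

lemma Ki_mul_Kg {c : ℕ} (h1 : 1 ≤ c) (h2 : c < N) : D.Ki c * D.Kg c = 1 :=
  (D.rels.1 c (mem_Icc_pred h1 h2)).2

end UqslData

namespace QslnFun

variable {q : ℝ} {N : ℕ} {D : UqslData q N} (P : QslnFun q N D)

open Coalgebra

lemma hitL_repr (x : D.U) {a : P.A} {ι : Type*} (s : Repr ℂ a ι) :
    P.hitL x a = ∑ i ∈ s.index, P.pair x (s.left i) • s.right i := by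
  simp [hitL, ← s.eq]

/-- For `x : U`, the operator `a ↦ ⟨x, a₍₂₎⟩ a₍₁₎` on `A`. -/
def hitR (x : D.U) : P.A →ₗ[ℂ] P.A :=
  (TensorProduct.rid ℂ P.A).toLinearMap ∘ₗ LinearMap.lTensor P.A (P.pair x) ∘ₗ comul

lemma hitR_repr (x : D.U) {a : P.A} {ι : Type*} (s : Repr ℂ a ι) :
    P.hitR x a = ∑ i ∈ s.index, P.pair x (s.right i) • s.left i := by
  simp [hitR, ← s.eq]

lemma pair_mulU_repr (x y : D.U) {a : P.A} {ι : Type*} (s : Repr ℂ a ι) :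
    P.pair (x * y) a = ∑ i ∈ s.index, P.pair x (s.left i) * P.pair y (s.right i) := by
  simp [P.pair_mulU, ← s.eq]

lemma pair_hitL (t x : D.U) (a : P.A) : P.pair t (P.hitL x a) = P.pair (x * t) a := by
  rw [P.hitL_repr x (ℛ ℂ a), P.pair_mulU_repr x t (ℛ ℂ a)]; simp

lemma pair_hitR (t x : D.U) (a : P.A) : P.pair t (P.hitR x a) = P.pair (t * x) a := by
  rw [P.hitR_repr x (ℛ ℂ a), P.pair_mulU_repr t x (ℛ ℂ a)]; simp [mul_comm]

variable {P} in
lemma ext_pair {a b : P.A} (h : ∀ t, P.pair t a = P.pair t b) : a = b := by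
  rw [← sub_eq_zero]; exact P.nondegA _ fun t => by simp [h]

lemma hitL_mul (x y : D.U) (a : P.A) : P.hitL (x * y) a = P.hitL y (P.hitL x a) :=
  ext_pair fun t => by simp [pair_hitL, mul_assoc]

lemma hitR_mul (x y : D.U) (a : P.A) : P.hitR (x * y) a = P.hitR x (P.hitR y a) :=
  ext_pair fun t => by simp [pair_hitR, mul_assoc]

@[simp] lemma hitL_one (a : P.A) : P.hitL 1 a = a := ext_pair fun t => by simp [pair_hitL]

@[simp] lemma hitR_one (a : P.A) : P.hitR 1 a = a := ext_pair fun t => by simp [pair_hitR]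

lemma hitL_add (x y : D.U) (a : P.A) : P.hitL (x + y) a = P.hitL x a + P.hitL y a :=
  ext_pair fun t => by simp [pair_hitL, add_mul]

lemma hitL_sub (x y : D.U) (a : P.A) : P.hitL (x - y) a = P.hitL x a - P.hitL y a :=
  ext_pair fun t => by simp [pair_hitL, sub_mul]

lemma hitL_smul (c : ℂ) (x : D.U) (a : P.A) : P.hitL (c • x) a = c • P.hitL x a :=
  ext_pair fun t => by simp [pair_hitL]

lemma hitR_add (x y : D.U) (a : P.A) : P.hitR (x + y) a = P.hitR x a + P.hitR y a :=
  ext_pair fun t => by simp [pair_hitR, mul_add]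

lemma hitR_sub (x y : D.U) (a : P.A) : P.hitR (x - y) a = P.hitR x a - P.hitR y a :=
  ext_pair fun t => by simp [pair_hitR, mul_sub]

lemma hitR_smul (c : ℂ) (x : D.U) (a : P.A) : P.hitR (c • x) a = c • P.hitR x a :=
  ext_pair fun t => by simp [pair_hitR]

@[simp] lemma counit_hitL (x : D.U) (a : P.A) : ε (P.hitL x a) = P.pair x a := by
  rw [← P.pair_oneU, pair_hitL, mul_one]

@[simp] lemma counit_hitR (x : D.U) (a : P.A) : ε (P.hitR x a) = P.pair x a := by
  rw [← P.pair_oneU, pair_hitR, one_mul]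

lemma hitL_hitR (x y : D.U) (a : P.A) : P.hitL x (P.hitR y a) = P.hitR y (P.hitL x a) :=
  ext_pair fun t => by simp [pair_hitL, pair_hitR, mul_assoc]

section TwoTerm

variable {P} {x s t s' t' : D.U}

lemma pair_mul₂ (h : Δ x = s ⊗ₜ[ℂ] t + s' ⊗ₜ t') (a b : P.A) :
    P.pair x (a * b) = P.pair s a * P.pair t b + P.pair s' a * P.pair t' b := by
  simp [P.pair_mulA, h]

/-- The coproduct of `A` is multiplicative, in terms of representations. -/
def reprMul (a b : P.A) : Repr ℂ (a * b) ((P.A × P.A) × (P.A × P.A)) where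
  index := (ℛ ℂ a).index ×ˢ (ℛ ℂ b).index
  left i := (ℛ ℂ a).left i.1 * (ℛ ℂ b).left i.2
  right i := (ℛ ℂ a).right i.1 * (ℛ ℂ b).right i.2
  eq := by
    have h : Δ (a * b) = Δ a * Δ b := Bialgebra.comul_mul a b
    rw [h, ← (ℛ ℂ a).eq, ← (ℛ ℂ b).eq, Finset.sum_mul_sum, Finset.sum_product]
    simp

lemma hitL_mul₂ (h : Δ x = s ⊗ₜ[ℂ] t + s' ⊗ₜ t') (a b : P.A) :
    P.hitL x (a * b) = P.hitL s a * P.hitL t b + P.hitL s' a * P.hitL t' b := by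
  rw [P.hitL_repr x (reprMul a b)]
  simp only [P.hitL_repr _ (ℛ ℂ a), P.hitL_repr _ (ℛ ℂ b), Finset.sum_mul_sum, reprMul,
    ← Finset.sum_product', ← Finset.sum_add_distrib, pair_mul₂ h, add_smul, smul_mul_smul_comm]

lemma hitR_mul₂ (h : Δ x = s ⊗ₜ[ℂ] t + s' ⊗ₜ t') (a b : P.A) :
    P.hitR x (a * b) = P.hitR s a * P.hitR t b + P.hitR s' a * P.hitR t' b := by
  rw [P.hitR_repr x (reprMul a b)]
  simp only [P.hitR_repr _ (ℛ ℂ a), P.hitR_repr _ (ℛ ℂ b), Finset.sum_mul_sum, reprMul,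
    ← Finset.sum_product', ← Finset.sum_add_distrib, pair_mul₂ h, add_smul, smul_mul_smul_comm]

end TwoTerm

lemma hitL_oneA (x : D.U) : P.hitL x 1 = ε x • (1 : P.A) := by
  simp [hitL, Bialgebra.comul_one, Algebra.TensorProduct.one_def, P.pair_oneA]

lemma hitR_oneA (x : D.U) : P.hitR x 1 = ε x • (1 : P.A) := by
  simp [hitR, Bialgebra.comul_one, Algebra.TensorProduct.one_def, P.pair_oneA]

section Gens

variable {c : ℕ} (h1 : 1 ≤ c) (h2 : c < N)

include h1 h2 in
lemma _root_.UqslData.comul_E' : Δ (D.E c) = D.E c ⊗ₜ[ℂ] 1 + D.Kg c ⊗ₜ D.E c :=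
  D.comul_E c (UqslData.mem_Icc_pred h1 h2)

include h1 h2 in
lemma _root_.UqslData.comul_F' : Δ (D.F c) = D.F c ⊗ₜ[ℂ] D.Ki c + 1 ⊗ₜ D.F c :=
  D.comul_F c (UqslData.mem_Icc_pred h1 h2)

include h1 h2 in
lemma _root_.UqslData.comul_Kg' : Δ (D.Kg c) = D.Kg c ⊗ₜ[ℂ] D.Kg c + 0 ⊗ₜ 0 := by
  simpa using D.comul_Kg c (UqslData.mem_Icc_pred h1 h2)

include h1 h2 in
lemma _root_.UqslData.comul_Ki' : Δ (D.Ki c) = D.Ki c ⊗ₜ[ℂ] D.Ki c + 0 ⊗ₜ 0 := by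
  simpa using D.comul_Ki c (UqslData.mem_Icc_pred h1 h2)

include h1 h2 in
lemma _root_.UqslData.counit_E' : ε (D.E c) = 0 := D.counit_E c (UqslData.mem_Icc_pred h1 h2)

include h1 h2 in
lemma _root_.UqslData.counit_F' : ε (D.F c) = 0 := D.counit_F c (UqslData.mem_Icc_pred h1 h2)

include h1 h2 in
lemma _root_.UqslData.counit_Kg' : ε (D.Kg c) = 1 := D.counit_Kg c (UqslData.mem_Icc_pred h1 h2)

include h1 h2 in
lemma _root_.UqslData.counit_Ki' : ε (D.Ki c) = 1 := D.counit_Ki c (UqslData.mem_Icc_pred h1 h2)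

@[simp] lemma hitL_zero (a : P.A) : P.hitL 0 a = 0 := by simpa using P.hitL_smul 0 0 a

@[simp] lemma hitR_zero (a : P.A) : P.hitR 0 a = 0 := by simp [hitR]

include h1 h2 in
lemma hitL_E_mul (a b : P.A) :
    P.hitL (D.E c) (a * b) = P.hitL (D.E c) a * b + P.hitL (D.Kg c) a * P.hitL (D.E c) b := by
  simpa using hitL_mul₂ (P := P) (UqslData.comul_E' h1 h2) a b

include h1 h2 in
lemma hitL_F_mul (a b : P.A) :
    P.hitL (D.F c) (a * b) = P.hitL (D.F c) a * P.hitL (D.Ki c) b + a * P.hitL (D.F c) b := by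
  simpa using hitL_mul₂ (P := P) (UqslData.comul_F' h1 h2) a b

include h1 h2 in
lemma hitL_Kg_mul (a b : P.A) :
    P.hitL (D.Kg c) (a * b) = P.hitL (D.Kg c) a * P.hitL (D.Kg c) b := by
  simpa using hitL_mul₂ (P := P) (UqslData.comul_Kg' h1 h2) a b

include h1 h2 in
lemma hitL_Ki_mul (a b : P.A) :
    P.hitL (D.Ki c) (a * b) = P.hitL (D.Ki c) a * P.hitL (D.Ki c) b := by
  simpa using hitL_mul₂ (P := P) (UqslData.comul_Ki' h1 h2) a b

include h1 h2 in
lemma hitR_E_mul (a b : P.A) :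
    P.hitR (D.E c) (a * b) = P.hitR (D.E c) a * b + P.hitR (D.Kg c) a * P.hitR (D.E c) b := by
  simpa using hitR_mul₂ (P := P) (UqslData.comul_E' h1 h2) a b

include h1 h2 in
lemma hitR_F_mul (a b : P.A) :
    P.hitR (D.F c) (a * b) = P.hitR (D.F c) a * P.hitR (D.Ki c) b + a * P.hitR (D.F c) b := by
  simpa using hitR_mul₂ (P := P) (UqslData.comul_F' h1 h2) a b

include h1 h2 in
lemma hitR_Kg_mul (a b : P.A) :
    P.hitR (D.Kg c) (a * b) = P.hitR (D.Kg c) a * P.hitR (D.Kg c) b := by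
  simpa using hitR_mul₂ (P := P) (UqslData.comul_Kg' h1 h2) a b

include h1 h2 in
lemma hitR_Ki_mul (a b : P.A) :
    P.hitR (D.Ki c) (a * b) = P.hitR (D.Ki c) a * P.hitR (D.Ki c) b := by
  simpa using hitR_mul₂ (P := P) (UqslData.comul_Ki' h1 h2) a b

end Gens

section Letters

variable {i j : ℕ} (hi1 : 1 ≤ i) (hi2 : i ≤ N) (hj1 : 1 ≤ j) (hj2 : j ≤ N)
include hi1 hi2 hj1 hj2

lemma hitL_u (x : D.U) :
    P.hitL x (P.u i j) = ∑ k ∈ Finset.Icc 1 N, P.pair x (P.u i k) • P.u k j := by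
  rw [hitL, LinearMap.comp_apply, P.comul_u i (by simp [*]) j (by simp [*])]
  simp

lemma hitR_u (x : D.U) :
    P.hitR x (P.u i j) = ∑ k ∈ Finset.Icc 1 N, P.pair x (P.u k j) • P.u i k := by
  simp only [hitR, LinearMap.comp_apply, P.comul_u i (by simp [*]) j (by simp [*])]
  simp

lemma counit_u' : ε (P.u i j) = if i = j then 1 else 0 :=
  P.counit_u i (by simp [*]) j (by simp [*])

variable {c : ℕ} (h1 : 1 ≤ c) (h2 : c < N)
include h1 h2

lemma hitL_E_u : P.hitL (D.E c) (P.u i j) = if i = c then P.u (c + 1) j else 0 := by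
  rw [P.hitL_u hi1 hi2 hj1 hj2, Finset.sum_congr rfl fun k hk => by
    rw [P.pair_E c (UqslData.mem_Icc_pred h1 h2) i (by simp [*]) k hk]]
  by_cases h : i = c
  · rw [Finset.sum_eq_single (c + 1)] <;> simp +contextual [h]; omega
  · simp [h]

lemma hitL_F_u : P.hitL (D.F c) (P.u i j) = if i = c + 1 then P.u c j else 0 := by
  rw [P.hitL_u hi1 hi2 hj1 hj2, Finset.sum_congr rfl fun k hk => by
    rw [P.pair_F c (UqslData.mem_Icc_pred h1 h2) i (by simp [*]) k hk]]
  by_cases h : i = c + 1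
  · rw [Finset.sum_eq_single c] <;> simp +contextual [h]; omega
  · simp [h]

lemma hitL_Kg_u : P.hitL (D.Kg c) (P.u i j) =
    (if i = c then (q : ℂ) else if i = c + 1 then (q : ℂ)⁻¹ else 1) • P.u i j := by
  rw [P.hitL_u hi1 hi2 hj1 hj2, Finset.sum_congr rfl fun k hk => by
    rw [P.pair_Kg c (UqslData.mem_Icc_pred h1 h2) i (by simp [*]) k hk]]
  rw [Finset.sum_eq_single i] <;> simp +contextual [eq_comm]; omega

lemma hitL_Ki_u : P.hitL (D.Ki c) (P.u i j) =
    (if i = c then (q : ℂ)⁻¹ else if i = c + 1 then (q : ℂ) else 1) • P.u i j := by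
  rw [P.hitL_u hi1 hi2 hj1 hj2, Finset.sum_congr rfl fun k hk => by
    rw [P.pair_Ki c (UqslData.mem_Icc_pred h1 h2) i (by simp [*]) k hk]]
  rw [Finset.sum_eq_single i] <;> simp +contextual [eq_comm]; omega

lemma hitR_E_u : P.hitR (D.E c) (P.u i j) = if j = c + 1 then P.u i c else 0 := by
  rw [P.hitR_u hi1 hi2 hj1 hj2, Finset.sum_congr rfl fun k hk => by
    rw [P.pair_E c (UqslData.mem_Icc_pred h1 h2) k hk j (by simp [*])]]
  by_cases h : j = c + 1
  · rw [Finset.sum_eq_single c] <;> simp +contextual [h]; omega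
  · simp [h]

lemma hitR_F_u : P.hitR (D.F c) (P.u i j) = if j = c then P.u i (c + 1) else 0 := by
  rw [P.hitR_u hi1 hi2 hj1 hj2, Finset.sum_congr rfl fun k hk => by
    rw [P.pair_F c (UqslData.mem_Icc_pred h1 h2) k hk j (by simp [*])]]
  by_cases h : j = c
  · rw [Finset.sum_eq_single (c + 1)] <;> simp +contextual [h]; omega
  · simp [h]

lemma hitR_Kg_u : P.hitR (D.Kg c) (P.u i j) =
    (if j = c then (q : ℂ) else if j = c + 1 then (q : ℂ)⁻¹ else 1) • P.u i j := by
  rw [P.hitR_u hi1 hi2 hj1 hj2, Finset.sum_congr rfl fun k hk => by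
    rw [P.pair_Kg c (UqslData.mem_Icc_pred h1 h2) k hk j (by simp [*])]]
  rw [Finset.sum_eq_single j] <;> simp +contextual [eq_comm]; omega

lemma hitR_Ki_u : P.hitR (D.Ki c) (P.u i j) =
    (if j = c then (q : ℂ)⁻¹ else if j = c + 1 then (q : ℂ) else 1) • P.u i j := by
  rw [P.hitR_u hi1 hi2 hj1 hj2, Finset.sum_congr rfl fun k hk => by
    rw [P.pair_Ki c (UqslData.mem_Icc_pred h1 h2) k hk j (by simp [*])]]
  rw [Finset.sum_eq_single j] <;> simp +contextual [eq_comm]; omega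

end Letters

section Antipode

open HopfAlgebra

lemma hitL_antipode (x : D.U) (a : P.A) :
    P.hitL x (antipode ℂ a) = antipode ℂ (P.hitR (antipode ℂ x) a) :=
  ext_pair fun t => by
    rw [pair_hitL, ← P.pair_antipode, ← P.pair_antipode, pair_hitR, antipode_mul_antidistrib]

lemma hitR_antipode (x : D.U) (a : P.A) :
    P.hitR x (antipode ℂ a) = antipode ℂ (P.hitL (antipode ℂ x) a) :=
  ext_pair fun t => by
    rw [pair_hitR, ← P.pair_antipode, ← P.pair_antipode, pair_hitL, antipode_mul_antidistrib]

variable {x s t s' t' : D.U}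

omit P in
lemma _root_.UqslData.antipode_mul₂ (h : Δ x = s ⊗ₜ[ℂ] t + s' ⊗ₜ t') :
    antipode ℂ s * t + antipode ℂ s' * t' = algebraMap ℂ D.U (ε x) := by
  simpa [h] using mul_antipode_rTensor_comul_apply (R := ℂ) x

variable {c : ℕ} (h1 : 1 ≤ c) (h2 : c < N)
include h1 h2

lemma _root_.UqslData.antipode_Kg : antipode ℂ (D.Kg c) = D.Ki c := by
  have h := UqslData.antipode_mul₂ (UqslData.comul_Kg' (D := D) h1 h2)
  rw [UqslData.counit_Kg' h1 h2] at h
  simp only [map_zero, mul_zero, add_zero, map_one] at h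
  calc _ = antipode ℂ (D.Kg c) * (D.Kg c * D.Ki c) := by rw [D.Kg_mul_Ki h1 h2, mul_one]
    _ = _ := by rw [← mul_assoc, h, one_mul]

lemma _root_.UqslData.antipode_Ki : antipode ℂ (D.Ki c) = D.Kg c := by
  have h := UqslData.antipode_mul₂ (UqslData.comul_Ki' (D := D) h1 h2)
  rw [UqslData.counit_Ki' h1 h2] at h
  simp only [map_zero, mul_zero, add_zero, map_one] at h
  calc _ = antipode ℂ (D.Ki c) * (D.Ki c * D.Kg c) := by rw [D.Ki_mul_Kg h1 h2, mul_one]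
    _ = _ := by rw [← mul_assoc, h, one_mul]

lemma _root_.UqslData.antipode_E : antipode ℂ (D.E c) = -(D.Ki c * D.E c) := by
  have h := UqslData.antipode_mul₂ (UqslData.comul_E' (D := D) h1 h2)
  rw [UqslData.counit_E' h1 h2, UqslData.antipode_Kg h1 h2] at h
  simpa [← eq_neg_iff_add_eq_zero] using h

lemma _root_.UqslData.antipode_F : antipode ℂ (D.F c) = -(D.F c * D.Kg c) := by
  have h := UqslData.antipode_mul₂ (UqslData.comul_F' (D := D) h1 h2)
  rw [UqslData.counit_F' h1 h2, antipode_one, one_mul, map_zero,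
    ← eq_neg_iff_add_eq_zero] at h
  calc _ = antipode ℂ (D.F c) * (D.Ki c * D.Kg c) := by rw [D.Ki_mul_Kg h1 h2, mul_one]
    _ = _ := by rw [← mul_assoc, h, neg_mul]

end Antipode

section Stab

/-- The subalgebra of `U` leaving a subspace of `A` stable under the left action. -/
def stabL (W : Submodule ℂ P.A) : Subalgebra ℂ D.U where
  carrier := {x | ∀ a ∈ W, P.hitL x a ∈ W}
  mul_mem' hx hy a ha := by rw [hitL_mul]; exact hy _ (hx a ha)
  add_mem' hx hy a ha := by rw [hitL_add]; exact add_mem (hx a ha) (hy a ha)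
  algebraMap_mem' c a ha := by
    rw [Algebra.algebraMap_eq_smul_one, hitL_smul, hitL_one]; exact W.smul_mem _ ha

lemma mem_stabL {W : Submodule ℂ P.A} {x : D.U} :
    x ∈ P.stabL W ↔ ∀ a ∈ W, P.hitL x a ∈ W := Iff.rfl

lemma mem_stabL_span {S : Set P.A} {x : D.U} :
    x ∈ P.stabL (Submodule.span ℂ S) ↔ ∀ a ∈ S, P.hitL x a ∈ Submodule.span ℂ S := by
  refine ⟨fun h a ha => h a (Submodule.subset_span ha), fun h a ha => ?_⟩
  have : Submodule.span ℂ S ≤ (Submodule.span ℂ S).comap (P.hitL x) :=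
    Submodule.span_le.2 h
  exact this ha

/-- The subalgebra of `U` acting on `a` through the counit (left action). -/
def fixL (a : P.A) : Subalgebra ℂ D.U where
  carrier := {x | P.hitL x a = ε x • a}
  mul_mem' {x y} hx hy := by
    simp only [Set.mem_ofPred_eq] at *
    rw [hitL_mul, hx, map_smul, hy, Bialgebra.counit_mul, smul_smul]
  add_mem' {x y} hx hy := by
    simp only [Set.mem_ofPred_eq] at *
    rw [hitL_add, hx, hy, map_add, add_smul]
  algebraMap_mem' c := by
    simp [Algebra.algebraMap_eq_smul_one, hitL_smul]

lemma mem_fixL {a : P.A} {x : D.U} : x ∈ P.fixL a ↔ P.hitL x a = ε x • a := Iff.rfl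

/-- The subalgebra of `U` acting on `a` through the counit (right action). -/
def fixR (a : P.A) : Subalgebra ℂ D.U where
  carrier := {x | P.hitR x a = ε x • a}
  mul_mem' {x y} hx hy := by
    simp only [Set.mem_ofPred_eq] at *
    rw [hitR_mul, hy, map_smul, hx, Bialgebra.counit_mul, smul_smul, mul_comm]
  add_mem' {x y} hx hy := by
    simp only [Set.mem_ofPred_eq] at *
    rw [hitR_add, hx, hy, map_add, add_smul]
  algebraMap_mem' c := by
    simp [Algebra.algebraMap_eq_smul_one, hitR_smul]

lemma pair_eq_zero_of_stabL {W : Submodule ℂ P.A} (hε : ∀ a ∈ W, ε a = 0) {x : D.U}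
    (hx : x ∈ P.stabL W) {a : P.A} (ha : a ∈ W) : P.pair x a = 0 := by
  rw [← counit_hitL]; exact hε _ (hx a ha)

lemma eq_zero_of_stabL {W : Submodule ℂ P.A} (hε : ∀ a ∈ W, ε a = 0)
    (h : D.gens ⊆ P.stabL W) {a : P.A} (ha : a ∈ W) : a = 0 :=
  P.nondegA _ fun _ => P.pair_eq_zero_of_stabL hε (D.mem_of_gens_subset h _) ha

lemma eq_smul_one_of_fixR {a : P.A} (h : D.gens ⊆ P.fixR a) : a = ε a • 1 :=
  ext_pair fun t => by
    have := D.mem_of_gens_subset h t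
    rw [← counit_hitR, show P.hitR t a = _ from this]
    simp [P.pair_oneA, mul_comm]

end Stab

end QslnFun

namespace QslnFun

section Scalars

/-- The eigenvalue of `K_c` on the `i`-th basis vector of the fundamental representation. -/
def kap (q : ℝ) (c i : ℕ) : ℂ := if i = c then (q : ℂ) else if i = c + 1 then (q : ℂ)⁻¹ else 1

/-- The eigenvalue of `K_c⁻¹` on the `i`-th basis vector of the fundamental representation. -/
def kap' (q : ℝ) (c i : ℕ) : ℂ := if i = c then (q : ℂ)⁻¹ else if i = c + 1 then (q : ℂ) else 1

end Scalars

variable {q : ℝ} {N : ℕ} {D : UqslData q N} (P : QslnFun q N D)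

/-- Families transforming under the left action like `u_{ij} u_{kl}` in the row indices. -/
structure IsTens (X : ℕ → ℕ → P.A) : Prop where
  E : ∀ c, 1 ≤ c → c < N → ∀ i k, 1 ≤ i → i ≤ N → 1 ≤ k → k ≤ N →
    P.hitL (D.E c) (X i k) =
      (if i = c then X (c + 1) k else 0) + kap q c i • (if k = c then X i (c + 1) else 0)
  F : ∀ c, 1 ≤ c → c < N → ∀ i k, 1 ≤ i → i ≤ N → 1 ≤ k → k ≤ N →
    P.hitL (D.F c) (X i k) =
      kap' q c k • (if i = c + 1 then X c k else 0) + (if k = c + 1 then X i c else 0)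
  Kg : ∀ c, 1 ≤ c → c < N → ∀ i k, 1 ≤ i → i ≤ N → 1 ≤ k → k ≤ N →
    P.hitL (D.Kg c) (X i k) = (kap q c i * kap q c k) • X i k
  Ki : ∀ c, 1 ≤ c → c < N → ∀ i k, 1 ≤ i → i ≤ N → 1 ≤ k → k ≤ N →
    P.hitL (D.Ki c) (X i k) = (kap' q c i * kap' q c k) • X i k

variable {P}

lemma isTens_u_mul_u {j l : ℕ} (hj1 : 1 ≤ j) (hj2 : j ≤ N) (hl1 : 1 ≤ l) (hl2 : l ≤ N) :
    P.IsTens fun i k => P.u i j * P.u k l where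
  E c h1 h2 i k hi1 hi2 hk1 hk2 := by
    rw [P.hitL_E_mul h1 h2, P.hitL_E_u hi1 hi2 hj1 hj2 h1 h2, P.hitL_E_u hk1 hk2 hl1 hl2 h1 h2,
      P.hitL_Kg_u hi1 hi2 hj1 hj2 h1 h2, kap]
    congr 1
    · split_ifs <;> simp
    · split_ifs <;> simp
  F c h1 h2 i k hi1 hi2 hk1 hk2 := by
    rw [P.hitL_F_mul h1 h2, P.hitL_F_u hi1 hi2 hj1 hj2 h1 h2, P.hitL_F_u hk1 hk2 hl1 hl2 h1 h2,
      P.hitL_Ki_u hk1 hk2 hl1 hl2 h1 h2, kap']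
    congr 1
    · split_ifs <;> simp
    · split_ifs <;> simp
  Kg c h1 h2 i k hi1 hi2 hk1 hk2 := by
    rw [P.hitL_Kg_mul h1 h2, P.hitL_Kg_u hi1 hi2 hj1 hj2 h1 h2,
      P.hitL_Kg_u hk1 hk2 hl1 hl2 h1 h2, smul_mul_smul_comm, kap, kap]
  Ki c h1 h2 i k hi1 hi2 hk1 hk2 := by
    rw [P.hitL_Ki_mul h1 h2, P.hitL_Ki_u hi1 hi2 hj1 hj2 h1 h2,
      P.hitL_Ki_u hk1 hk2 hl1 hl2 h1 h2, smul_mul_smul_comm, kap', kap']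

lemma IsTens.sub {X Y : ℕ → ℕ → P.A} (hX : P.IsTens X) (hY : P.IsTens Y) :
    P.IsTens fun i k => X i k - Y i k where
  E c h1 h2 i k hi1 hi2 hk1 hk2 := by
    rw [map_sub, hX.E c h1 h2 i k hi1 hi2 hk1 hk2, hY.E c h1 h2 i k hi1 hi2 hk1 hk2]
    split_ifs <;> module
  F c h1 h2 i k hi1 hi2 hk1 hk2 := by
    rw [map_sub, hX.F c h1 h2 i k hi1 hi2 hk1 hk2, hY.F c h1 h2 i k hi1 hi2 hk1 hk2]
    split_ifs <;> module
  Kg c h1 h2 i k hi1 hi2 hk1 hk2 := by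
    rw [map_sub, hX.Kg c h1 h2 i k hi1 hi2 hk1 hk2, hY.Kg c h1 h2 i k hi1 hi2 hk1 hk2, smul_sub]
  Ki c h1 h2 i k hi1 hi2 hk1 hk2 := by
    rw [map_sub, hX.Ki c h1 h2 i k hi1 hi2 hk1 hk2, hY.Ki c h1 h2 i k hi1 hi2 hk1 hk2, smul_sub]

lemma IsTens.smul {X : ℕ → ℕ → P.A} (a : ℂ) (hX : P.IsTens X) :
    P.IsTens fun i k => a • X i k where
  E c h1 h2 i k hi1 hi2 hk1 hk2 := by
    rw [map_smul, hX.E c h1 h2 i k hi1 hi2 hk1 hk2]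
    split_ifs <;> module
  F c h1 h2 i k hi1 hi2 hk1 hk2 := by
    rw [map_smul, hX.F c h1 h2 i k hi1 hi2 hk1 hk2]
    split_ifs <;> module
  Kg c h1 h2 i k hi1 hi2 hk1 hk2 := by
    rw [map_smul, hX.Kg c h1 h2 i k hi1 hi2 hk1 hk2, smul_comm]
  Ki c h1 h2 i k hi1 hi2 hk1 hk2 := by
    rw [map_smul, hX.Ki c h1 h2 i k hi1 hi2 hk1 hk2, smul_comm]

/-- The braiding on tensors of rank two. -/
def braid (X : ℕ → ℕ → P.A) (i k : ℕ) : P.A :=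
  if i = k then (q : ℂ) • X i k
  else if i < k then X k i + ((q : ℂ) - (q : ℂ)⁻¹) • X i k else X k i

lemma IsTens.braid (hq : (q : ℂ) ≠ 0) {X : ℕ → ℕ → P.A} (hX : P.IsTens X) :
    P.IsTens (braid X) where
  E c h1 h2 i k hi1 hi2 hk1 hk2 := by
    have e1 := hX.E c h1 h2 i k hi1 hi2 hk1 hk2
    have e2 := hX.E c h1 h2 k i hk1 hk2 hi1 hi2
    unfold QslnFun.braid kap at *
    by_cases a1 : i = c <;> by_cases a2 : i = c + 1 <;> by_cases b1 : k = c <;>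
      by_cases b2 : k = c + 1 <;> rcases lt_trichotomy i k with h | h | h <;>
      first
      | omega
      | simp (disch := omega) only [if_pos, if_neg, map_add, map_smul] at e1 e2 ⊢
        simp only [e1, e2]
        try subst a1
        try subst a2
        try subst b1
        try subst b2
        all_goals (match_scalars <;> field_simp <;> ring)
  F c h1 h2 i k hi1 hi2 hk1 hk2 := by
    have e1 := hX.F c h1 h2 i k hi1 hi2 hk1 hk2
    have e2 := hX.F c h1 h2 k i hk1 hk2 hi1 hi2
    unfold QslnFun.braid kap' at *
    by_cases a1 : i = c <;> by_cases a2 : i = c + 1 <;> by_cases b1 : k = c <;>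
      by_cases b2 : k = c + 1 <;> rcases lt_trichotomy i k with h | h | h <;>
      first
      | omega
      | simp (disch := omega) only [if_pos, if_neg, map_add, map_smul] at e1 e2 ⊢
        simp only [e1, e2]
        try subst a1
        try subst a2
        try subst b1
        try subst b2
        all_goals (match_scalars <;> field_simp <;> ring)
  Kg c h1 h2 i k hi1 hi2 hk1 hk2 := by
    unfold QslnFun.braid
    have e1 := hX.Kg c h1 h2 i k hi1 hi2 hk1 hk2
    have e2 := hX.Kg c h1 h2 k i hk1 hk2 hi1 hi2
    split_ifs <;> simp only [map_add, map_smul, e1, e2] <;> module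
  Ki c h1 h2 i k hi1 hi2 hk1 hk2 := by
    unfold QslnFun.braid
    have e1 := hX.Ki c h1 h2 i k hi1 hi2 hk1 hk2
    have e2 := hX.Ki c h1 h2 k i hk1 hk2 hi1 hi2
    split_ifs <;> simp only [map_add, map_smul, e1, e2] <;> module

lemma IsTens.eq_zero {X : ℕ → ℕ → P.A} (hX : P.IsTens X)
    (hε : ∀ i k, 1 ≤ i → i ≤ N → 1 ≤ k → k ≤ N → ε (X i k) = 0) {i k : ℕ}
    (hi1 : 1 ≤ i) (hi2 : i ≤ N) (hk1 : 1 ≤ k) (hk2 : k ≤ N) : X i k = 0 := by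
  let S : Set P.A := {a | ∃ i k, 1 ≤ i ∧ i ≤ N ∧ 1 ≤ k ∧ k ≤ N ∧ a = X i k}
  have hS : ∀ i k, 1 ≤ i → i ≤ N → 1 ≤ k → k ≤ N → X i k ∈ Submodule.span ℂ S :=
    fun i k h1 h2 h3 h4 => Submodule.subset_span ⟨i, k, h1, h2, h3, h4, rfl⟩
  refine P.eq_zero_of_stabL (W := Submodule.span ℂ S) (fun a ha => ?_) ?_ (hS i k hi1 hi2 hk1 hk2)
  · have : Submodule.span ℂ S ≤ LinearMap.ker (Coalgebra.counit (R := ℂ) (A := P.A)) := by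
      refine Submodule.span_le.2 ?_
      rintro _ ⟨i, k, h1, h2, h3, h4, rfl⟩
      exact hε i k h1 h2 h3 h4
    exact this ha
  · refine D.forall_mem_gens ?_ ?_ ?_ ?_ <;> intro c h1 h2 <;> refine P.mem_stabL_span.2 ?_ <;>
      rintro _ ⟨i, k, h3, h4, h5, h6, rfl⟩
    · rw [hX.E c h1 h2 i k h3 h4 h5 h6]
      refine add_mem ?_ (Submodule.smul_mem _ _ ?_) <;> split_ifs <;>
        first | exact zero_mem _ | (apply hS <;> omega)
    · rw [hX.F c h1 h2 i k h3 h4 h5 h6]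
      refine add_mem (Submodule.smul_mem _ _ ?_) ?_ <;> split_ifs <;>
        first | exact zero_mem _ | (apply hS <;> omega)
    · rw [hX.Kg c h1 h2 i k h3 h4 h5 h6]
      exact Submodule.smul_mem _ _ (hS i k h3 h4 h5 h6)
    · rw [hX.Ki c h1 h2 i k h3 h4 h5 h6]
      exact Submodule.smul_mem _ _ (hS i k h3 h4 h5 h6)

end QslnFun

namespace QslnFun

variable {q : ℝ} {N : ℕ} {D : UqslData q N} (P : QslnFun q N D)

section FRT

lemma braid_u (hq : (q : ℂ) ≠ 0) {i j k l : ℕ} (hi1 : 1 ≤ i) (hi2 : i ≤ N) (hk1 : 1 ≤ k)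
    (hk2 : k ≤ N) (hj1 : 1 ≤ j) (hj2 : j ≤ N) (hl1 : 1 ≤ l) (hl2 : l ≤ N) :
    braid (fun i k => P.u i j * P.u k l) i k =
      if j = l then (q : ℂ) • (P.u i j * P.u k l)
      else if j < l then P.u i l * P.u k j + ((q : ℂ) - (q : ℂ)⁻¹) • (P.u i j * P.u k l)
      else P.u i l * P.u k j := by
  have hX := isTens_u_mul_u (P := P) hj1 hj2 hl1 hl2
  have hX' := isTens_u_mul_u (P := P) hl1 hl2 hj1 hj2
  have hcu := fun i (h1 : 1 ≤ i) (h2 : i ≤ N) => P.counit_u' h1 h2 hj1 hj2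
  have hcu' := fun i (h1 : 1 ≤ i) (h2 : i ≤ N) => P.counit_u' h1 h2 hl1 hl2
  rcases lt_trichotomy j l with h | h | h
  · have := ((hX.braid hq).sub hX').sub (hX.smul ((q : ℂ) - (q : ℂ)⁻¹))
    have := this.eq_zero (fun i k h1 h2 h3 h4 => ?_) hi1 hi2 hk1 hk2
    · rw [if_neg h.ne, if_pos h, ← sub_eq_zero, ← this]; abel
    · simp only [map_sub, map_smul, braid]
      rcases lt_trichotomy i k with h' | h' | h' <;>
      simp (disch := omega) only [if_pos, if_neg, map_add, map_smul, Bialgebra.counit_mul, hcu,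
        hcu', h1, h2, h3, h4] <;> split_ifs <;> (try omega) <;> simp
  · subst h
    have := (hX.braid hq).sub (hX.smul (q : ℂ))
    have := this.eq_zero (fun i k h1 h2 h3 h4 => ?_) hi1 hi2 hk1 hk2
    · rw [if_pos rfl, ← sub_eq_zero, ← this]
    · simp only [map_sub, map_smul, braid]
      rcases lt_trichotomy i k with h' | h' | h' <;>
      simp (disch := omega) only [if_pos, if_neg, map_add, map_smul, Bialgebra.counit_mul, hcu,
        hcu', h1, h2, h3, h4] <;> split_ifs <;> (try omega) <;> simp
  · have := (hX.braid hq).sub hX'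
    have := this.eq_zero (fun i k h1 h2 h3 h4 => ?_) hi1 hi2 hk1 hk2
    · rw [if_neg h.ne', if_neg (by omega), ← sub_eq_zero, ← this]
    · simp only [map_sub, map_smul, braid]
      rcases lt_trichotomy i k with h' | h' | h' <;>
      simp (disch := omega) only [if_pos, if_neg, map_add, map_smul, Bialgebra.counit_mul, hcu,
        hcu', h1, h2, h3, h4] <;> split_ifs <;> (try omega) <;> simp

variable (hq : (q : ℂ) ≠ 0) {i j k l : ℕ} (hi1 : 1 ≤ i) (hj1 : 1 ≤ j)
include hq hi1 hj1

lemma u_row (hi2 : i ≤ N) (hjl : j < l) (hl2 : l ≤ N) :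
    P.u i j * P.u i l = (q : ℂ) • (P.u i l * P.u i j) := by
  have := P.braid_u hq hi1 hi2 hi1 hi2 (hj1.trans hjl.le) hl2 hj1 (by omega)
  rw [braid, if_pos rfl, if_neg hjl.ne', if_neg (by omega)] at this
  exact this.symm

lemma u_col (hj2 : j ≤ N) (hik : i < k) (hk2 : k ≤ N) :
    P.u i j * P.u k j = (q : ℂ) • (P.u k j * P.u i j) := by
  have := P.braid_u hq (hi1.trans hik.le) hk2 hi1 (by omega) hj1 hj2 hj1 hj2
  rwa [braid, if_neg hik.ne', if_neg (by omega), if_pos rfl] at this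

lemma u_anti (hik : i < k) (hk2 : k ≤ N) (hjl : j < l) (hl2 : l ≤ N) :
    P.u i l * P.u k j = P.u k j * P.u i l := by
  have := P.braid_u hq (hi1.trans hik.le) hk2 hi1 (by omega) (hj1.trans hjl.le) hl2 hj1 (by omega)
  simpa (disch := omega) only [braid, if_pos, if_neg, eq_comm] using this

lemma u_diag (hik : i < k) (hk2 : k ≤ N) (hjl : j < l) (hl2 : l ≤ N) :
    P.u i j * P.u k l = P.u k l * P.u i j + ((q : ℂ) - (q : ℂ)⁻¹) • (P.u k j * P.u i l) := by
  have := P.braid_u hq (hi1.trans hik.le) hk2 hi1 (by omega) hj1 (by omega) (hj1.trans hjl.le) hl2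
  simpa (disch := omega) only [braid, if_pos, if_neg, eq_comm] using this

end FRT

section Det

/-- The sign weight in the expansion of a quantum minor along its first row. -/
def sgnw (q : ℝ) (S : Finset ℕ) (j : ℕ) : ℂ := (-(q : ℂ)) ^ (S.filter (· < j)).card

/-- Quantum minors. -/
def minor : List ℕ → Finset ℕ → P.A
  | [], S => if S = ∅ then 1 else 0
  | i :: rows, S => ∑ j ∈ S, sgnw q S j • (P.u i j * minor rows (S.erase j))

variable {c : ℕ} (h1 : 1 ≤ c) (h2 : c < N)

lemma sgnw_succ {S : Finset ℕ} {c : ℕ} (hc : c ∈ S) :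
    sgnw q S (c + 1) = -(q : ℂ) * sgnw q S c := by
  have : S.filter (· < c + 1) = insert c (S.filter (· < c)) := by
    ext j; simp only [Finset.mem_filter, Finset.mem_insert]
    constructor
    · rintro ⟨h, h'⟩; rcases Nat.lt_succ_iff_lt_or_eq.1 h' with h' | h' <;> simp [*]
    · rintro (rfl | ⟨h, h'⟩)
      · simp [hc]
      · exact ⟨h, by omega⟩
  rw [sgnw, sgnw, this, Finset.card_insert_of_notMem (by simp), pow_succ']

lemma sgnw_swap {S : Finset ℕ} {c d j : ℕ} (hc : c ∉ S) (hd : d ∈ S) (h : d < j ↔ c < j) :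
    sgnw q (insert c (S.erase d)) j = sgnw q S j := by
  rw [sgnw, sgnw]
  congr 1
  by_cases hj : d < j
  · rw [Finset.filter_insert, if_pos (h.1 hj), Finset.card_insert_of_notMem (by simp [hc]),
      Finset.filter_erase, Finset.card_erase_of_mem (by simp [hd, hj])]
    have : 0 < (S.filter (· < j)).card := Finset.card_pos.2 ⟨d, by simp [hd, hj]⟩
    omega
  · rw [Finset.filter_insert, if_neg (by rwa [← h]), Finset.filter_erase,
      Finset.erase_eq_of_notMem (by simp [hj])]

include h1 h2

lemma hitR_Kg_minor (rows : List ℕ) (hr : ∀ i ∈ rows, 1 ≤ i ∧ i ≤ N) (S : Finset ℕ)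
    (hS : ∀ j ∈ S, 1 ≤ j ∧ j ≤ N) :
    P.hitR (D.Kg c) (P.minor rows S) = (∏ j ∈ S, kap q c j) • P.minor rows S := by
  induction rows generalizing S with
  | nil =>
    rw [minor]
    split_ifs with h
    · simp [h, hitR_oneA, UqslData.counit_Kg' h1 h2]
    · simp
  | cons i rows ih =>
    rw [minor, map_sum, Finset.smul_sum]
    refine Finset.sum_congr rfl fun j hj => ?_
    rw [map_smul, P.hitR_Kg_mul h1 h2, ih (fun i hi => hr i (by simp [hi])) _
      fun j' hj' => hS j' (Finset.mem_of_mem_erase hj'),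
      P.hitR_Kg_u (hr i (by simp)).1 (hr i (by simp)).2 (hS j hj).1 (hS j hj).2 h1 h2,
      ← Finset.mul_prod_erase S _ hj, smul_mul_smul_comm, smul_comm]
    rfl

lemma hitR_Ki_minor (rows : List ℕ) (hr : ∀ i ∈ rows, 1 ≤ i ∧ i ≤ N) (S : Finset ℕ)
    (hS : ∀ j ∈ S, 1 ≤ j ∧ j ≤ N) :
    P.hitR (D.Ki c) (P.minor rows S) = (∏ j ∈ S, kap' q c j) • P.minor rows S := by
  induction rows generalizing S with
  | nil =>
    rw [minor]
    split_ifs with h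
    · simp [h, hitR_oneA, UqslData.counit_Ki' h1 h2]
    · simp
  | cons i rows ih =>
    rw [minor, map_sum, Finset.smul_sum]
    refine Finset.sum_congr rfl fun j hj => ?_
    rw [map_smul, P.hitR_Ki_mul h1 h2, ih (fun i hi => hr i (by simp [hi])) _
      fun j' hj' => hS j' (Finset.mem_of_mem_erase hj'),
      P.hitR_Ki_u (hr i (by simp)).1 (hr i (by simp)).2 (hS j hj).1 (hS j hj).2 h1 h2,
      ← Finset.mul_prod_erase S _ hj, smul_mul_smul_comm, smul_comm]
    rfl

lemma hitR_E_minor (hq : (q : ℂ) ≠ 0) (rows : List ℕ) (hr : ∀ i ∈ rows, 1 ≤ i ∧ i ≤ N)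
    (S : Finset ℕ) (hS : ∀ j ∈ S, 1 ≤ j ∧ j ≤ N) :
    P.hitR (D.E c) (P.minor rows S) =
      if c + 1 ∈ S ∧ c ∉ S then P.minor rows (insert c (S.erase (c + 1))) else 0 := by
  induction rows generalizing S with
  | nil =>
    have : P.hitR (D.E c) (P.minor [] S) = 0 := by
      rw [minor]; split_ifs <;> simp [hitR_oneA, UqslData.counit_E' h1 h2]
    rw [this]; split_ifs with h
    · simp [minor]
    · rfl
  | cons i rows ih =>
    have ih' : ∀ j, _ := fun j => ih (fun i hi => hr i (by simp [hi])) (S.erase j)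
      fun j' hj' => hS j' (Finset.mem_of_mem_erase hj')
    have key : ∀ j ∈ S, P.hitR (D.E c) (sgnw q S j • (P.u i j * P.minor rows (S.erase j))) =
        sgnw q S j • ((if j = c + 1 then P.u i c * P.minor rows (S.erase j) else 0) +
          kap q c j • (P.u i j * P.hitR (D.E c) (P.minor rows (S.erase j)))) := fun j hj => by
      rw [map_smul, P.hitR_E_mul h1 h2,
        P.hitR_E_u (hr i (by simp)).1 (hr i (by simp)).2 (hS j hj).1 (hS j hj).2 h1 h2,
        P.hitR_Kg_u (hr i (by simp)).1 (hr i (by simp)).2 (hS j hj).1 (hS j hj).2 h1 h2, kap]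
      congr 2
      · split_ifs <;> simp
      · rw [smul_mul_assoc]
    rw [minor, map_sum, Finset.sum_congr rfl key]
    by_cases hd : c + 1 ∈ S
    · by_cases hc : c ∈ S
      · have hA := ih' (c + 1)
        have hC := ih' c
        rw [if_neg (by simp)] at hA
        rw [if_pos (by simp [hd]), show insert c ((S.erase c).erase (c + 1)) = S.erase (c + 1) by
            rw [Finset.erase_right_comm, Finset.insert_erase (by simp [hc])]] at hC
        rw [if_neg (by simp [hc]), ← Finset.add_sum_erase S _ hd,
          ← Finset.add_sum_erase (S.erase (c + 1)) _ (a := c) (by simp [hc]), Finset.sum_eq_zero,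
          hA, hC, if_pos rfl, if_neg (by simp), sgnw_succ hc]
        · simp only [smul_zero, mul_zero, kap, if_true]
          module
        · intro j hj
          simp only [Finset.mem_erase] at hj
          rw [if_neg hj.2.1, ih', if_neg (by simp [hc, Ne.symm hj.1])]; simp
      · have hA := ih' (c + 1)
        rw [if_neg (by simp)] at hA
        rw [if_pos ⟨hd, hc⟩, minor, Finset.sum_insert (by simp [hc]),
          ← Finset.add_sum_erase S _ hd, hA, if_pos rfl, Finset.erase_insert (by simp [hc])]
        congr 1
        · have : sgnw q S (c + 1) = sgnw q (insert c (S.erase (c + 1))) c := by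
            rw [sgnw, sgnw]; congr 2; ext j
            simp only [Finset.mem_filter, Finset.mem_insert, Finset.mem_erase]
            constructor
            · rintro ⟨h, h'⟩
              have : j ≠ c := fun e => hc (e ▸ h)
              exact ⟨Or.inr ⟨by omega, h⟩, by omega⟩
            · rintro ⟨h | h, h'⟩
              · omega
              · exact ⟨h.2, by omega⟩
          rw [this]; simp
        · refine Finset.sum_congr rfl fun j hj => ?_
          simp only [Finset.mem_erase] at hj
          have hjc : j ≠ c := fun e => hc (e ▸ hj.2)
          rw [if_neg hj.1, ih', if_pos (by simp [hd, hc, Ne.symm hj.1]), zero_add,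
            sgnw_swap hc hd (by omega), kap, if_neg hjc, if_neg hj.1, one_smul,
            Finset.erase_insert_of_ne hjc.symm, Finset.erase_right_comm]
    · rw [if_neg (by simp [hd])]
      refine Finset.sum_eq_zero fun j hj => ?_
      rw [if_neg (fun h : j = c + 1 => hd (h ▸ hj)), ih', if_neg (by simp [hd])]; simp

lemma hitR_F_minor (hq : (q : ℂ) ≠ 0) (rows : List ℕ) (hr : ∀ i ∈ rows, 1 ≤ i ∧ i ≤ N)
    (S : Finset ℕ) (hS : ∀ j ∈ S, 1 ≤ j ∧ j ≤ N) :
    P.hitR (D.F c) (P.minor rows S) =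
      if c ∈ S ∧ c + 1 ∉ S then P.minor rows (insert (c + 1) (S.erase c)) else 0 := by
  induction rows generalizing S with
  | nil =>
    have : P.hitR (D.F c) (P.minor [] S) = 0 := by
      rw [minor]; split_ifs <;> simp [hitR_oneA, UqslData.counit_F' h1 h2]
    rw [this]; split_ifs with h
    · simp [minor]
    · rfl
  | cons i rows ih =>
    have ih' : ∀ j, _ := fun j => ih (fun i hi => hr i (by simp [hi])) (S.erase j)
      fun j' hj' => hS j' (Finset.mem_of_mem_erase hj')
    have key : ∀ j ∈ S, P.hitR (D.F c) (sgnw q S j • (P.u i j * P.minor rows (S.erase j))) =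
        sgnw q S j • ((if j = c then (∏ j' ∈ S.erase j, kap' q c j') •
            (P.u i (c + 1) * P.minor rows (S.erase j)) else 0) +
          P.u i j * P.hitR (D.F c) (P.minor rows (S.erase j))) := fun j hj => by
      rw [map_smul, P.hitR_F_mul h1 h2,
        P.hitR_F_u (hr i (by simp)).1 (hr i (by simp)).2 (hS j hj).1 (hS j hj).2 h1 h2,
        P.hitR_Ki_minor h1 h2 rows (fun i hi => hr i (by simp [hi])) _
          fun j' hj' => hS j' (Finset.mem_of_mem_erase hj')]
      congr 2
      split_ifs <;> simp
    rw [minor, map_sum, Finset.sum_congr rfl key]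
    have hprod : ∀ T : Finset ℕ, c ∉ T → ∏ j' ∈ T, kap' q c j' = if c + 1 ∈ T then (q : ℂ) else 1 := by
      intro T hT
      have : ∀ j ∈ T, kap' q c j = if j = c + 1 then (q : ℂ) else 1 := fun j hj => by
        rw [kap', if_neg (fun h : j = c => hT (h ▸ hj))]
      rw [Finset.prod_congr rfl this, Finset.prod_ite_eq']
    by_cases hd : c ∈ S
    · by_cases hc : c + 1 ∈ S
      · have hA := ih' (c + 1)
        have hC := ih' c
        rw [if_neg (by simp)] at hC
        rw [if_pos (by simp [hd]), show insert (c + 1) ((S.erase (c + 1)).erase c) = S.erase c by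
            rw [Finset.erase_right_comm, Finset.insert_erase (by simp [hc])]] at hA
        rw [if_neg (by simp [hc]), ← Finset.add_sum_erase S _ hc,
          ← Finset.add_sum_erase (S.erase (c + 1)) _ (a := c) (by simp [hd]), Finset.sum_eq_zero,
          hA, hC, if_pos rfl, if_neg (by simp), sgnw_succ hd, hprod (S.erase c) (by simp),
          if_pos (by simp [hc])]
        · simp only [mul_zero]
          module
        · intro j hj
          simp only [Finset.mem_erase] at hj
          rw [if_neg hj.1, ih', if_neg (by simp [hc, Ne.symm hj.2.1])]; simp
      · have hC := ih' c
        rw [if_neg (by simp)] at hC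
        rw [if_pos ⟨hd, hc⟩, minor, Finset.sum_insert (by simp [hc]),
          ← Finset.add_sum_erase S _ hd, hC, if_pos rfl,
          Finset.erase_insert (by simp [hc]), hprod _ (by simp), if_neg (by simp [hc])]
        congr 1
        · have : sgnw q S c = sgnw q (insert (c + 1) (S.erase c)) (c + 1) := by
            rw [sgnw, sgnw]; congr 2; ext j
            simp only [Finset.mem_filter, Finset.mem_insert, Finset.mem_erase]
            constructor
            · rintro ⟨h, h'⟩
              exact ⟨Or.inr ⟨by omega, h⟩, by omega⟩
            · rintro ⟨h | h, h'⟩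
              · omega
              · exact ⟨h.2, by omega⟩
          rw [this]; simp
        · refine Finset.sum_congr rfl fun j hj => ?_
          simp only [Finset.mem_erase] at hj
          have hjc : j ≠ c + 1 := fun e => hc (e ▸ hj.2)
          rw [if_neg hj.1, ih', if_pos (by simp [hd, hc, Ne.symm hj.1]), zero_add,
            sgnw_swap hc hd (by omega),
            Finset.erase_insert_of_ne hjc.symm, Finset.erase_right_comm]
    · rw [if_neg (by simp [hd])]
      refine Finset.sum_eq_zero fun j hj => ?_
      rw [if_neg (fun h : j = c => hd (h ▸ hj)), ih', if_neg (by simp [hd])]; simp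

omit h1 h2

lemma counit_minor (n i : ℕ) (hi : 1 ≤ i) (hin : i + n ≤ N + 1) :
    ε (P.minor (List.range' i n) (Finset.Ico i (i + n))) = 1 := by
  induction n generalizing i with
  | zero => simp [minor]
  | succ n ih =>
    rw [List.range'_succ, minor, map_sum, Finset.sum_eq_single i]
    · rw [map_smul, Bialgebra.counit_mul, P.counit_u' hi (by omega) hi (by omega), if_pos rfl,
        show (Finset.Ico i (i + (n + 1))).erase i = Finset.Ico (i + 1) (i + 1 + n) by
          ext j; simp; omega, ih (i + 1) (by omega) (by omega), sgnw,
        Finset.filter_false_of_mem (by simp; omega)]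
      simp
    · intro j hj hji
      simp only [Finset.mem_Ico] at hj
      rw [map_smul, Bialgebra.counit_mul, P.counit_u' hi (by omega) (by omega) (by omega),
        if_neg hji.symm]
      simp
    · intro h; simp at h

/-- The quantum determinant is trivial. -/
lemma minor_full (hq : (q : ℂ) ≠ 0) : P.minor (List.range' 1 N) (Finset.Ico 1 (1 + N)) = 1 := by
  have hr : ∀ i ∈ List.range' 1 N, 1 ≤ i ∧ i ≤ N := by simp; omega
  have hS : ∀ i ∈ Finset.Ico 1 (1 + N), 1 ≤ i ∧ i ≤ N := by simp; omega
  rw [P.eq_smul_one_of_fixR (a := P.minor _ _), counit_minor _ _ _ le_rfl (by omega), one_smul]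
  refine D.forall_mem_gens ?_ ?_ ?_ ?_ <;> intro c h1 h2
  · change P.hitR _ _ = _
    rw [P.hitR_E_minor h1 h2 hq _ hr _ hS, UqslData.counit_E' h1 h2, if_neg, zero_smul]
    simp; omega
  · change P.hitR _ _ = _
    rw [P.hitR_F_minor h1 h2 hq _ hr _ hS, UqslData.counit_F' h1 h2, if_neg, zero_smul]
    simp; omega
  · change P.hitR _ _ = _
    rw [P.hitR_Kg_minor h1 h2 _ hr _ hS, UqslData.counit_Kg' h1 h2]
    congr 1
    rw [← Finset.mul_prod_erase _ _ (a := c) (by simp; omega),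
      ← Finset.mul_prod_erase _ _ (a := c + 1) (by simp; omega), Finset.prod_eq_one]
    · simp [kap, hq]
    · intro j hj; simp at hj; simp [kap, hj]
  · change P.hitR _ _ = _
    rw [P.hitR_Ki_minor h1 h2 _ hr _ hS, UqslData.counit_Ki' h1 h2]
    congr 1
    rw [← Finset.mul_prod_erase _ _ (a := c) (by simp; omega),
      ← Finset.mul_prod_erase _ _ (a := c + 1) (by simp; omega), Finset.prod_eq_one]
    · simp [kap', hq]
    · intro j hj; simp at hj; simp [kap', hj]

end Det

end QslnFun

section StableComplement

open scoped InnerProductSpace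

variable {G M : Type*} [AddCommGroup M] [Module ℂ M]

/-- A subspace is stable under a family of operators. -/
def IsStableUnder (T : G → M →ₗ[ℂ] M) (W : Submodule ℂ M) : Prop :=
  ∀ g, ∀ a ∈ W, T g a ∈ W

/-- The module over the free algebra attached to a family of operators. -/
abbrev freeAlgebraModule (T : G → M →ₗ[ℂ] M) : Module (FreeAlgebra ℂ G) M :=
  Module.compHom M (FreeAlgebra.lift ℂ T : FreeAlgebra ℂ G →ₐ[ℂ] Module.End ℂ M).toRingHom

/-- A stable subspace is a submodule over the free algebra. -/
def IsStableUnder.toSubmodule {T : G → M →ₗ[ℂ] M} {W : Submodule ℂ M} (h : IsStableUnder T W) :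
    letI := freeAlgebraModule T
    Submodule (FreeAlgebra ℂ G) M :=
  letI := freeAlgebraModule T
  { carrier := W
    add_mem' := W.add_mem
    zero_mem' := W.zero_mem
    smul_mem' := fun r => by
      change ∀ a ∈ W, FreeAlgebra.lift ℂ T r a ∈ W
      induction r using FreeAlgebra.induction with
      | grade0 c => intro a ha; simpa [Module.algebraMap_end_apply] using W.smul_mem c ha
      | grade1 g => intro a ha; simpa using h g a ha
      | mul r s hr hs => intro a ha; simpa using hr _ (hs a ha)
      | add r s hr hs => intro a ha; simpa using W.add_mem (hr a ha) (hs a ha) }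

/-- A submodule over the free algebra, as a subspace. -/
def toSubspace (T : G → M →ₗ[ℂ] M) :
    letI := freeAlgebraModule T
    Submodule (FreeAlgebra ℂ G) M → Submodule ℂ M :=
  letI := freeAlgebraModule T
  fun p =>
  { carrier := p
    add_mem' := p.add_mem
    zero_mem' := p.zero_mem
    smul_mem' := fun c a ha => by
      have : (algebraMap ℂ (FreeAlgebra ℂ G) c) • a ∈ p := p.smul_mem _ ha
      have e : (algebraMap ℂ (FreeAlgebra ℂ G) c) • a = c • a := by
        change FreeAlgebra.lift ℂ T (algebraMap ℂ (FreeAlgebra ℂ G) c) a = _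
        simp [Module.algebraMap_end_apply]
      rwa [e] at this }

lemma isStableUnder_toSubspace (T : G → M →ₗ[ℂ] M) :
    letI := freeAlgebraModule T
    ∀ p : Submodule (FreeAlgebra ℂ G) M, IsStableUnder T (toSubspace T p) := by
  letI := freeAlgebraModule T
  intro p g a ha
  have : (FreeAlgebra.ι ℂ g) • a ∈ p := p.smul_mem _ ha
  have e : (FreeAlgebra.ι ℂ g) • a = T g a := by
    change FreeAlgebra.lift ℂ T (FreeAlgebra.ι ℂ g) a = _
    simp
  rwa [e] at this

/-- If the operators are semisimple because `M` is a sum of images of finite-dimensional unitary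
pieces, then stable subspaces have stable complements. -/
theorem exists_isCompl_isStableUnder (T : G → M →ₗ[ℂ] M) {J : Type*} {X : J → Type*}
    [∀ j, NormedAddCommGroup (X j)] [∀ j, InnerProductSpace ℂ (X j)]
    [∀ j, FiniteDimensional ℂ (X j)] (TX : ∀ j, G → X j →ₗ[ℂ] X j)
    (adj : ∀ g, ∃ g', ∀ j v w, ⟪TX j g v, w⟫_ℂ = ⟪v, TX j g' w⟫_ℂ)
    (f : ∀ j, X j →ₗ[ℂ] M) (hf : ∀ j g v, f j (TX j g v) = T g (f j v))
    (htop : ⨆ j, LinearMap.range (f j) = ⊤) {W : Submodule ℂ M} (hW : IsStableUnder T W) :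
    ∃ C : Submodule ℂ M, IsCompl W C ∧ IsStableUnder T C := by
  letI := freeAlgebraModule T
  letI := fun j => freeAlgebraModule (TX j)
  have hX : ∀ j, IsSemisimpleModule (FreeAlgebra ℂ G) (X j) := fun j => by
    refine @IsSemisimpleModule.mk _ _ _ _ _ ⟨fun p => ?_⟩
    have hp := isStableUnder_toSubspace (TX j) p
    have ho : IsStableUnder (TX j) (toSubspace (TX j) p)ᗮ := by
      intro g a ha
      obtain ⟨g', hg'⟩ := adj g
      rw [Submodule.mem_orthogonal'] at ha ⊢
      intro u hu
      rw [hg']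
      exact ha _ (hp g' u hu)
    refine ⟨ho.toSubmodule, ?_, ?_⟩
    · rw [Submodule.disjoint_def]
      intro x hx hx'
      exact Submodule.disjoint_def.1 (toSubspace (TX j) p).isCompl_orthogonal.disjoint x hx hx'
    · rw [Submodule.codisjoint_iff_exists_add_eq]
      intro z
      exact Submodule.codisjoint_iff_exists_add_eq.1
        (toSubspace (TX j) p).isCompl_orthogonal.codisjoint z
  let F : ∀ j, X j →ₗ[FreeAlgebra ℂ G] M := fun j =>
    { toFun := f j
      map_add' := map_add _
      map_smul' := fun r => by
        change ∀ v, f j (FreeAlgebra.lift ℂ (TX j) r v) = FreeAlgebra.lift ℂ T r (f j v)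
        induction r using FreeAlgebra.induction with
        | grade0 c => intro v; simp [Module.algebraMap_end_apply]
        | grade1 g => intro v; simpa using hf j g v
        | mul r s hr hs => intro v; simp [hr, hs]
        | add r s hr hs => intro v; simp [hr, hs] }
  have hM : IsSemisimpleModule (FreeAlgebra ℂ G) M := by
    refine isSemisimpleModule_of_isSemisimpleModule_submodule' (p := fun j => LinearMap.range (F j))
      (fun j => by haveI := hX j; exact IsSemisimpleModule.range (F j)) ?_
    rw [eq_top_iff]
    rintro x -
    have hx : x ∈ ⨆ j, LinearMap.range (f j) := htop ▸ Submodule.mem_top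
    have : ⨆ j, LinearMap.range (f j) ≤ toSubspace T (⨆ j, LinearMap.range (F j)) := by
      refine iSup_le fun j => ?_
      rintro _ ⟨v, rfl⟩
      exact (le_iSup (fun j => LinearMap.range (F j)) j : _) ⟨v, rfl⟩
    exact this hx
  obtain ⟨C, hC⟩ := hM.exists_isCompl hW.toSubmodule
  refine ⟨toSubspace T C, ⟨?_, ?_⟩, isStableUnder_toSubspace T C⟩
  · rw [Submodule.disjoint_def]
    intro x hx hx'
    exact Submodule.disjoint_def.1 hC.disjoint x hx hx'
  · rw [Submodule.codisjoint_iff_exists_add_eq]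
    intro z
    exact Submodule.codisjoint_iff_exists_add_eq.1 hC.codisjoint z

/-- In a semisimple situation every stable subspace is the sum of its `χ`-isotypic part and a part
of the span of the `T g a - χ g a`. -/
theorem le_inf_sup_of_compl {T : G → M →ₗ[ℂ] M} (χ : G → ℂ)
    (hc : ∀ W, IsStableUnder T W → ∃ C : Submodule ℂ M, IsCompl W C ∧ IsStableUnder T C)
    {W : Submodule ℂ M} (hW : IsStableUnder T W) :
    W ≤ (W ⊓ ⨅ g, LinearMap.ker (T g - χ g • LinearMap.id)) ⊔
      Submodule.span ℂ {x | ∃ g, ∃ a ∈ W, x = T g a - χ g • a} := by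
  set I : Submodule ℂ M := ⨅ g, LinearMap.ker (T g - χ g • LinearMap.id)
  have hI : ∀ {a}, a ∈ I ↔ ∀ g, T g a = χ g • a := fun {a} => by
    simp [I, sub_eq_zero]
  have hWI : IsStableUnder T (W ⊓ I) := fun g a ha => by
    refine ⟨hW g a ha.1, ?_⟩
    rw [hI.1 ha.2 g]; exact I.smul_mem _ ha.2
  obtain ⟨C', hC', hC's⟩ := hc _ hWI
  have hC : IsStableUnder T (C' ⊓ W) := fun g a ha => ⟨hC's g a ha.1, hW g a ha.2⟩
  set Q := Submodule.span ℂ {x | ∃ g, ∃ a ∈ C' ⊓ W, x = T g a - χ g • a}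
  have hQC : Q ≤ C' ⊓ W := Submodule.span_le.2 (by
    rintro _ ⟨g, a, ha, rfl⟩
    exact sub_mem (hC g a ha) (Submodule.smul_mem _ _ ha))
  have hQ : IsStableUnder T Q := fun g a ha => by
    have : T g a = (T g a - χ g • a) + χ g • a := by abel
    rw [this]
    exact add_mem (Submodule.subset_span ⟨g, a, hQC ha, rfl⟩) (Q.smul_mem _ ha)
  obtain ⟨Q', hQ', hQ's⟩ := hc _ hQ
  have hle : C' ⊓ W ≤ Q := by
    intro a ha
    obtain ⟨y, z, hy, hz, rfl⟩ := Submodule.codisjoint_iff_exists_add_eq.1 hQ'.codisjoint a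
    have hzC : z ∈ C' ⊓ W := by
      have := sub_mem ha (hQC hy); simpa using this
    have hzI : z ∈ I := hI.2 fun g => by
      rw [← sub_eq_zero]
      exact Submodule.disjoint_def.1 hQ'.disjoint _ (Submodule.subset_span ⟨g, z, hzC, rfl⟩)
        (sub_mem (hQ's g z hz) (Q'.smul_mem _ hz))
    have : z = 0 := Submodule.disjoint_def.1 hC'.disjoint z ⟨hzC.2, hzI⟩ hzC.1
    rw [this, add_zero]; exact hy
  intro a ha
  obtain ⟨y, z, hy, hz, rfl⟩ := Submodule.codisjoint_iff_exists_add_eq.1 hC'.codisjoint a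
  refine Submodule.add_mem_sup hy ?_
  have hzW : z ∈ W := by simpa using sub_mem ha hy.1
  refine Submodule.span_mono ?_ (hle ⟨hz, hzW⟩)
  rintro _ ⟨g, a, ha, rfl⟩
  exact ⟨g, a, ha.2, rfl⟩

theorem disjoint_of_compl {T : G → M →ₗ[ℂ] M} (χ : G → ℂ)
    (hc : ∀ W, IsStableUnder T W → ∃ C : Submodule ℂ M, IsCompl W C ∧ IsStableUnder T C) {a : M}
    (ha : ∀ g, T g a = χ g • a)
    (ha' : a ∈ Submodule.span ℂ {x | ∃ g, ∃ a, x = T g a - χ g • a}) : a = 0 := by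
  set I : Submodule ℂ M := ⨅ g, LinearMap.ker (T g - χ g • LinearMap.id)
  have hI : ∀ {a}, a ∈ I ↔ ∀ g, T g a = χ g • a := fun {a} => by
    simp [I, sub_eq_zero]
  have hIs : IsStableUnder T I := fun g a ha => by
    rw [hI.1 ha g]; exact I.smul_mem _ ha
  obtain ⟨C, hC, hCs⟩ := hc _ hIs
  refine Submodule.disjoint_def.1 hC.disjoint a (hI.2 ha) ?_
  refine Submodule.span_le.2 ?_ ha'
  rintro _ ⟨g, x, rfl⟩
  obtain ⟨y, z, hy, hz, rfl⟩ := Submodule.codisjoint_iff_exists_add_eq.1 hC.codisjoint x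
  rw [map_add, hI.1 hy g]
  have : χ g • y + T g z - χ g • (y + z) = T g z - χ g • z := by module
  rw [this]
  exact sub_mem (hCs g z hz) (C.smul_mem _ hz)

end StableComplement

namespace QslnFun

/-- Multi-indices of length `n` with entries in `{1, …, N}`. -/
def Idx (N : ℕ) : ℕ → Type
  | 0 => Unit
  | n + 1 => ↥(Finset.Icc 1 N) × Idx N n

instance Idx.instFintype (N : ℕ) : ∀ n, Fintype (Idx N n)
  | 0 => inferInstanceAs (Fintype Unit)
  | n + 1 =>
    letI := Idx.instFintype N n
    inferInstanceAs (Fintype (↥(Finset.Icc 1 N) × Idx N n))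

instance Idx.instDecidableEq (N n : ℕ) : DecidableEq (Idx N n) := Classical.decEq _

variable {q : ℝ} {N : ℕ} {D : UqslData q N} (P : QslnFun q N D)

/-- Matrix coefficients of the tensor powers of the fundamental representation. -/
def uw : ∀ n, Idx N n → Idx N n → P.A
  | 0, _, _ => 1
  | n + 1, I, J => P.u I.1 J.1 * uw n I.2 J.2

lemma comul_uw (n : ℕ) (I J : Idx N n) :
    Δ (P.uw n I J) = ∑ K, P.uw n I K ⊗ₜ[ℂ] P.uw n K J := by
  induction n with
  | zero =>
    have : ∑ K : Idx N 0, P.uw 0 I K ⊗ₜ[ℂ] P.uw 0 K J = 1 ⊗ₜ 1 :=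
      Fintype.sum_unique (ι := Unit) fun _ => (1 : P.A) ⊗ₜ[ℂ] (1 : P.A)
    rw [this]
    simp [uw, Algebra.TensorProduct.one_def]
  | succ n ih =>
    rw [uw, Bialgebra.comul_mul, ih, P.comul_u _ I.1.2 _ J.1.2]
    change _ = ∑ K : ↥(Finset.Icc 1 N) × Idx N n, _
    rw [Fintype.sum_prod_type, ← Finset.sum_coe_sort, Finset.sum_mul_sum]
    simp only [Algebra.TensorProduct.tmul_mul_tmul]
    rfl

lemma hitL_uw (n : ℕ) (x : D.U) (I J : Idx N n) :
    P.hitL x (P.uw n I J) = ∑ K, P.pair x (P.uw n I K) • P.uw n K J := by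
  simp [hitL, comul_uw]

/-- `x` and `x'` act by mutually adjoint matrices on tensor powers of the fundamental
representation. -/
def IsAdj (x x' : D.U) : Prop :=
  ∀ n I J, (starRingEnd ℂ) (P.pair x (P.uw n I J)) = P.pair x' (P.uw n J I)

/-- `x` and `x'` act by mutually adjoint matrices on the fundamental representation. -/
def IsAdj₁ (x x' : D.U) : Prop :=
  ∀ i ∈ Finset.Icc 1 N, ∀ j ∈ Finset.Icc 1 N,
    (starRingEnd ℂ) (P.pair x (P.u i j)) = P.pair x' (P.u j i)

variable {P}

lemma IsAdj.symm {x x' : D.U} (h : P.IsAdj x x') : P.IsAdj x' x := fun n I J => by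
  rw [← h n J I, Complex.conj_conj]

lemma isAdj_of_comul {x s t s' t' x' σ τ σ' τ' : D.U} (hx : Δ x = s ⊗ₜ[ℂ] t + s' ⊗ₜ t')
    (hx' : Δ x' = σ ⊗ₜ[ℂ] τ + σ' ⊗ₜ τ') (h0 : (starRingEnd ℂ) (ε x) = ε x')
    (hs : P.IsAdj₁ s σ) (hs' : P.IsAdj₁ s' σ')
    (ht : (t = x ∧ τ = x') ∨ P.IsAdj t τ) (ht' : (t' = x ∧ τ' = x') ∨ P.IsAdj t' τ') :
    P.IsAdj x x' := by
  intro n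
  induction n with
  | zero => intro I J; simp [uw, P.pair_oneA, h0]
  | succ n ih =>
    intro I J
    have e : (starRingEnd ℂ) (P.pair t (P.uw n I.2 J.2)) = P.pair τ (P.uw n J.2 I.2) := by
      rcases ht with ⟨rfl, rfl⟩ | h
      exacts [ih _ _, h _ _ _]
    have e' : (starRingEnd ℂ) (P.pair t' (P.uw n I.2 J.2)) = P.pair τ' (P.uw n J.2 I.2) := by
      rcases ht' with ⟨rfl, rfl⟩ | h
      exacts [ih _ _, h _ _ _]
    rw [uw, uw, pair_mul₂ hx, pair_mul₂ hx', map_add, map_mul, map_mul,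
      hs _ I.1.2 _ J.1.2, hs' _ I.1.2 _ J.1.2, e, e']

lemma isAdj₁_zero : P.IsAdj₁ 0 0 := fun i _ j _ => by simp

lemma isAdj_zero : P.IsAdj 0 0 := fun i _ j => by simp

lemma isAdj₁_one : P.IsAdj₁ 1 1 := fun i hi j hj => by
  simp only [P.pair_oneU, P.counit_u i hi j hj, P.counit_u j hj i hi, eq_comm]
  split_ifs <;> simp

lemma isAdj_one : P.IsAdj 1 1 :=
  isAdj_of_comul (s := 1) (t := 1) (s' := 0) (t' := 0) (σ := 1) (τ := 1) (σ' := 0) (τ' := 0)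
    (by simp [Algebra.TensorProduct.one_def]) (by simp [Algebra.TensorProduct.one_def])
    (by simp) isAdj₁_one isAdj₁_zero (.inl ⟨rfl, rfl⟩) (.inr isAdj_zero)

section Gens

variable {c : ℕ} (h1 : 1 ≤ c) (h2 : c < N)
include h1 h2

lemma isAdj₁_Kg : P.IsAdj₁ (D.Kg c) (D.Kg c) := fun i hi j hj => by
  rw [P.pair_Kg c (UqslData.mem_Icc_pred h1 h2) i hi j hj,
    P.pair_Kg c (UqslData.mem_Icc_pred h1 h2) j hj i hi]
  by_cases h : i = j
  · subst h; split_ifs <;> simp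
  · simp [h, Ne.symm h]

lemma isAdj₁_Ki : P.IsAdj₁ (D.Ki c) (D.Ki c) := fun i hi j hj => by
  rw [P.pair_Ki c (UqslData.mem_Icc_pred h1 h2) i hi j hj,
    P.pair_Ki c (UqslData.mem_Icc_pred h1 h2) j hj i hi]
  by_cases h : i = j
  · subst h; split_ifs <;> simp
  · simp [h, Ne.symm h]

lemma isAdj_Kg : P.IsAdj (D.Kg c) (D.Kg c) :=
  isAdj_of_comul (UqslData.comul_Kg' h1 h2) (UqslData.comul_Kg' h1 h2)
    (by simp [UqslData.counit_Kg' h1 h2]) (isAdj₁_Kg h1 h2) isAdj₁_zero (.inl ⟨rfl, rfl⟩)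
    (.inr isAdj_zero)

lemma isAdj_Ki : P.IsAdj (D.Ki c) (D.Ki c) :=
  isAdj_of_comul (UqslData.comul_Ki' h1 h2) (UqslData.comul_Ki' h1 h2)
    (by simp [UqslData.counit_Ki' h1 h2]) (isAdj₁_Ki h1 h2) isAdj₁_zero (.inl ⟨rfl, rfl⟩)
    (.inr isAdj_zero)

lemma isAdj_E (hq : (q : ℂ) ≠ 0) : P.IsAdj (D.E c) ((q : ℂ)⁻¹ • (D.F c * D.Kg c)) := by
  have hF : Δ ((q : ℂ)⁻¹ • (D.F c * D.Kg c)) =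
      ((q : ℂ)⁻¹ • (D.F c * D.Kg c)) ⊗ₜ[ℂ] 1 + D.Kg c ⊗ₜ ((q : ℂ)⁻¹ • (D.F c * D.Kg c)) := by
    rw [map_smul, Bialgebra.comul_mul, UqslData.comul_F' h1 h2,
      D.comul_Kg c (UqslData.mem_Icc_pred h1 h2), add_mul, Algebra.TensorProduct.tmul_mul_tmul,
      Algebra.TensorProduct.tmul_mul_tmul, D.Ki_mul_Kg h1 h2, one_mul, smul_add,
      TensorProduct.smul_tmul', TensorProduct.tmul_smul]
  have h : P.IsAdj₁ (D.E c) ((q : ℂ)⁻¹ • (D.F c * D.Kg c)) := fun i hi j hj => by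
    rw [P.pair_E c (UqslData.mem_Icc_pred h1 h2) i hi j hj]
    simp only [Finset.mem_Icc] at hi hj
    rw [map_smul, LinearMap.smul_apply, ← P.pair_hitR, P.hitR_Kg_u hj.1 hj.2 hi.1 hi.2 h1 h2,
      map_smul, P.pair_F c (UqslData.mem_Icc_pred h1 h2) j (by simp [hj]) i (by simp [hi])]
    by_cases h : i = c ∧ j = c + 1
    · simp [h, hq]
    · rw [if_neg h]; simp; tauto
  exact isAdj_of_comul (UqslData.comul_E' h1 h2) hF
    (by simp [UqslData.counit_E' h1 h2, UqslData.counit_F' h1 h2]) h (isAdj₁_Kg h1 h2)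
    (.inr isAdj_one) (.inl ⟨rfl, rfl⟩)

lemma isAdj_F (hq : (q : ℂ) ≠ 0) : P.IsAdj (D.F c) ((q : ℂ) • (D.Ki c * D.E c)) := by
  have hE : Δ ((q : ℂ) • (D.Ki c * D.E c)) =
      ((q : ℂ) • (D.Ki c * D.E c)) ⊗ₜ[ℂ] D.Ki c + 1 ⊗ₜ ((q : ℂ) • (D.Ki c * D.E c)) := by
    rw [map_smul, Bialgebra.comul_mul, UqslData.comul_E' h1 h2,
      D.comul_Ki c (UqslData.mem_Icc_pred h1 h2), mul_add, Algebra.TensorProduct.tmul_mul_tmul,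
      Algebra.TensorProduct.tmul_mul_tmul, D.Ki_mul_Kg h1 h2, mul_one, smul_add,
      TensorProduct.smul_tmul', TensorProduct.tmul_smul]
  have h : P.IsAdj₁ (D.F c) ((q : ℂ) • (D.Ki c * D.E c)) := fun i hi j hj => by
    rw [P.pair_F c (UqslData.mem_Icc_pred h1 h2) i hi j hj]
    simp only [Finset.mem_Icc] at hi hj
    rw [map_smul, LinearMap.smul_apply, ← P.pair_hitL, P.hitL_Ki_u hj.1 hj.2 hi.1 hi.2 h1 h2,
      map_smul, P.pair_E c (UqslData.mem_Icc_pred h1 h2) j (by simp [hj]) i (by simp [hi])]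
    by_cases h : i = c + 1 ∧ j = c
    · simp [h, hq]
    · rw [if_neg h]; simp; tauto
  exact isAdj_of_comul (UqslData.comul_F' h1 h2) hE
    (by simp [UqslData.counit_E' h1 h2, UqslData.counit_F' h1 h2]) h isAdj₁_one
    (.inr (isAdj_Ki h1 h2)) (.inl ⟨rfl, rfl⟩)

end Gens

section Words

variable (P)

/-- The product of the letters of a word. -/
def wd (l : List (ℕ × ℕ)) : P.A := (l.map fun p => P.u p.1 p.2).prod

@[simp] lemma wd_nil : P.wd [] = 1 := rfl

@[simp] lemma wd_cons (p : ℕ × ℕ) (l : List (ℕ × ℕ)) : P.wd (p :: l) = P.u p.1 p.2 * P.wd l := by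
  simp [wd]

@[simp] lemma wd_append (l l' : List (ℕ × ℕ)) : P.wd (l ++ l') = P.wd l * P.wd l' := by
  simp [wd]

/-- The range of indices of the letters. -/
def Ltr (N : ℕ) (p : ℕ × ℕ) : Prop := 1 ≤ p.1 ∧ p.1 ≤ N ∧ 1 ≤ p.2 ∧ p.2 ≤ N

lemma span_wd : Submodule.span ℂ (P.wd '' {l | ∀ p ∈ l, Ltr N p}) = ⊤ := by
  have h := Algebra.adjoin_eq_span ℂ {x : P.A | ∃ i ∈ Finset.Icc 1 N, ∃ j ∈ Finset.Icc 1 N, x = P.u i j}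
  rw [P.genA, Algebra.top_toSubmodule] at h
  rw [h, eq_comm]
  congr 1
  ext a
  constructor
  · intro ha
    induction ha using Submonoid.closure_induction with
    | mem x hx =>
      obtain ⟨i, hi, j, hj, rfl⟩ := hx
      simp only [Finset.mem_Icc] at hi hj
      exact ⟨[(i, j)], by simp [Ltr, *], by simp⟩
    | one => exact ⟨[], by simp⟩
    | mul x y _ _ hx hy =>
      obtain ⟨l, hl, rfl⟩ := hx
      obtain ⟨l', hl', rfl⟩ := hy
      refine ⟨l ++ l', fun p hp => ?_, by simp⟩
      rcases List.mem_append.1 hp with h | h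
      exacts [hl p h, hl' p h]
  · rintro ⟨l, hl, rfl⟩
    refine Submonoid.list_prod_mem _ fun x hx => ?_
    obtain ⟨p, hp, rfl⟩ := List.mem_map.1 hx
    have := hl p hp
    exact Submonoid.subset_closure ⟨p.1, by simp [this.1, this.2.1], p.2, by simp [this.2.2], rfl⟩

lemma exists_uw_eq_wd (l : List (ℕ × ℕ)) (hl : ∀ p ∈ l, Ltr N p) :
    ∃ n I J, P.uw n I J = P.wd l := by
  induction l with
  | nil => exact ⟨0, (), (), rfl⟩
  | cons p l ih =>
    obtain ⟨n, I, J, h⟩ := ih fun p hp => hl p (by simp [hp])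
    have := hl p (by simp)
    refine ⟨n + 1, (⟨p.1, by simp [this.1, this.2.1]⟩, I), (⟨p.2, by simp [this.2.2]⟩, J), ?_⟩
    rw [wd_cons, ← h]; rfl

end Words

/-- Complete reducibility for star-closed sets of operators. -/
theorem exists_isCompl_of_star {S : Set D.U} (hS : ∀ x ∈ S, ∃ x' ∈ S, P.IsAdj x x')
    {M ι : Type*} [AddCommGroup M] [Module ℂ M] (T : D.U → M →ₗ[ℂ] M) (g : ι → P.A →ₗ[ℂ] M)
    (hg : ∀ s x a, g s (P.hitL x a) = T x (g s a)) (htop : ⨆ s, LinearMap.range (g s) = ⊤)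
    {W : Submodule ℂ M} (hW : IsStableUnder (fun x : S => T x) W) :
    ∃ C : Submodule ℂ M, IsCompl W C ∧ IsStableUnder (fun x : S => T x) C := by
  let Jt := (Σ n, Idx N n) × ι
  let f₀ : ∀ j : Jt, EuclideanSpace ℂ (Idx N j.1.1) →ₗ[ℂ] P.A := fun j =>
    (Fintype.linearCombination ℂ fun I => P.uw j.1.1 I j.1.2) ∘ₗ
      (WithLp.linearEquiv 2 ℂ _).toLinearMap
  refine exists_isCompl_isStableUnder (fun x : S => T x) (J := Jt)
    (X := fun j => EuclideanSpace ℂ (Idx N j.1.1))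
    (fun j x => Matrix.toEuclideanLin
      (Matrix.of fun I' I => P.pair x (P.uw j.1.1 I I'))) ?_ (fun j => g j.2 ∘ₗ f₀ j) ?_ ?_ hW
  · rintro ⟨x, hx⟩
    obtain ⟨x', hx', h⟩ := hS x hx
    refine ⟨⟨x', hx'⟩, fun j v w => ?_⟩
    have : (Matrix.of fun I' I => P.pair x' (P.uw j.1.1 I I')) =
        (Matrix.of fun I' I => P.pair x (P.uw j.1.1 I I')).conjTranspose := by
      ext I I'
      simp only [Matrix.of_apply, Matrix.conjTranspose_apply]
      exact (h _ _ _).symm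
    dsimp only
    rw [this, Matrix.toEuclideanLin_conjTranspose_eq_adjoint, LinearMap.adjoint_inner_right]
  · rintro ⟨⟨n, J⟩, s⟩ ⟨x, hx⟩ v
    simp only [LinearMap.comp_apply, ← hg]
    congr 1
    simp only [f₀, LinearMap.comp_apply, LinearEquiv.coe_coe, WithLp.linearEquiv_apply,
      Fintype.linearCombination_apply, map_sum, map_smul, hitL_uw, Finset.smul_sum]
    rw [Finset.sum_comm]
    refine Finset.sum_congr rfl fun K _ => ?_
    simp [Matrix.toEuclideanLin, Matrix.toLin'_apply, Matrix.mulVec, dotProduct,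
      Finset.sum_smul, smul_smul, mul_comm]
  · rw [eq_top_iff, ← htop]
    refine iSup_le fun s => ?_
    rw [← Submodule.map_top, ← P.span_wd, Submodule.map_span_le]
    rintro _ ⟨l, hl, rfl⟩
    obtain ⟨n, I, J, h⟩ := P.exists_uw_eq_wd l hl
    refine (le_iSup (fun j : Jt => LinearMap.range (g j.2 ∘ₗ f₀ j)) (⟨n, J⟩, s) : _)
      ⟨EuclideanSpace.single I 1, ?_⟩
    simp only [f₀, LinearMap.comp_apply, LinearEquiv.coe_coe, WithLp.linearEquiv_apply,
      Fintype.linearCombination_apply]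
    rw [Finset.sum_eq_single I] <;> simp +contextual [h]

end QslnFun

namespace UqslData

variable {q : ℝ} {N : ℕ} (D : UqslData q N) {r : ℕ}

variable {D} in
lemma Ksub_le {S : Subalgebra ℂ D.U} (hE : ∀ c, 1 ≤ c → c < N → c ≠ r → D.E c ∈ S)
    (hF : ∀ c, 1 ≤ c → c < N → c ≠ r → D.F c ∈ S) (hK : ∀ c, 1 ≤ c → c < N → D.Kg c ∈ S)
    (hK' : ∀ c, 1 ≤ c → c < N → D.Ki c ∈ S) : D.Ksub r ≤ S := by
  refine Algebra.adjoin_le ?_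
  rintro x (⟨i, hi, hir, rfl | rfl⟩ | ⟨i, hi, rfl | rfl⟩) <;> simp only [Finset.mem_Icc] at hi
  exacts [hE i hi.1 (by omega) hir, hF i hi.1 (by omega) hir, hK i hi.1 (by omega),
    hK' i hi.1 (by omega)]

section

variable {c : ℕ} (h1 : 1 ≤ c) (h2 : c < N)
include h1 h2

lemma E_mem_Ksub (h : c ≠ r) : D.E c ∈ D.Ksub r :=
  Algebra.subset_adjoin (.inl ⟨c, mem_Icc_pred h1 h2, h, .inl rfl⟩)

lemma F_mem_Ksub (h : c ≠ r) : D.F c ∈ D.Ksub r :=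
  Algebra.subset_adjoin (.inl ⟨c, mem_Icc_pred h1 h2, h, .inr rfl⟩)

lemma Kg_mem_Ksub : D.Kg c ∈ D.Ksub r :=
  Algebra.subset_adjoin (.inr ⟨c, mem_Icc_pred h1 h2, .inl rfl⟩)

lemma Ki_mem_Ksub : D.Ki c ∈ D.Ksub r :=
  Algebra.subset_adjoin (.inr ⟨c, mem_Icc_pred h1 h2, .inr rfl⟩)

end

/-- A star-closed set of generators of the Levi subalgebra. -/
def starK (r : ℕ) : Set D.U := {x | ∃ c, 1 ≤ c ∧ c < N ∧
  ((c ≠ r ∧ (x = D.E c ∨ x = D.F c ∨ x = (q : ℂ)⁻¹ • (D.F c * D.Kg c) ∨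
    x = (q : ℂ) • (D.Ki c * D.E c))) ∨ x = D.Kg c ∨ x = D.Ki c)}

/-- A star-closed set of generators of the torus. -/
def starT : Set D.U := {x | ∃ c, 1 ≤ c ∧ c < N ∧ (x = D.Kg c ∨ x = D.Ki c)}

lemma starK_subset : D.starK r ⊆ D.Ksub r := by
  rintro x ⟨c, h1, h2, ⟨h, rfl | rfl | rfl | rfl⟩ | rfl | rfl⟩
  · exact D.E_mem_Ksub h1 h2 h
  · exact D.F_mem_Ksub h1 h2 h
  · exact Subalgebra.smul_mem _ (mul_mem (D.F_mem_Ksub h1 h2 h) (D.Kg_mem_Ksub h1 h2)) _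
  · exact Subalgebra.smul_mem _ (mul_mem (D.Ki_mem_Ksub h1 h2) (D.E_mem_Ksub h1 h2 h)) _
  · exact D.Kg_mem_Ksub h1 h2
  · exact D.Ki_mem_Ksub h1 h2

variable {D} in
lemma Ksub_le_of_starK {S : Subalgebra ℂ D.U} (h : D.starK r ⊆ S) : D.Ksub r ≤ S :=
  Ksub_le (fun c h1 h2 hc => h ⟨c, h1, h2, .inl ⟨hc, .inl rfl⟩⟩)
    (fun c h1 h2 hc => h ⟨c, h1, h2, .inl ⟨hc, .inr (.inl rfl)⟩⟩)
    (fun c h1 h2 => h ⟨c, h1, h2, .inr (.inl rfl)⟩)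
    (fun c h1 h2 => h ⟨c, h1, h2, .inr (.inr rfl)⟩)

end UqslData

namespace QslnFun

variable {q : ℝ} {N : ℕ} {D : UqslData q N} {P : QslnFun q N D} {r : ℕ}

lemma starK_adj (hq : (q : ℂ) ≠ 0) : ∀ x ∈ D.starK r, ∃ x' ∈ D.starK r, P.IsAdj x x' := by
  rintro x ⟨c, h1, h2, ⟨h, rfl | rfl | rfl | rfl⟩ | rfl | rfl⟩
  · exact ⟨_, ⟨c, h1, h2, .inl ⟨h, .inr (.inr (.inl rfl))⟩⟩, isAdj_E h1 h2 hq⟩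
  · exact ⟨_, ⟨c, h1, h2, .inl ⟨h, .inr (.inr (.inr rfl))⟩⟩, isAdj_F h1 h2 hq⟩
  · exact ⟨_, ⟨c, h1, h2, .inl ⟨h, .inl rfl⟩⟩, (isAdj_E h1 h2 hq).symm⟩
  · exact ⟨_, ⟨c, h1, h2, .inl ⟨h, .inr (.inl rfl)⟩⟩, (isAdj_F h1 h2 hq).symm⟩
  · exact ⟨_, ⟨c, h1, h2, .inr (.inl rfl)⟩, isAdj_Kg h1 h2⟩
  · exact ⟨_, ⟨c, h1, h2, .inr (.inr rfl)⟩, isAdj_Ki h1 h2⟩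

lemma starT_adj : ∀ x ∈ D.starT, ∃ x' ∈ D.starT, P.IsAdj x x' := by
  rintro x ⟨c, h1, h2, rfl | rfl⟩
  · exact ⟨_, ⟨c, h1, h2, .inl rfl⟩, isAdj_Kg h1 h2⟩
  · exact ⟨_, ⟨c, h1, h2, .inr rfl⟩, isAdj_Ki h1 h2⟩

variable (P) in
/-- The span of the elements `⟨k, a₍₁₎⟩ a₍₂₎` with `a ∈ W` and `k` in the augmentation ideal of
the Levi subalgebra. -/
def Kplus (r : ℕ) (W : Submodule ℂ P.A) : Submodule ℂ P.A :=
  Submodule.span ℂ {x | ∃ k ∈ D.Ksub r, ∃ a ∈ W, x = P.hitL k a - ε k • a}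

lemma mem_Bmod {b : P.A} : b ∈ P.Bmod r ↔ D.Ksub r ≤ P.fixL b := by
  simp only [Bmod, Submodule.mem_iInf, LinearMap.mem_ker, hitL_sub,
    Algebra.algebraMap_eq_smul_one, hitL_smul, hitL_one, sub_eq_zero, Subtype.forall]
  rfl

lemma hitL_of_mem_Bmod {b : P.A} (hb : b ∈ P.Bmod r) {k : D.U} (hk : k ∈ D.Ksub r) :
    P.hitL k b = ε k • b := mem_Bmod.1 hb hk

variable (r) in
lemma starK_compl (hq : (q : ℂ) ≠ 0) {W : Submodule ℂ P.A}
    (hW : IsStableUnder (fun x : D.starK r => P.hitL (x : D.U)) W) :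
    ∃ C : Submodule ℂ P.A, IsCompl W C ∧ IsStableUnder (fun x : D.starK r => P.hitL (x : D.U)) C :=
  exists_isCompl_of_star (starK_adj hq) P.hitL (fun _ : Unit => LinearMap.id) (by simp) (by simp)
    hW

lemma starT_compl {W : Submodule ℂ P.A}
    (hW : IsStableUnder (fun x : D.starT => P.hitL (x : D.U)) W) :
    ∃ C : Submodule ℂ P.A, IsCompl W C ∧ IsStableUnder (fun x : D.starT => P.hitL (x : D.U)) C :=
  exists_isCompl_of_star starT_adj P.hitL (fun _ : Unit => LinearMap.id) (by simp) (by simp) hW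

/-- A Levi-stable subspace is the sum of its invariants and its coinvariant part. -/
lemma le_Bmod_sup_Kplus (hq : (q : ℂ) ≠ 0) {W : Submodule ℂ P.A} (hW : D.Ksub r ≤ P.stabL W) :
    W ≤ (W ⊓ P.Bmod r) ⊔ P.Kplus r W := by
  refine (le_inf_sup_of_compl (T := fun x : D.starK r => P.hitL (x : D.U)) (fun x => ε (x : D.U))
    (fun W hW => starK_compl r hq hW) (W := W)
    fun x => hW (D.starK_subset x.2)).trans (sup_le_sup (inf_le_inf_left _ ?_) ?_)
  · intro b hb
    simp only [Submodule.mem_iInf, LinearMap.mem_ker, LinearMap.sub_apply, LinearMap.smul_apply,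
      LinearMap.id_apply, sub_eq_zero] at hb
    exact mem_Bmod.2 (UqslData.Ksub_le_of_starK fun x hx => hb ⟨x, hx⟩)
  · refine Submodule.span_mono ?_
    rintro _ ⟨x, a, ha, rfl⟩
    exact ⟨x, D.starK_subset x.2, a, ha, rfl⟩

lemma eq_zero_of_mem_Bmod_of_mem_Kplus (hq : (q : ℂ) ≠ 0) {b : P.A} (hb : b ∈ P.Bmod r)
    (hb' : b ∈ P.Kplus r ⊤) : b = 0 := by
  set Q := Submodule.span ℂ {x | ∃ g : D.starK r, ∃ a, x = P.hitL (g : D.U) a - ε (g : D.U) • a}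
  refine disjoint_of_compl (T := fun x : D.starK r => P.hitL (x : D.U)) (fun x => ε (x : D.U))
    (fun W hW => starK_compl r hq hW) (fun x => hitL_of_mem_Bmod hb (D.starK_subset x.2)) ?_
  change b ∈ Q
  let S : Subalgebra ℂ D.U :=
    { carrier := {x | ∀ a, P.hitL x a - ε x • a ∈ Q}
      mul_mem' := fun {x y} hx hy a => by
        have : P.hitL (x * y) a - ε (x * y) • a =
            (P.hitL y (P.hitL x a) - ε y • P.hitL x a) + ε y • (P.hitL x a - ε x • a) := by
          rw [hitL_mul, Bialgebra.counit_mul]; module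
        rw [this]
        exact add_mem (hy _) (Q.smul_mem _ (hx _))
      add_mem' := fun {x y} hx hy a => by
        have : P.hitL (x + y) a - ε (x + y) • a =
            (P.hitL x a - ε x • a) + (P.hitL y a - ε y • a) := by
          rw [hitL_add, map_add]; module
        rw [this]
        exact add_mem (hx _) (hy _)
      algebraMap_mem' := fun c a => by
        simp [Algebra.algebraMap_eq_smul_one, hitL_smul] }
  have hS : D.Ksub r ≤ S := UqslData.Ksub_le_of_starK fun x hx a =>
    Submodule.subset_span ⟨⟨x, hx⟩, a, rfl⟩
  refine Submodule.span_le.2 ?_ hb'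
  rintro _ ⟨k, hk, a, -, rfl⟩
  exact hS hk a

section Projection

open HopfAlgebra Coalgebra

lemma rTensor_hitR_comul (y : D.U) (a : P.A) :
    (P.hitR y).rTensor P.A (Δ a) = (P.hitL y).lTensor P.A (Δ a) := by
  have e : ((TensorProduct.rid ℂ P.A).toLinearMap ∘ₗ
      LinearMap.lTensor P.A (P.pair y)).rTensor P.A =
      (TensorProduct.lift ((LinearMap.lsmul ℂ P.A).comp (P.pair y))).lTensor P.A ∘ₗ
        (TensorProduct.assoc ℂ P.A P.A P.A).toLinearMap := by
    ext; simp [TensorProduct.smul_tmul]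
  rw [hitR, ← LinearMap.comp_assoc, LinearMap.rTensor_comp, LinearMap.comp_apply, e, hitL,
    LinearMap.lTensor_comp, LinearMap.comp_apply, LinearMap.comp_apply, ← Coalgebra.coassoc_apply]
  rfl

/-- The map `a ↦ S(a₍₁₎) f(a₍₂₎)`. -/
def twist (f : P.A →ₗ[ℂ] P.A) : P.A →ₗ[ℂ] P.A :=
  LinearMap.mul' ℂ P.A ∘ₗ TensorProduct.map (antipode ℂ) f ∘ₗ comul

lemma twist_repr (f : P.A →ₗ[ℂ] P.A) {a : P.A} {ι : Type*} (s : Repr ℂ a ι) :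
    twist f a = ∑ i ∈ s.index, antipode ℂ (s.left i) * f (s.right i) := by
  simp [twist, ← s.eq]

lemma hitL_twist {f : P.A →ₗ[ℂ] P.A} {x s t s' t' : D.U} (h : Δ x = s ⊗ₜ[ℂ] t + s' ⊗ₜ t')
    (ht : ∀ a, f (P.hitL t a) = P.hitL t (f a)) (ht' : ∀ a, f (P.hitL t' a) = P.hitL t' (f a))
    (a : P.A) : P.hitL x (twist f a) = ε x • twist f a := by
  have key : ∀ y t : D.U, (∀ a, f (P.hitL t a) = P.hitL t (f a)) →
      ∑ i ∈ (ℛ ℂ a).index, P.hitL y (antipode ℂ ((ℛ ℂ a).left i)) * P.hitL t (f ((ℛ ℂ a).right i)) =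
        LinearMap.mul' ℂ P.A (TensorProduct.map (antipode ℂ) f
          ((P.hitL (antipode ℂ y * t)).lTensor P.A (Δ a))) := by
    intro y t ht
    have e : P.hitL (antipode ℂ y * t) = P.hitL t ∘ₗ P.hitL (antipode ℂ y) :=
      LinearMap.ext fun a => hitL_mul _ _ _ _
    rw [e, LinearMap.lTensor_comp, LinearMap.comp_apply, ← rTensor_hitR_comul, ← (ℛ ℂ a).eq]
    simp [hitL_antipode, ht]
  rw [twist_repr f (ℛ ℂ a), map_sum, Finset.sum_congr rfl fun i _ => hitL_mul₂ h _ _,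
    Finset.sum_add_distrib, key s t ht, key s' t' ht', ← map_add, ← map_add, ← LinearMap.add_apply,
    ← LinearMap.lTensor_add]
  have e : P.hitL (antipode ℂ s * t) + P.hitL (antipode ℂ s' * t') = ε x • LinearMap.id :=
    LinearMap.ext fun a => by
      rw [LinearMap.add_apply, ← hitL_add, UqslData.antipode_mul₂ h,
        Algebra.algebraMap_eq_smul_one, hitL_smul, hitL_one]; rfl
  rw [e, ← twist_repr f, LinearMap.lTensor_smul, LinearMap.smul_apply, map_smul, map_smul,
    LinearMap.lTensor_id]
  rfl

lemma sum_mul_twist (f : P.A →ₗ[ℂ] P.A) (a : P.A) :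
    ∑ i ∈ (ℛ ℂ a).index, (ℛ ℂ a).left i * twist f ((ℛ ℂ a).right i) = f a := by
  let Ψ : P.A ⊗[ℂ] (P.A ⊗[ℂ] P.A) →ₗ[ℂ] P.A := LinearMap.mul' ℂ P.A ∘ₗ
    (LinearMap.mul' ℂ P.A ∘ₗ TensorProduct.map (antipode ℂ) f).lTensor P.A
  have e : Ψ = LinearMap.mul' ℂ P.A ∘ₗ
      TensorProduct.map (LinearMap.mul' ℂ P.A ∘ₗ (antipode ℂ).lTensor P.A) f ∘ₗ
      (TensorProduct.assoc ℂ P.A P.A P.A).symm.toLinearMap := by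
    ext; simp [Ψ, mul_assoc]
  calc _ = Ψ (comul.lTensor P.A (Δ a)) := by
        simp only [Ψ, LinearMap.comp_apply, ← LinearMap.lTensor_comp_apply, ← twist.eq_1]
        conv_rhs => rw [← (ℛ ℂ a).eq]
        simp [twist]
    _ = LinearMap.mul' ℂ P.A (TensorProduct.map (LinearMap.mul' ℂ P.A ∘ₗ (antipode ℂ).lTensor P.A) f
          (comul.rTensor P.A (Δ a))) := by
        rw [e, ← Coalgebra.coassoc_apply]; simp
    _ = _ := by
        conv_lhs => rw [← (ℛ ℂ a).eq]
        simp only [map_sum, LinearMap.rTensor_tmul, TensorProduct.map_tmul, LinearMap.comp_apply,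
          mul_antipode_lTensor_comul_apply, LinearMap.mul'_apply]
        conv_rhs => rw [← Coalgebra.sum_counit_smul (ℛ ℂ a)]
        simp [Algebra.algebraMap_eq_smul_one]

/-- A subspace of `A^ι` stable under left multiplication and under the Levi subalgebra is generated
by its invariants. -/
theorem mem_span_smul_Bmod (hq : (q : ℂ) ≠ 0) {ι : Type*} [Finite ι] {W : Submodule ℂ (ι → P.A)}
    (hA : ∀ (a : P.A), ∀ v ∈ W, a • v ∈ W)
    (hK : ∀ x ∈ D.Ksub r, ∀ v ∈ W, (fun s => P.hitL x (v s)) ∈ W) {v : ι → P.A} (hv : v ∈ W) :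
    v ∈ Submodule.span P.A {w | w ∈ W ∧ ∀ s, w s ∈ P.Bmod r} := by
  classical
  have := Fintype.ofFinite ι
  let T : D.U → (ι → P.A) →ₗ[ℂ] ι → P.A := fun x => (P.hitL x).compLeft ι
  have hW : IsStableUnder (fun x : D.starK r => T x) W := fun x v hv =>
    hK x (D.starK_subset x.2) v hv
  obtain ⟨C, hC, hCs⟩ := exists_isCompl_of_star (starK_adj hq) T
    (LinearMap.single ℂ fun _ : ι => P.A)
    (fun s x a => by
      ext t; by_cases h : t = s
      · subst h; simp [T]
      · simp [T, h])
    (by rw [LinearMap.iSup_range_single]) hW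
  let π : (ι → P.A) →ₗ[ℂ] ι → P.A := W.subtype ∘ₗ Submodule.projectionOnto W C hC
  have hπW : ∀ v, π v ∈ W := fun v => (Submodule.projectionOnto W C hC v).2
  have hπ : ∀ v ∈ W, π v = v := fun v hv =>
    congrArg Subtype.val (Submodule.projectionOnto_apply_left hC ⟨v, hv⟩)
  have hπC : ∀ v ∈ C, π v = 0 := fun v hv =>
    congrArg Subtype.val (Submodule.projectionOnto_apply_right hC ⟨v, hv⟩)
  let S : Subalgebra ℂ D.U :=
    { carrier := {x | ∀ v, π (T x v) = T x (π v)}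
      mul_mem' := fun {x y} hx hy v => by
        have h : ∀ v, T (x * y) v = T y (T x v) := fun v => by
          ext s; exact P.hitL_mul _ _ _
        rw [h, h, hy, hx]
      add_mem' := fun {x y} hx hy v => by
        have h : ∀ v, T (x + y) v = T x v + T y v := fun v => by
          ext s; exact P.hitL_add _ _ _
        rw [h, h, map_add, hx, hy]
      algebraMap_mem' := fun c v => by
        have h : ∀ v, T (algebraMap ℂ D.U c) v = c • v := fun v => by
          ext s; simp [T, Algebra.algebraMap_eq_smul_one, hitL_smul]
        rw [h, h, map_smul] }
  have hS : D.Ksub r ≤ S := UqslData.Ksub_le_of_starK fun x hx v => by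
    obtain ⟨y, z, hy, hz, rfl⟩ := Submodule.codisjoint_iff_exists_add_eq.1 hC.codisjoint v
    rw [map_add, map_add, map_add, hπ _ (hW ⟨x, hx⟩ y hy), hπ y hy, hπC z hz,
      hπC _ (hCs ⟨x, hx⟩ z hz), add_zero, add_zero]
  let f : ι → ι → P.A →ₗ[ℂ] P.A := fun s t =>
    LinearMap.proj t ∘ₗ π ∘ₗ LinearMap.single ℂ (fun _ => P.A) s
  have hf : ∀ s t, ∀ x ∈ D.Ksub r, ∀ a, f s t (P.hitL x a) = P.hitL x (f s t a) := by
    intro s t x hx a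
    have e : Pi.single s (P.hitL x a) = T x (Pi.single s a : ι → P.A) := by
      ext t; by_cases h : t = s
      · subst h; simp [T]
      · simp [T, h]
    simp only [f, LinearMap.comp_apply, LinearMap.single_apply, e, hS hx _]
    rfl
  have hB : ∀ s t a, twist (f s t) a ∈ P.Bmod r := by
    intro s t a
    refine mem_Bmod.2 (UqslData.Ksub_le ?_ ?_ ?_ ?_)
    · exact fun c h1 h2 h => hitL_twist (UqslData.comul_E' h1 h2) (hf s t _ (one_mem _))
        (hf s t _ (D.E_mem_Ksub h1 h2 h)) a
    · exact fun c h1 h2 h => hitL_twist (UqslData.comul_F' h1 h2) (hf s t _ (D.Ki_mem_Ksub h1 h2))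
        (hf s t _ (D.F_mem_Ksub h1 h2 h)) a
    · exact fun c h1 h2 => hitL_twist (UqslData.comul_Kg' h1 h2) (hf s t _ (D.Kg_mem_Ksub h1 h2))
        (hf s t _ (zero_mem _)) a
    · exact fun c h1 h2 => hitL_twist (UqslData.comul_Ki' h1 h2) (hf s t _ (D.Ki_mem_Ksub h1 h2))
        (hf s t _ (zero_mem _)) a
  have hmem : ∀ s a, (fun t => twist (f s t) a) ∈ W := by
    intro s a
    have e : (fun t => twist (f s t) a) = ∑ i ∈ (ℛ ℂ a).index,
        antipode ℂ ((ℛ ℂ a).left i) • π (Pi.single s ((ℛ ℂ a).right i)) := by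
      ext t
      rw [twist_repr _ (ℛ ℂ a), Finset.sum_apply]
      rfl
    rw [e]
    exact sum_mem fun i _ => hA _ _ (hπW _)
  have e : v = ∑ s, ∑ i ∈ (ℛ ℂ (v s)).index,
      (ℛ ℂ (v s)).left i • fun t => twist (f s t) ((ℛ ℂ (v s)).right i) := by
    conv_lhs => rw [← hπ v hv, ← Finset.univ_sum_single v, map_sum]
    refine Finset.sum_congr rfl fun s _ => ?_
    ext t
    rw [Finset.sum_apply]
    exact (sum_mul_twist (f s t) (v s)).symm
  rw [e]
  exact sum_mem fun s _ => sum_mem fun i _ =>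
    Submodule.smul_mem _ _ (Submodule.subset_span ⟨hmem _ _, fun t => hB _ _ _⟩)

end Projection

end QslnFun

namespace QslnFun

variable {q : ℝ} {N : ℕ} {D : UqslData q N} {P : QslnFun q N D} {r : ℕ}

/-- Letters of the upper left block. -/
def Blk₁ (N r : ℕ) (p : ℕ × ℕ) : Prop := Ltr N p ∧ p.1 ≤ r ∧ p.2 ≤ r

/-- Letters of the lower right block. -/
def Blk₂ (N r : ℕ) (p : ℕ × ℕ) : Prop := Ltr N p ∧ r < p.1 ∧ r < p.2

/-- Letters of the off-diagonal blocks. -/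
def Off (N r : ℕ) (p : ℕ × ℕ) : Prop := Ltr N p ∧ ¬(p.1 ≤ r ↔ p.2 ≤ r)

variable (P) in
/-- The span of a set of letters. -/
def ltrs (Q : ℕ × ℕ → Prop) : Submodule ℂ P.A :=
  Submodule.span ℂ ((fun p : ℕ × ℕ => P.u p.1 p.2) '' {p | Q p})

variable (P) in
/-- The span of a set of words. -/
def wds (S : List (ℕ × ℕ) → Prop) : Submodule ℂ P.A := Submodule.span ℂ (P.wd '' {l | S l})

lemma u_mem_ltrs {Q : ℕ × ℕ → Prop} {i j : ℕ} (h : Q (i, j)) : P.u i j ∈ P.ltrs Q :=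
  Submodule.subset_span ⟨(i, j), h, rfl⟩

lemma wd_mem_wds {S : List (ℕ × ℕ) → Prop} {l : List (ℕ × ℕ)} (h : S l) : P.wd l ∈ P.wds S :=
  Submodule.subset_span ⟨l, h, rfl⟩

lemma wds_le {S : List (ℕ × ℕ) → Prop} {W : Submodule ℂ P.A} : P.wds S ≤ W ↔ ∀ l, S l → P.wd l ∈ W := by
  rw [wds, Submodule.span_le]
  exact ⟨fun h l hl => h ⟨l, hl, rfl⟩, by rintro h _ ⟨l, hl, rfl⟩; exact h l hl⟩

lemma ltrs_le {Q : ℕ × ℕ → Prop} {W : Submodule ℂ P.A} :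
    P.ltrs Q ≤ W ↔ ∀ i j, Q (i, j) → P.u i j ∈ W := by
  rw [ltrs, Submodule.span_le]
  exact ⟨fun h i j hl => h ⟨(i, j), hl, rfl⟩, by rintro h _ ⟨⟨i, j⟩, hl, rfl⟩; exact h i j hl⟩

lemma wds_mono {S S' : List (ℕ × ℕ) → Prop} (h : ∀ l, S l → S' l) : P.wds S ≤ P.wds S' :=
  wds_le.2 fun l hl => wd_mem_wds (h l hl)

lemma wds_mul_wds {S S' S'' : List (ℕ × ℕ) → Prop} (h : ∀ l l', S l → S' l' → S'' (l ++ l')) :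
    P.wds S * P.wds S' ≤ P.wds S'' := by
  rw [wds, wds, Submodule.span_mul_span, Submodule.span_le]
  rintro _ ⟨_, ⟨l, hl, rfl⟩, _, ⟨l', hl', rfl⟩, rfl⟩
  dsimp only
  rw [← wd_append]
  exact wd_mem_wds (h l l' hl hl')

lemma wds_top : P.wds (fun l => ∀ p ∈ l, Ltr N p) = ⊤ := P.span_wd

lemma wd_mem_ltrs_pow {Q : ℕ × ℕ → Prop} (l : List (ℕ × ℕ)) (h : ∀ p ∈ l, Q p) :
    P.wd l ∈ P.ltrs Q ^ l.length := by
  induction l with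
  | nil => rw [wd_nil]; exact Submodule.one_le.1 le_rfl
  | cons p l ih =>
    rw [List.length_cons, pow_succ', wd_cons]
    exact Submodule.mul_mem_mul (u_mem_ltrs (h p (by simp))) (ih fun p hp => h p (by simp [hp]))

lemma ltrs_pow_eq (Q : ℕ × ℕ → Prop) (n : ℕ) :
    P.ltrs Q ^ n = P.wds fun l => (∀ p ∈ l, Q p) ∧ l.length = n := by
  refine le_antisymm ?_ (wds_le.2 fun l hl => hl.2 ▸ wd_mem_ltrs_pow l hl.1)
  induction n with
  | zero =>
    rw [pow_zero, Submodule.one_le]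
    exact wd_mem_wds (l := []) (by simp)
  | succ n ih =>
    rw [pow_succ']
    refine (mul_le_mul' (ltrs_le (W := P.wds fun l => (∀ p ∈ l, Q p) ∧ l.length = 1).2
      fun i j h => ?_) ih).trans (wds_mul_wds fun l l' hl hl' => ?_)
    · rw [show P.u i j = P.wd [(i, j)] by simp]
      exact wd_mem_wds (by simpa using h)
    · refine ⟨fun p hp => ?_, by simp [hl.2, hl'.2, add_comm]⟩
      rcases List.mem_append.1 hp with h | h
      exacts [hl.1 p h, hl'.1 p h]

lemma stabL_mul {W W' : Submodule ℂ P.A} (h : D.Ksub r ≤ P.stabL W) (h' : D.Ksub r ≤ P.stabL W') :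
    D.Ksub r ≤ P.stabL (W * W') := by
  have key : ∀ x : D.U, (∀ a ∈ W, ∀ b ∈ W', P.hitL x (a * b) ∈ W * W') → x ∈ P.stabL (W * W') := by
    intro x hx a ha
    induction ha using Submodule.mul_induction_on' with
    | mem_mul_mem a ha b hb => exact hx a ha b hb
    | add a _ b _ ha hb => rw [map_add]; exact add_mem ha hb
  refine UqslData.Ksub_le ?_ ?_ ?_ ?_ <;> intro c h1 h2
  · refine fun hc => key _ fun a ha b hb => ?_
    rw [P.hitL_E_mul h1 h2]
    exact add_mem (Submodule.mul_mem_mul (h (D.E_mem_Ksub h1 h2 hc) a ha) hb)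
      (Submodule.mul_mem_mul (h (D.Kg_mem_Ksub h1 h2) a ha) (h' (D.E_mem_Ksub h1 h2 hc) b hb))
  · refine fun hc => key _ fun a ha b hb => ?_
    rw [P.hitL_F_mul h1 h2]
    exact add_mem (Submodule.mul_mem_mul (h (D.F_mem_Ksub h1 h2 hc) a ha)
      (h' (D.Ki_mem_Ksub h1 h2) b hb)) (Submodule.mul_mem_mul ha (h' (D.F_mem_Ksub h1 h2 hc) b hb))
  · refine key _ fun a ha b hb => ?_
    rw [P.hitL_Kg_mul h1 h2]
    exact Submodule.mul_mem_mul (h (D.Kg_mem_Ksub h1 h2) a ha) (h' (D.Kg_mem_Ksub h1 h2) b hb)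
  · refine key _ fun a ha b hb => ?_
    rw [P.hitL_Ki_mul h1 h2]
    exact Submodule.mul_mem_mul (h (D.Ki_mem_Ksub h1 h2) a ha) (h' (D.Ki_mem_Ksub h1 h2) b hb)

lemma stabL_one : D.Ksub r ≤ P.stabL 1 := fun x _ a ha => by
  obtain ⟨c, rfl⟩ := Submodule.mem_one.1 ha
  rw [Algebra.algebraMap_eq_smul_one, map_smul, hitL_oneA]
  exact Submodule.smul_mem _ _ (Submodule.smul_mem _ _ (Submodule.one_le.1 le_rfl))

lemma stabL_pow {W : Submodule ℂ P.A} (h : D.Ksub r ≤ P.stabL W) (n : ℕ) :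
    D.Ksub r ≤ P.stabL (W ^ n) := by
  induction n with
  | zero => exact stabL_one
  | succ n ih => rw [pow_succ]; exact stabL_mul ih h

lemma stabL_top : D.Ksub r ≤ P.stabL ⊤ := fun _ _ _ _ => trivial

lemma stabL_ltrs {Q : ℕ × ℕ → Prop} (hQ : ∀ p, Q p → Ltr N p)
    (hup : ∀ c j, 1 ≤ c → c < N → c ≠ r → Q (c, j) → Q (c + 1, j))
    (hdown : ∀ c j, 1 ≤ c → c < N → c ≠ r → Q (c + 1, j) → Q (c, j)) :
    D.Ksub r ≤ P.stabL (P.ltrs Q) := by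
  refine UqslData.Ksub_le ?_ ?_ ?_ ?_ <;> intro c h1 h2
  · rintro hc
    refine P.mem_stabL_span.2 ?_
    rintro _ ⟨⟨i, j⟩, h : Q (i, j), rfl⟩
    obtain ⟨a1, a2, a3, a4⟩ := hQ _ h
    dsimp only at a1 a2 a3 a4 ⊢
    rw [P.hitL_E_u a1 a2 a3 a4 h1 h2]
    split_ifs with hi
    · subst hi; exact u_mem_ltrs (hup i j h1 h2 hc h)
    · exact zero_mem _
  · rintro hc
    refine P.mem_stabL_span.2 ?_
    rintro _ ⟨⟨i, j⟩, h : Q (i, j), rfl⟩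
    obtain ⟨a1, a2, a3, a4⟩ := hQ _ h
    dsimp only at a1 a2 a3 a4 ⊢
    rw [P.hitL_F_u a1 a2 a3 a4 h1 h2]
    split_ifs with hi
    · subst hi; exact u_mem_ltrs (hdown c j h1 h2 hc h)
    · exact zero_mem _
  · refine P.mem_stabL_span.2 ?_
    rintro _ ⟨⟨i, j⟩, h : Q (i, j), rfl⟩
    obtain ⟨a1, a2, a3, a4⟩ := hQ _ h
    dsimp only at a1 a2 a3 a4 ⊢
    rw [P.hitL_Kg_u a1 a2 a3 a4 h1 h2]
    exact Submodule.smul_mem _ _ (u_mem_ltrs h)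
  · refine P.mem_stabL_span.2 ?_
    rintro _ ⟨⟨i, j⟩, h : Q (i, j), rfl⟩
    obtain ⟨a1, a2, a3, a4⟩ := hQ _ h
    dsimp only at a1 a2 a3 a4 ⊢
    rw [P.hitL_Ki_u a1 a2 a3 a4 h1 h2]
    exact Submodule.smul_mem _ _ (u_mem_ltrs h)

lemma stabL_blk₁ : D.Ksub r ≤ P.stabL (P.ltrs (Blk₁ N r)) :=
  stabL_ltrs (fun _ h => h.1) (by simp only [Blk₁, Ltr]; omega) (by simp only [Blk₁, Ltr]; omega)

lemma stabL_blk₂ : D.Ksub r ≤ P.stabL (P.ltrs (Blk₂ N r)) :=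
  stabL_ltrs (fun _ h => h.1) (by simp only [Blk₂, Ltr]; omega) (by simp only [Blk₂, Ltr]; omega)

lemma stabL_off : D.Ksub r ≤ P.stabL (P.ltrs (Off N r)) :=
  stabL_ltrs (fun _ h => h.1) (by simp only [Off, Ltr]; omega) (by simp only [Off, Ltr]; omega)

lemma stabL_wds {Q : ℕ × ℕ → Prop} (h : D.Ksub r ≤ P.stabL (P.ltrs Q)) :
    D.Ksub r ≤ P.stabL (P.wds fun l => ∀ p ∈ l, Q p) := fun x hx => by
  refine P.mem_stabL_span.2 ?_
  rintro _ ⟨l, hl, rfl⟩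
  have := stabL_pow h l.length hx _ (wd_mem_ltrs_pow l hl)
  rw [ltrs_pow_eq] at this
  exact wds_mono (fun l h => h.1) this

variable (P r) in
/-- The left ideal generated by the off-diagonal letters. -/
def offIdeal : Submodule ℂ P.A := ⊤ * P.ltrs (Off N r)

lemma mul_mem_offIdeal (a : P.A) {b : P.A} (hb : b ∈ P.offIdeal r) : a * b ∈ P.offIdeal r := by
  have : a * b ∈ (⊤ * (⊤ * P.ltrs (Off N r)) : Submodule ℂ P.A) :=
    Submodule.mul_mem_mul trivial hb
  rw [← mul_assoc] at this
  exact (mul_le_mul' le_top le_rfl : (⊤ * ⊤ * P.ltrs (Off N r) : Submodule ℂ P.A) ≤ _) this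

lemma ltrs_off_le : P.ltrs (Off N r) ≤ P.offIdeal r := fun a ha => by
  rw [← one_mul a]; exact Submodule.mul_mem_mul trivial ha

section Commutation

variable (hq : (q : ℂ) ≠ 0)
include hq

lemma off_mul_letter {i j k l : ℕ} (h : Off N r (i, j)) (h' : Ltr N (k, l)) :
    P.u i j * P.u k l ∈ P.offIdeal r := by
  have key : ∀ {i j} (a : P.A), Off N r (i, j) → a * P.u i j ∈ P.offIdeal r := fun a h =>
    Submodule.mul_mem_mul trivial (u_mem_ltrs h)
  obtain ⟨⟨hi1, hi2, hj1, hj2⟩, h⟩ := h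
  obtain ⟨hk1, hk2, hl1, hl2⟩ := h'
  dsimp only at *
  have hoff : Off N r (i, j) := ⟨⟨hi1, hi2, hj1, hj2⟩, h⟩
  rcases lt_trichotomy i k with hik | rfl | hik <;> rcases lt_trichotomy j l with hjl | rfl | hjl
  · rw [P.u_diag hq hi1 hj1 hik hk2 hjl hl2]
    refine add_mem (key _ hoff) (Submodule.smul_mem _ _ ?_)
    by_cases hil : Off N r (i, l)
    · exact key _ hil
    · rw [← P.u_anti hq hi1 hj1 hik hk2 hjl hl2]
      exact key _ (by simp only [Off, Ltr] at *; omega)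
  · rw [P.u_col hq hi1 hj1 hj2 hik hk2]
    exact Submodule.smul_mem _ _ (key _ hoff)
  · rw [P.u_anti hq hi1 hl1 hik hk2 hjl hj2]
    exact key _ hoff
  · rw [P.u_row hq hi1 hj1 hi2 hjl hl2]
    exact Submodule.smul_mem _ _ (key _ hoff)
  · exact key _ hoff
  · have := P.u_row hq hi1 hl1 hi2 hjl hj2
    rw [← inv_smul_eq_iff₀ hq] at this
    rw [← this]
    exact Submodule.smul_mem _ _ (key _ hoff)
  · rw [← P.u_anti hq hk1 hj1 hik hi2 hjl hl2]
    exact key _ hoff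
  · have := P.u_col hq hk1 hj1 hj2 hik hi2
    rw [← inv_smul_eq_iff₀ hq] at this
    rw [← this]
    exact Submodule.smul_mem _ _ (key _ hoff)
  · have := P.u_diag hq hk1 hl1 hik hi2 hjl hj2
    rw [← sub_eq_iff_eq_add] at this
    rw [← this]
    refine sub_mem (key _ hoff) (Submodule.smul_mem _ _ ?_)
    by_cases hil : Off N r (k, j)
    · exact key _ hil
    · rw [← P.u_anti hq hk1 hl1 hik hi2 hjl hj2]
      exact key _ (by simp only [Off, Ltr] at *; omega)

lemma off_mul_top : P.ltrs (Off N r) * ⊤ ≤ P.offIdeal r := by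
  rw [← wds_top, Submodule.mul_le]
  intro v hv a ha
  have h1 : ∀ l : List (ℕ × ℕ), (∀ p ∈ l, Ltr N p) → ∀ v ∈ P.ltrs (Off N r),
      v * P.wd l ∈ P.offIdeal r := by
    intro l
    induction l with
    | nil => intro _ v hv; simpa using ltrs_off_le hv
    | cons p l ih =>
      intro hl v hv
      have h2 : v * P.u p.1 p.2 ∈ P.offIdeal r := by
        have : P.ltrs (Off N r) ≤ (P.offIdeal r).comap (LinearMap.mulRight ℂ (P.u p.1 p.2)) :=
          ltrs_le.2 fun i j h => off_mul_letter hq h (hl p (by simp))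
        exact this hv
      rw [wd_cons, ← mul_assoc]
      have h3 : P.offIdeal r ≤ (P.offIdeal r).comap (LinearMap.mulRight ℂ (P.wd l)) := by
        refine Submodule.mul_le.2 fun a _ v hv => ?_
        rw [Submodule.mem_comap, LinearMap.mulRight_apply, mul_assoc]
        exact mul_mem_offIdeal a (ih (fun p hp => hl p (by simp [hp])) v hv)
      exact h3 h2
  have h2 : P.wds (fun l => ∀ p ∈ l, Ltr N p) ≤
      (P.offIdeal r).comap (LinearMap.mulLeft ℂ v) := wds_le.2 fun l hl => h1 l hl v hv
  exact h2 ha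

lemma offIdeal_mul_mem {a : P.A} (ha : a ∈ P.offIdeal r) (b : P.A) : a * b ∈ P.offIdeal r := by
  have h : P.offIdeal r ≤ (P.offIdeal r).comap (LinearMap.mulRight ℂ b) := by
    refine Submodule.mul_le.2 fun a _ v hv => ?_
    rw [Submodule.mem_comap, LinearMap.mulRight_apply, mul_assoc]
    exact mul_mem_offIdeal a (off_mul_top hq (Submodule.mul_mem_mul hv trivial))
  exact h ha

lemma wd_mem_offIdeal {l : List (ℕ × ℕ)} (hl : ∀ p ∈ l, Ltr N p) (h : ∃ p ∈ l, Off N r p) :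
    P.wd l ∈ P.offIdeal r := by
  obtain ⟨p, hp, ho⟩ := h
  obtain ⟨s, t, rfl⟩ := List.append_of_mem hp
  rw [wd_append, wd_cons]
  exact mul_mem_offIdeal _ (offIdeal_mul_mem hq (ltrs_off_le (u_mem_ltrs ho)) _)

lemma blk₂_mul_blk₁ {i j : ℕ} (h : Blk₂ N r (i, j)) (l : List (ℕ × ℕ)) (hl : ∀ p ∈ l, Blk₁ N r p) :
    P.u i j * P.wd l - P.wd l * P.u i j ∈ P.offIdeal r := by
  induction l with
  | nil => simp
  | cons p l ih =>
    obtain ⟨k, m⟩ := p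
    have h' := hl (k, m) (by simp)
    have e : P.u i j * P.wd ((k, m) :: l) - P.wd ((k, m) :: l) * P.u i j =
        (P.u i j * P.u k m - P.u k m * P.u i j) * P.wd l +
          P.u k m * (P.u i j * P.wd l - P.wd l * P.u i j) := by
      rw [wd_cons]; noncomm_ring
    rw [e]
    refine add_mem (offIdeal_mul_mem hq ?_ _)
      (mul_mem_offIdeal _ (ih fun p hp => hl p (by simp [hp])))
    simp only [Blk₁, Blk₂, Ltr] at h h'
    rw [P.u_diag hq (i := k) (j := m) (k := i) (l := j) (by omega) (by omega) (by omega) (by omega)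
      (by omega) (by omega), sub_add_cancel_left]
    refine neg_mem (Submodule.smul_mem _ _ (Submodule.mul_mem_mul trivial (u_mem_ltrs ?_)))
    simp only [Off, Ltr]; omega

open Classical in
lemma wd_sub_mem_offIdeal (l : List (ℕ × ℕ)) (hl : ∀ p ∈ l, Blk₁ N r p ∨ Blk₂ N r p) :
    P.wd l - P.wd (l.filter (Blk₁ N r ·)) * P.wd (l.filter (Blk₂ N r ·)) ∈ P.offIdeal r := by
  induction l with
  | nil => simp
  | cons p l ih =>
    have ih := ih fun p hp => hl p (by simp [hp])
    rcases hl p (by simp) with h | h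
    · rw [List.filter_cons_of_pos (by simpa using h), List.filter_cons_of_neg
        (by simpa using fun h' : Blk₂ N r p => absurd h'.2.1 (by have := h.2.1; omega)), wd_cons, wd_cons, mul_assoc, ← mul_sub]
      exact mul_mem_offIdeal _ ih
    · rw [List.filter_cons_of_neg
        (by simpa using fun h' : Blk₁ N r p => absurd h'.2.1 (by have := h.2.1; omega)),
        List.filter_cons_of_pos (by simpa using h), wd_cons, wd_cons]
      set a := P.wd (l.filter (Blk₁ N r ·))
      set b := P.wd (l.filter (Blk₂ N r ·))
      have e : P.u p.1 p.2 * P.wd l - a * (P.u p.1 p.2 * b) =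
          P.u p.1 p.2 * (P.wd l - a * b) + (P.u p.1 p.2 * a - a * P.u p.1 p.2) * b := by
        noncomm_ring
      rw [e]
      exact add_mem (mul_mem_offIdeal _ ih) (offIdeal_mul_mem hq (blk₂_mul_blk₁ hq h _ (by simp)) _)

end Commutation

end QslnFun

lemma ofReal_ne_zero_of_transcendental {q : ℝ} (hq : Transcendental ℚ q) : (q : ℂ) ≠ 0 :=
  Complex.ofReal_ne_zero.2 fun h => hq (h ▸ isAlgebraic_zero)

lemma zpow_eq_one_of_transcendental {q : ℝ} (hq : Transcendental ℚ q) {n : ℤ}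
    (h : (q : ℂ) ^ n = 1) : n = 0 := by
  have key : ∀ n : ℕ, q ^ n = 1 → n = 0 := fun n h => by
    by_contra hn
    exact hq (IsAlgebraic.of_pow (Nat.pos_of_ne_zero hn) (h ▸ isAlgebraic_one))
  have h : q ^ n = 1 := by exact_mod_cast h
  obtain ⟨n, rfl | rfl⟩ := n.eq_nat_or_neg
  · rw [zpow_natCast] at h; simp [key n h]
  · rw [zpow_neg, zpow_natCast, inv_eq_one] at h; simp [key n h]

/-- An eigenvector in the span of a family of eigenvectors is in the span of those with the same
eigenvalue. -/
lemma mem_span_image_of_eigenvector {ι M : Type*} [AddCommGroup M] [Module ℂ M] {T : M →ₗ[ℂ] M}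
    {v : ι → M} {χ : ι → ℂ} {S : Set ι} (hT : ∀ i ∈ S, T (v i) = χ i • v i) {μ : ℂ} {a : M}
    (ha : a ∈ Submodule.span ℂ (v '' S)) (h : T a = μ • a) :
    a ∈ Submodule.span ℂ (v '' {i | i ∈ S ∧ χ i = μ}) := by
  have hle : Submodule.span ℂ (v '' S) ≤ Submodule.span ℂ (v '' {i | i ∈ S ∧ χ i = μ}) ⊔
      Submodule.span ℂ (v '' {i | i ∈ S ∧ χ i ≠ μ}) := by
    rw [← Submodule.span_union, ← Set.image_union]
    refine Submodule.span_mono (Set.image_mono fun i hi => ?_)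
    by_cases hμ : χ i = μ
    exacts [.inl ⟨hi, hμ⟩, .inr ⟨hi, hμ⟩]
  obtain ⟨y, hy, z, hz, rfl⟩ := Submodule.mem_sup.1 (hle ha)
  have hyT : T y = μ • y := by
    have : Submodule.span ℂ (v '' {i | i ∈ S ∧ χ i = μ}) ≤ Module.End.eigenspace T μ := by
      rw [Submodule.span_le]
      rintro _ ⟨i, ⟨hi, hμ⟩, rfl⟩
      exact Module.End.mem_eigenspace_iff.2 (hμ ▸ hT i hi)
    exact Module.End.mem_eigenspace_iff.1 (this hy)
  have hz1 : z ∈ Module.End.eigenspace T μ := by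
    rw [Module.End.mem_eigenspace_iff]
    rw [map_add, hyT, smul_add] at h
    exact add_left_cancel h
  have hz2 : Submodule.span ℂ (v '' {i | i ∈ S ∧ χ i ≠ μ}) ≤
      ⨆ ν, ⨆ _ : ν ≠ μ, Module.End.eigenspace T ν := by
    rw [Submodule.span_le]
    rintro _ ⟨i, ⟨hi, hμ⟩, rfl⟩
    exact Submodule.mem_iSup_of_mem _ (Submodule.mem_iSup_of_mem hμ
      (Module.End.mem_eigenspace_iff.2 (hT i hi)))
  have : z = 0 := Submodule.disjoint_def.1 (Module.End.eigenspaces_iSupIndep T μ) z hz1 (hz2 hz)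
  rw [this, add_zero]; exact hy

/-- The number of letters of a word in a given row. -/
def cnt (i : ℕ) (l : List (ℕ × ℕ)) : ℕ := (l.map Prod.fst).count i

lemma sum_cnt {s : Finset ℕ} {l : List (ℕ × ℕ)} (h : ∀ p ∈ l, p.1 ∈ s) :
    ∑ i ∈ s, cnt i l = l.length := by
  induction l with
  | nil => simp [cnt]
  | cons p l ih =>
    have := ih fun p hp => h p (by simp [hp])
    simp only [cnt, List.map_cons, List.count_cons, Finset.sum_add_distrib, List.length_cons] at *
    rw [this]
    simp [h p (by simp)]

namespace QslnFun

variable {q : ℝ} {N : ℕ} {D : UqslData q N} {P : QslnFun q N D} {r : ℕ}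

section Weights

variable {c : ℕ} (h1 : 1 ≤ c) (h2 : c < N)
include h1 h2

lemma hitL_Kg_wd (hq : (q : ℂ) ≠ 0) {l : List (ℕ × ℕ)} (hl : ∀ p ∈ l, Ltr N p) :
    P.hitL (D.Kg c) (P.wd l) = (q : ℂ) ^ ((cnt c l : ℤ) - cnt (c + 1) l) • P.wd l := by
  induction l with
  | nil => simp [cnt, hitL_oneA, UqslData.counit_Kg' h1 h2]
  | cons p l ih =>
    obtain ⟨a1, a2, a3, a4⟩ := hl p (by simp)
    rw [wd_cons, P.hitL_Kg_mul h1 h2, ih fun p hp => hl p (by simp [hp]),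
      P.hitL_Kg_u a1 a2 a3 a4 h1 h2, smul_mul_smul_comm]
    congr 1
    simp only [cnt, List.map_cons, List.count_cons, beq_iff_eq]
    rcases eq_or_ne p.1 c with h | h
    · rw [if_pos h, if_pos h, if_neg (by omega), ← zpow_one_add₀ hq]
      congr 1; push_cast; ring
    · rw [if_neg h, if_neg h]
      split_ifs
      · rw [← zpow_neg_one, ← zpow_add₀ hq]; congr 1; push_cast; ring
      · simp

lemma hitL_Ki_of_eigenvector {a : P.A} {μ : ℂ} (h : P.hitL (D.Kg c) a = μ • a) :
    P.hitL (D.Ki c) a = μ⁻¹ • a := by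
  have e : a = μ • P.hitL (D.Ki c) a := by
    rw [← map_smul, ← h, ← hitL_mul, D.Kg_mul_Ki h1 h2, hitL_one]
  rcases eq_or_ne μ 0 with rfl | hμ
  · rw [zero_smul] at e; rw [e]; simp
  · conv_rhs => rw [e]
    rw [smul_smul, inv_mul_cancel₀ hμ, one_smul]

lemma hitL_E_wds {S S' : List (ℕ × ℕ) → Prop} (hS : ∀ l, S l → ∀ p ∈ l, Ltr N p)
    (hc : ∀ s t j, S (s ++ (c, j) :: t) → S' (s ++ (c + 1, j) :: t)) {a : P.A} (ha : a ∈ P.wds S) :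
    P.hitL (D.E c) a ∈ P.wds S' := by
  have key : ∀ l, (∀ p ∈ l, Ltr N p) → P.hitL (D.E c) (P.wd l) ∈
      P.wds fun l' => ∃ s t j, l = s ++ (c, j) :: t ∧ l' = s ++ (c + 1, j) :: t := by
    intro l hl
    induction l with
    | nil => simp [hitL_oneA, UqslData.counit_E' h1 h2]
    | cons p l ih =>
      obtain ⟨a1, a2, a3, a4⟩ := hl p (by simp)
      rw [wd_cons, P.hitL_E_mul h1 h2, P.hitL_E_u a1 a2 a3 a4 h1 h2, P.hitL_Kg_u a1 a2 a3 a4 h1 h2]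
      refine add_mem ?_ ?_
      · split_ifs with h
        · rw [← wd_cons P (c + 1, p.2)]
          exact wd_mem_wds ⟨[], l, p.2, by simp [← h], rfl⟩
        · simp
      · rw [smul_mul_assoc]
        refine Submodule.smul_mem _ _ ?_
        have : (P.wds fun l' => ∃ s t j, l = s ++ (c, j) :: t ∧ l' = s ++ (c + 1, j) :: t) ≤
            (P.wds fun l' => ∃ s t j, p :: l = s ++ (c, j) :: t ∧
              l' = s ++ (c + 1, j) :: t).comap (LinearMap.mulLeft ℂ (P.u p.1 p.2)) := by
          refine wds_le.2 ?_
          rintro _ ⟨s, t, j, rfl, rfl⟩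
          rw [Submodule.mem_comap, LinearMap.mulLeft_apply, ← wd_cons]
          exact wd_mem_wds ⟨p :: s, t, j, rfl, rfl⟩
        exact this (ih fun p hp => hl p (by simp [hp]))
  have : P.wds S ≤ (P.wds S').comap (P.hitL (D.E c)) := wds_le.2 fun l hl => by
    refine wds_mono ?_ (key l (hS l hl))
    rintro _ ⟨s, t, j, rfl, rfl⟩
    exact hc s t j hl
  exact this ha

lemma hitL_Ki_wd (hq : (q : ℂ) ≠ 0) {l : List (ℕ × ℕ)} (hl : ∀ p ∈ l, Ltr N p) :
    P.hitL (D.Ki c) (P.wd l) = ((q : ℂ) ^ ((cnt c l : ℤ) - cnt (c + 1) l))⁻¹ • P.wd l :=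
  hitL_Ki_of_eigenvector h1 h2 (hitL_Kg_wd h1 h2 hq hl)

lemma hitL_F_wds (hq : (q : ℂ) ≠ 0) {S S' : List (ℕ × ℕ) → Prop}
    (hS : ∀ l, S l → ∀ p ∈ l, Ltr N p)
    (hc : ∀ s t j, S (s ++ (c + 1, j) :: t) → S' (s ++ (c, j) :: t)) {a : P.A}
    (ha : a ∈ P.wds S) : P.hitL (D.F c) a ∈ P.wds S' := by
  have key : ∀ l, (∀ p ∈ l, Ltr N p) → P.hitL (D.F c) (P.wd l) ∈
      P.wds fun l' => ∃ s t j, l = s ++ (c + 1, j) :: t ∧ l' = s ++ (c, j) :: t := by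
    intro l hl
    induction l with
    | nil => simp [hitL_oneA, UqslData.counit_F' h1 h2]
    | cons p l ih =>
      obtain ⟨a1, a2, a3, a4⟩ := hl p (by simp)
      have hl' : ∀ p ∈ l, Ltr N p := fun p hp => hl p (by simp [hp])
      rw [wd_cons, P.hitL_F_mul h1 h2, P.hitL_F_u a1 a2 a3 a4 h1 h2, hitL_Ki_wd h1 h2 hq hl']
      refine add_mem ?_ ?_
      · rw [mul_smul_comm]
        refine Submodule.smul_mem _ _ ?_
        split_ifs with h
        · rw [← wd_cons P (c, p.2)]
          exact wd_mem_wds ⟨[], l, p.2, by simp [← h], rfl⟩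
        · simp
      · have : (P.wds fun l' => ∃ s t j, l = s ++ (c + 1, j) :: t ∧ l' = s ++ (c, j) :: t) ≤
            (P.wds fun l' => ∃ s t j, p :: l = s ++ (c + 1, j) :: t ∧
              l' = s ++ (c, j) :: t).comap (LinearMap.mulLeft ℂ (P.u p.1 p.2)) := by
          refine wds_le.2 ?_
          rintro _ ⟨s, t, j, rfl, rfl⟩
          rw [Submodule.mem_comap, LinearMap.mulLeft_apply, ← wd_cons]
          exact wd_mem_wds ⟨p :: s, t, j, rfl, rfl⟩
        exact this (ih hl')
  have : P.wds S ≤ (P.wds S').comap (P.hitL (D.F c)) := wds_le.2 fun l hl => by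
    refine wds_mono ?_ (key l (hS l hl))
    rintro _ ⟨s, t, j, rfl, rfl⟩
    exact hc s t j hl
  exact this ha

end Weights

/-- A combination of words fixed by part of the torus is a combination of balanced words. -/
lemma mem_wds_of_fixed (hq : Transcendental ℚ q) (C : Finset ℕ) (hC : ∀ c ∈ C, 1 ≤ c ∧ c < N)
    {S : List (ℕ × ℕ) → Prop} (hS : ∀ l, S l → ∀ p ∈ l, Ltr N p) {a : P.A} (ha : a ∈ P.wds S)
    (h : ∀ c ∈ C, P.hitL (D.Kg c) a = a) :
    a ∈ P.wds fun l => S l ∧ ∀ c ∈ C, cnt c l = cnt (c + 1) l := by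
  induction C using Finset.induction_on with
  | empty => simpa using ha
  | insert c C _ ih =>
    have ih := ih (fun c hc => hC c (by simp [hc])) fun c hc => h c (by simp [hc])
    obtain ⟨h1, h2⟩ := hC c (by simp)
    have := mem_span_image_of_eigenvector (μ := 1) (fun l hl => hitL_Kg_wd (P := P) h1 h2
      (ofReal_ne_zero_of_transcendental hq) (hS l hl.1)) ih
      (by rw [one_smul]; exact h c (by simp))
    refine wds_mono (S := fun l => (S l ∧ ∀ c ∈ C, cnt c l = cnt (c + 1) l) ∧
      (q : ℂ) ^ ((cnt c l : ℤ) - cnt (c + 1) l) = 1) (fun l hl => ⟨hl.1.1, fun d hd => ?_⟩) this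
    rcases Finset.mem_insert.1 hd with rfl | hd
    · have := zpow_eq_one_of_transcendental hq hl.2; omega
    · exact hl.1.2 d hd

/-- An extremal weight vector killed by the counit, all of whose descendants are killed by the
counit, vanishes. -/
lemma eq_zero_of_extremal {X Y : ℕ → D.U} {κ : ℂ}
    (hgen : ∀ i, (X i = D.E i ∧ Y i = D.F i) ∨ (X i = D.F i ∧ Y i = D.E i))
    (hYX : ∀ i j, 1 ≤ i → i < N → 1 ≤ j → j < N → ∀ a : P.A, P.hitL (Y j) (P.hitL (X i) a) =
      P.hitL (X i) (P.hitL (Y j) a) +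
        if i = j then κ • (P.hitL (D.Kg i) a - P.hitL (D.Ki i) a) else 0)
    (hKX : ∀ i j, 1 ≤ i → i < N → 1 ≤ j → j < N → ∃ t : ℂ, ∀ a : P.A,
      P.hitL (D.Kg j) (P.hitL (X i) a) = t • P.hitL (X i) (P.hitL (D.Kg j) a))
    {c : P.A} (hc : ∀ j, 1 ≤ j → j < N → P.hitL (Y j) c = 0)
    (hcK : ∀ j, 1 ≤ j → j < N → ∃ t : ℂ, P.hitL (D.Kg j) c = t • c)
    {Z : Submodule ℂ P.A} (hcZ : ∀ i, 1 ≤ i → i < N → P.hitL (X i) c ∈ Z)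
    (hZ : ∀ i, 1 ≤ i → i < N → ∀ a ∈ Z, P.hitL (X i) a ∈ Z) (hεZ : ∀ a ∈ Z, ε a = 0)
    (hε : ε c = 0) : c = 0 := by
  let act : List ℕ → P.A := fun l => l.foldr (fun i a => P.hitL (X i) a) c
  let T : Set (List ℕ) := {l | ∀ i ∈ l, 1 ≤ i ∧ i < N}
  let M := Submodule.span ℂ (act '' T)
  have hM : ∀ l ∈ T, act l ∈ M := fun l hl => Submodule.subset_span ⟨l, hl, rfl⟩
  have ext : ∀ x : D.U, (∀ l ∈ T, P.hitL x (act l) ∈ M) → x ∈ P.stabL M := fun x hx => by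
    refine P.mem_stabL_span.2 ?_
    rintro _ ⟨l, hl, rfl⟩; exact hx l hl
  have hXs : ∀ i, 1 ≤ i → i < N → X i ∈ P.stabL M := fun i h1 h2 => ext _ fun l hl =>
    hM (i :: l) (by rintro k (_ | ⟨_, hk⟩); exacts [⟨h1, h2⟩, hl k hk])
  have hKe : ∀ j, 1 ≤ j → j < N → ∀ l ∈ T, ∃ t : ℂ, P.hitL (D.Kg j) (act l) = t • act l := by
    intro j h1 h2 l hl
    induction l with
    | nil => exact hcK j h1 h2
    | cons i l ih =>
      obtain ⟨t, ht⟩ := ih fun k hk => hl k (by simp [hk])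
      obtain ⟨t', ht'⟩ := hKX i j (hl i (by simp)).1 (hl i (by simp)).2 h1 h2
      refine ⟨t' * t, ?_⟩
      change P.hitL (D.Kg j) (P.hitL (X i) (act l)) = _ • P.hitL (X i) (act l)
      rw [ht', ht, map_smul, smul_smul]
  have hKs : ∀ j, 1 ≤ j → j < N → ∀ l ∈ T,
      P.hitL (D.Kg j) (act l) ∈ M ∧ P.hitL (D.Ki j) (act l) ∈ M := fun j h1 h2 l hl => by
    obtain ⟨t, ht⟩ := hKe j h1 h2 l hl
    rw [hitL_Ki_of_eigenvector h1 h2 ht, ht]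
    exact ⟨M.smul_mem _ (hM l hl), M.smul_mem _ (hM l hl)⟩
  have hYs : ∀ j, 1 ≤ j → j < N → Y j ∈ P.stabL M := fun j h1 h2 => ext _ fun l hl => by
    induction l with
    | nil => change P.hitL (Y j) c ∈ M; rw [hc j h1 h2]; exact zero_mem _
    | cons i l ih =>
      have hl' : l ∈ T := fun k hk => hl k (by simp [hk])
      obtain ⟨hi1, hi2⟩ := hl i (by simp)
      change P.hitL (Y j) (P.hitL (X i) (act l)) ∈ M
      rw [hYX i j hi1 hi2 h1 h2]
      refine add_mem (hXs i hi1 hi2 _ (ih hl')) ?_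
      split_ifs
      · exact M.smul_mem _ (sub_mem (hKs i hi1 hi2 l hl').1 (hKs i hi1 hi2 l hl').2)
      · exact zero_mem _
  have hEF : ∀ j, 1 ≤ j → j < N → D.E j ∈ P.stabL M ∧ D.F j ∈ P.stabL M := fun j h1 h2 => by
    rcases hgen j with ⟨h, h'⟩ | ⟨h, h'⟩
    · exact h ▸ h' ▸ ⟨hXs j h1 h2, hYs j h1 h2⟩
    · exact h ▸ h' ▸ ⟨hYs j h1 h2, hXs j h1 h2⟩
  refine P.eq_zero_of_stabL (W := M) ?_ ?_ (hM [] (by simp [T]))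
  · have hl : ∀ l ∈ T, l ≠ [] → act l ∈ Z := by
      intro l hl hne
      induction l with
      | nil => exact absurd rfl hne
      | cons i l ih =>
        obtain ⟨hi1, hi2⟩ := hl i (by simp)
        rcases eq_or_ne l [] with rfl | h
        · exact hcZ i hi1 hi2
        · exact hZ i hi1 hi2 _ (ih (fun k hk => hl k (by simp [hk])) h)
    have : M ≤ LinearMap.ker (ε : P.A →ₗ[ℂ] ℂ) := by
      rw [Submodule.span_le]
      rintro _ ⟨l, h, rfl⟩
      rcases eq_or_ne l [] with rfl | hne
      · exact hε
      · exact hεZ _ (hl l h hne)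
    exact this
  · exact D.forall_mem_gens (fun j h1 h2 => (hEF j h1 h2).1) (fun j h1 h2 => (hEF j h1 h2).2)
      (fun j h1 h2 => ext _ fun l hl => (hKs j h1 h2 l hl).1)
      fun j h1 h2 => ext _ fun l hl => (hKs j h1 h2 l hl).2

section Relations

variable {i j : ℕ} (hi1 : 1 ≤ i) (hi2 : i < N) (hj1 : 1 ≤ j) (hj2 : j < N)
include hi1 hi2 hj1 hj2

lemma hitL_F_E (a : P.A) : P.hitL (D.F j) (P.hitL (D.E i) a) =
    P.hitL (D.E i) (P.hitL (D.F j) a) + if i = j then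
      ((q : ℂ) - (q : ℂ)⁻¹)⁻¹ • (P.hitL (D.Kg i) a - P.hitL (D.Ki i) a) else 0 := by
  rw [← hitL_mul, ← hitL_mul, ← sub_eq_iff_eq_add', ← hitL_sub,
    D.rels.2.2.2.2.1 i (UqslData.mem_Icc_pred hi1 hi2) j (UqslData.mem_Icc_pred hj1 hj2)]
  split_ifs
  · rw [hitL_smul, hitL_sub]
  · exact hitL_zero _ _

lemma hitL_E_F (a : P.A) : P.hitL (D.E j) (P.hitL (D.F i) a) =
    P.hitL (D.F i) (P.hitL (D.E j) a) + if i = j then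
      (-((q : ℂ) - (q : ℂ)⁻¹)⁻¹) • (P.hitL (D.Kg i) a - P.hitL (D.Ki i) a) else 0 := by
  have := hitL_F_E (P := P) hj1 hj2 hi1 hi2 a
  rw [this, add_assoc, left_eq_add]
  by_cases h : i = j
  · subst h; simp
  · simp [h, Ne.symm h]

lemma hitL_Kg_E (hq : (q : ℂ) ≠ 0) : ∃ t : ℂ, ∀ a : P.A,
    P.hitL (D.Kg j) (P.hitL (D.E i) a) = t • P.hitL (D.E i) (P.hitL (D.Kg j) a) := by
  refine ⟨((q : ℂ) ^ cartanSL j i)⁻¹, fun a => ?_⟩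
  rw [← hitL_mul, ← hitL_mul,
    D.rels.2.2.1 j (UqslData.mem_Icc_pred hj1 hj2) i (UqslData.mem_Icc_pred hi1 hi2), hitL_smul,
    smul_smul, inv_mul_cancel₀ (zpow_ne_zero _ hq), one_smul]

lemma hitL_Kg_F (hq : (q : ℂ) ≠ 0) : ∃ t : ℂ, ∀ a : P.A,
    P.hitL (D.Kg j) (P.hitL (D.F i) a) = t • P.hitL (D.F i) (P.hitL (D.Kg j) a) := by
  refine ⟨((q : ℂ) ^ (-cartanSL j i))⁻¹, fun a => ?_⟩
  rw [← hitL_mul, ← hitL_mul,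
    D.rels.2.2.2.1 j (UqslData.mem_Icc_pred hj1 hj2) i (UqslData.mem_Icc_pred hi1 hi2), hitL_smul,
    smul_smul, inv_mul_cancel₀ (zpow_ne_zero _ hq), one_smul]

end Relations

lemma counit_wd {l : List (ℕ × ℕ)} (hl : ∀ p ∈ l, Ltr N p) (h : ∃ p ∈ l, p.1 ≠ p.2) :
    ε (P.wd l) = 0 := by
  obtain ⟨p, hp, hne⟩ := h
  obtain ⟨s, t, rfl⟩ := List.append_of_mem hp
  obtain ⟨a1, a2, a3, a4⟩ := hl p (by simp)
  rw [wd_append, wd_cons, Bialgebra.counit_mul, Bialgebra.counit_mul, P.counit_u' a1 a2 a3 a4,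
    if_neg hne, zero_mul, mul_zero]

variable (P r) in
/-- The vectors fixed by the semisimple part of the Levi subalgebra. -/
def semiFix : Submodule ℂ P.A where
  carrier := {a | ∀ c, 1 ≤ c → c < N → c ≠ r → D.E c ∈ P.fixL a ∧ D.F c ∈ P.fixL a ∧
    D.Kg c ∈ P.fixL a}
  add_mem' := fun {a b} ha hb c h1 h2 hc => by
    obtain ⟨h3, h4, h5⟩ := ha c h1 h2 hc
    obtain ⟨h6, h7, h8⟩ := hb c h1 h2 hc
    simp only [mem_fixL] at *
    simp only [map_add, smul_add, *, and_self]
  zero_mem' := fun c h1 h2 hc => by simp [mem_fixL]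
  smul_mem' := fun t a ha c h1 h2 hc => by
    obtain ⟨h3, h4, h5⟩ := ha c h1 h2 hc
    simp only [mem_fixL] at *
    simp only [map_smul, *, smul_comm t, and_self]

lemma hitL_of_mem_semiFix {a : P.A} (ha : a ∈ P.semiFix r) {c : ℕ} (h1 : 1 ≤ c) (h2 : c < N)
    (hc : c ≠ r) : P.hitL (D.E c) a = 0 ∧ P.hitL (D.F c) a = 0 ∧ P.hitL (D.Kg c) a = a := by
  obtain ⟨h3, h4, h5⟩ := ha c h1 h2 hc
  simp only [mem_fixL, UqslData.counit_E' h1 h2, UqslData.counit_F' h1 h2,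
    UqslData.counit_Kg' h1 h2, zero_smul, one_smul] at *
  exact ⟨h3, h4, h5⟩

lemma cnt_eq_of_balanced {l : List (ℕ × ℕ)} {a b : ℕ}
    (h : ∀ c, a ≤ c → c < b → cnt c l = cnt (c + 1) l) {i : ℕ} (hi : a ≤ i) (hib : i ≤ b) :
    cnt i l = cnt a l := by
  induction i, hi using Nat.le_induction with
  | base => rfl
  | succ i hi ih => rw [← ih (by omega), h i hi (by omega)]

lemma mul_cnt_of_balanced {l : List (ℕ × ℕ)} {a b : ℕ}
    (h : ∀ c, a ≤ c → c < b → cnt c l = cnt (c + 1) l) (hl : ∀ p ∈ l, a ≤ p.1 ∧ p.1 ≤ b) :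
    (b + 1 - a) * cnt a l = l.length := by
  rw [← sum_cnt (s := Finset.Icc a b) (by simpa using hl), Finset.sum_congr rfl fun i hi =>
    cnt_eq_of_balanced h (Finset.mem_Icc.1 hi).1 (Finset.mem_Icc.1 hi).2]
  simp

lemma cnt_eq_zero {l : List (ℕ × ℕ)} {i : ℕ} (h : ∀ p ∈ l, p.1 ≠ i) : cnt i l = 0 :=
  List.count_eq_zero.2 (by simpa using fun b hb => h (i, b) hb rfl)

/-- A combination of words of constant weight is a weight vector. -/
lemma hitL_Kg_wds (hq : (q : ℂ) ≠ 0) {c : ℕ} (h1 : 1 ≤ c) (h2 : c < N)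
    {S : List (ℕ × ℕ) → Prop} (hS : ∀ l, S l → ∀ p ∈ l, Ltr N p) {m : ℤ}
    (h : ∀ l, S l → (cnt c l : ℤ) - cnt (c + 1) l = m) {a : P.A} (ha : a ∈ P.wds S) :
    P.hitL (D.Kg c) a = (q : ℂ) ^ m • a := by
  have : P.wds S ≤ Module.End.eigenspace (P.hitL (D.Kg c)) ((q : ℂ) ^ m) := wds_le.2 fun l hl => by
    rw [Module.End.mem_eigenspace_iff, hitL_Kg_wd h1 h2 hq (hS l hl), h l hl]
  exact Module.End.mem_eigenspace_iff.1 (this ha)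

lemma eq_zero_of_blk₁ (hq : Transcendental ℚ q) (hr1 : 1 ≤ r) (hr2 : r < N) {n : ℕ} {a : P.A}
    (ha : a ∈ P.wds fun l => (∀ p ∈ l, Blk₁ N r p) ∧ l.length = n) (hf : a ∈ P.semiFix r)
    (hε : ε a = 0) : a = 0 := by
  have hq0 := ofReal_ne_zero_of_transcendental hq
  have ha' := mem_wds_of_fixed hq (Finset.Ico 1 r) (by simp; omega)
    (fun l hl p hp => (hl.1 p hp).1) ha fun c hc => by
      simp only [Finset.mem_Ico] at hc
      exact (hitL_of_mem_semiFix hf hc.1 (by omega) (by omega)).2.2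
  have hZ : ∀ l : List (ℕ × ℕ), ((∀ p ∈ l, Ltr N p ∧ p.2 ≤ r) ∧ ∃ p ∈ l, r < p.1) → ∀ p ∈ l, Ltr N p :=
    fun l hl p hp => (hl.1 p hp).1
  refine eq_zero_of_extremal (X := D.E) (Y := D.F) (fun i => .inl ⟨rfl, rfl⟩)
    (fun i j hi1 hi2 hj1 hj2 => hitL_F_E hi1 hi2 hj1 hj2)
    (fun i j hi1 hi2 hj1 hj2 => hitL_Kg_E hi1 hi2 hj1 hj2 hq0) (c := a)
    (Z := P.wds fun l : List (ℕ × ℕ) => (∀ p ∈ l, Ltr N p ∧ p.2 ≤ r) ∧ ∃ p ∈ l, r < p.1) ?_ ?_ ?_ ?_ ?_ hε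
  · intro j h1 h2
    by_cases hj : j = r
    · subst hj
      have := hitL_F_wds (P := P) h1 h2 hq0 (S' := fun _ => False)
        (fun l hl p hp => (hl.1 p hp).1) (fun s t i h => by
          have := (h.1 (j + 1, i) (by simp)).2.1; dsimp only at this; omega) ha
      simpa [wds] using this
    · exact (hitL_of_mem_semiFix hf h1 h2 hj).2.1
  · intro j h1 h2
    by_cases hj : j = r
    · subst hj
      refine ⟨_, hitL_Kg_wds hq0 h1 h2 (m := ((n / j : ℕ) : ℤ))
        (fun l hl p hp => (hl.1.1 p hp).1) (fun l hl => ?_) ha'⟩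
      have hb : ∀ c, 1 ≤ c → c < j → cnt c l = cnt (c + 1) l := by simpa using hl.2
      have := mul_cnt_of_balanced hb fun p hp => ⟨(hl.1.1 p hp).1.1, (hl.1.1 p hp).2.1⟩
      rw [Nat.add_sub_cancel, hl.1.2, ← cnt_eq_of_balanced hb h1 le_rfl] at this
      rw [cnt_eq_zero (i := j + 1) fun p hp => by have := (hl.1.1 p hp).2.1; omega, ← this,
        Nat.mul_div_cancel_left _ h1]
      simp
    · exact ⟨1, by rw [(hitL_of_mem_semiFix hf h1 h2 hj).2.2, one_smul]⟩
  · intro i h1 h2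
    by_cases hi : i = r
    · subst hi
      refine hitL_E_wds h1 h2 (fun l hl p hp => (hl.1 p hp).1) (fun s t j h => ⟨?_, ?_⟩) ha
      · intro p hp
        have h3 := h.1 (i, j) (by simp)
        simp only [List.mem_append, List.mem_cons] at hp
        rcases hp with hp | rfl | hp
        · exact ⟨(h.1 p (by simp [hp])).1, (h.1 p (by simp [hp])).2.2⟩
        · simp only [Blk₁, Ltr] at *; omega
        · exact ⟨(h.1 p (by simp [hp])).1, (h.1 p (by simp [hp])).2.2⟩
      · exact ⟨(i + 1, j), by simp, by simp⟩
    · rw [(hitL_of_mem_semiFix hf h1 h2 hi).1]; exact zero_mem _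
  · intro i h1 h2 b hb
    refine hitL_E_wds h1 h2 hZ (fun s t j h => ⟨?_, ?_⟩) hb
    · intro p hp
      have h3 := h.1 (i, j) (by simp)
      simp only [List.mem_append, List.mem_cons] at hp
      rcases hp with hp | rfl | hp
      · exact h.1 p (by simp [hp])
      · simp only [Ltr] at *; omega
      · exact h.1 p (by simp [hp])
    · obtain ⟨p, hp, hpr⟩ := h.2
      simp only [List.mem_append, List.mem_cons] at hp
      rcases hp with hp | rfl | hp
      · exact ⟨p, by simp [hp], hpr⟩
      · exact ⟨(i + 1, j), by simp, by dsimp only at *; omega⟩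
      · exact ⟨p, by simp [hp], hpr⟩
  · intro b hb
    have : (P.wds fun l : List (ℕ × ℕ) => (∀ p ∈ l, Ltr N p ∧ p.2 ≤ r) ∧ ∃ p ∈ l, r < p.1) ≤
        LinearMap.ker (ε : P.A →ₗ[ℂ] ℂ) := wds_le.2 fun l hl => by
      obtain ⟨p, hp, hpr⟩ := hl.2
      exact counit_wd (hZ l hl) ⟨p, hp, by have := (hl.1 p hp).2; omega⟩
    exact this hb

lemma eq_zero_of_blk₂ (hq : Transcendental ℚ q) (hr1 : 1 ≤ r) (hr2 : r < N) {n : ℕ} {a : P.A}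
    (ha : a ∈ P.wds fun l => (∀ p ∈ l, Blk₂ N r p) ∧ l.length = n) (hf : a ∈ P.semiFix r)
    (hε : ε a = 0) : a = 0 := by
  have hq0 := ofReal_ne_zero_of_transcendental hq
  have ha' := mem_wds_of_fixed hq (Finset.Ico (r + 1) N) (by simp; omega)
    (fun l hl p hp => (hl.1 p hp).1) ha fun c hc => by
      simp only [Finset.mem_Ico] at hc
      exact (hitL_of_mem_semiFix hf (by omega) (by omega) (by omega)).2.2
  have hZ : ∀ l : List (ℕ × ℕ), ((∀ p ∈ l, Ltr N p ∧ r < p.2) ∧ ∃ p ∈ l, p.1 ≤ r) → ∀ p ∈ l, Ltr N p :=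
    fun l hl p hp => (hl.1 p hp).1
  refine eq_zero_of_extremal (X := D.F) (Y := D.E) (fun i => .inr ⟨rfl, rfl⟩)
    (fun i j hi1 hi2 hj1 hj2 => hitL_E_F hi1 hi2 hj1 hj2)
    (fun i j hi1 hi2 hj1 hj2 => hitL_Kg_F hi1 hi2 hj1 hj2 hq0) (c := a)
    (Z := P.wds fun l : List (ℕ × ℕ) => (∀ p ∈ l, Ltr N p ∧ r < p.2) ∧ ∃ p ∈ l, p.1 ≤ r) ?_ ?_ ?_ ?_ ?_ hε
  · intro j h1 h2
    by_cases hj : j = r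
    · subst hj
      have := hitL_E_wds (P := P) h1 h2 (S' := fun _ => False)
        (fun l hl p hp => (hl.1 p hp).1) (fun s t i h => by
          have := (h.1 (j, i) (by simp)).2.1; dsimp only at this; omega) ha
      simpa [wds] using this
    · exact (hitL_of_mem_semiFix hf h1 h2 hj).1
  · intro j h1 h2
    by_cases hj : j = r
    · subst hj
      refine ⟨_, hitL_Kg_wds hq0 h1 h2 (m := -((n / (N - j) : ℕ) : ℤ))
        (fun l hl p hp => (hl.1.1 p hp).1) (fun l hl => ?_) ha'⟩
      have hb : ∀ c, j + 1 ≤ c → c < N → cnt c l = cnt (c + 1) l := fun c hc1 hc2 =>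
        hl.2 c (Finset.mem_Ico.2 ⟨hc1, hc2⟩)
      have := mul_cnt_of_balanced hb fun p hp => ⟨(hl.1.1 p hp).2.1, (hl.1.1 p hp).1.2.1⟩
      rw [hl.1.2, Nat.add_sub_add_right] at this
      rw [cnt_eq_zero (i := j) fun p hp => by have := (hl.1.1 p hp).2.1; omega, ← this,
        Nat.mul_div_cancel_left _ (by omega)]
      simp
    · exact ⟨1, by rw [(hitL_of_mem_semiFix hf h1 h2 hj).2.2, one_smul]⟩
  · intro i h1 h2
    by_cases hi : i = r
    · subst hi
      refine hitL_F_wds h1 h2 hq0 (fun l hl p hp => (hl.1 p hp).1) (fun s t j h => ⟨?_, ?_⟩) ha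
      · intro p hp
        have h3 := h.1 (i + 1, j) (by simp)
        simp only [List.mem_append, List.mem_cons] at hp
        rcases hp with hp | rfl | hp
        · exact ⟨(h.1 p (by simp [hp])).1, (h.1 p (by simp [hp])).2.2⟩
        · simp only [Blk₂, Ltr] at *; omega
        · exact ⟨(h.1 p (by simp [hp])).1, (h.1 p (by simp [hp])).2.2⟩
      · exact ⟨(i, j), by simp, by simp⟩
    · rw [(hitL_of_mem_semiFix hf h1 h2 hi).2.1]; exact zero_mem _
  · intro i h1 h2 b hb
    refine hitL_F_wds h1 h2 hq0 hZ (fun s t j h => ⟨?_, ?_⟩) hb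
    · intro p hp
      have h3 := h.1 (i + 1, j) (by simp)
      simp only [List.mem_append, List.mem_cons] at hp
      rcases hp with hp | rfl | hp
      · exact h.1 p (by simp [hp])
      · simp only [Ltr] at *; omega
      · exact h.1 p (by simp [hp])
    · obtain ⟨p, hp, hpr⟩ := h.2
      simp only [List.mem_append, List.mem_cons] at hp
      rcases hp with hp | rfl | hp
      · exact ⟨p, by simp [hp], hpr⟩
      · exact ⟨(i, j), by simp, by dsimp only at *; omega⟩
      · exact ⟨p, by simp [hp], hpr⟩
  · intro b hb
    have : (P.wds fun l : List (ℕ × ℕ) => (∀ p ∈ l, Ltr N p ∧ r < p.2) ∧ ∃ p ∈ l, p.1 ≤ r) ≤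
        LinearMap.ker (ε : P.A →ₗ[ℂ] ℂ) := wds_le.2 fun l hl => by
      obtain ⟨p, hp, hpr⟩ := hl.2
      exact counit_wd (hZ l hl) ⟨p, hp, by have := (hl.1 p hp).2; omega⟩
    exact this hb

end QslnFun

namespace UqslData

variable {q : ℝ} {N : ℕ} (D : UqslData q N) {r : ℕ}

/-- A star-closed set of generators of the `c`-th copy of `U_q(sl_2)`. -/
def star₂ (c : ℕ) : Set D.U := {x | x = D.E c ∨ x = D.F c ∨ x = (q : ℂ)⁻¹ • (D.F c * D.Kg c) ∨
  x = (q : ℂ) • (D.Ki c * D.E c) ∨ x = D.Kg c ∨ x = D.Ki c}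

/-- A star-closed set of generators of the semisimple part of the Levi subalgebra. -/
def starS (r : ℕ) : Set D.U := {x | ∃ c, 1 ≤ c ∧ c < N ∧ c ≠ r ∧ x ∈ D.star₂ c}

lemma starS_subset : D.starS r ⊆ D.Ksub r := by
  rintro x ⟨c, h1, h2, h, rfl | rfl | rfl | rfl | rfl | rfl⟩
  · exact D.E_mem_Ksub h1 h2 h
  · exact D.F_mem_Ksub h1 h2 h
  · exact Subalgebra.smul_mem _ (mul_mem (D.F_mem_Ksub h1 h2 h) (D.Kg_mem_Ksub h1 h2)) _
  · exact Subalgebra.smul_mem _ (mul_mem (D.Ki_mem_Ksub h1 h2) (D.E_mem_Ksub h1 h2 h)) _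
  · exact D.Kg_mem_Ksub h1 h2
  · exact D.Ki_mem_Ksub h1 h2

end UqslData

namespace QslnFun

variable {q : ℝ} {N : ℕ} {D : UqslData q N} {P : QslnFun q N D} {r : ℕ}

lemma starS_adj (hq : (q : ℂ) ≠ 0) : ∀ x ∈ D.starS r, ∃ x' ∈ D.starS r, P.IsAdj x x' := by
  rintro x ⟨c, h1, h2, h, rfl | rfl | rfl | rfl | rfl | rfl⟩
  · exact ⟨_, ⟨c, h1, h2, h, .inr (.inr (.inl rfl))⟩, isAdj_E h1 h2 hq⟩
  · exact ⟨_, ⟨c, h1, h2, h, .inr (.inr (.inr (.inl rfl)))⟩, isAdj_F h1 h2 hq⟩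
  · exact ⟨_, ⟨c, h1, h2, h, .inl rfl⟩, (isAdj_E h1 h2 hq).symm⟩
  · exact ⟨_, ⟨c, h1, h2, h, .inr (.inl rfl)⟩, (isAdj_F h1 h2 hq).symm⟩
  · exact ⟨_, ⟨c, h1, h2, h, .inr (.inr (.inr (.inr (.inl rfl))))⟩, isAdj_Kg h1 h2⟩
  · exact ⟨_, ⟨c, h1, h2, h, .inr (.inr (.inr (.inr (.inr rfl))))⟩, isAdj_Ki h1 h2⟩

/-- `b` is invariant under the `c`-th copy of `U_q(sl_2)`. -/
def Fixed₂ (P : QslnFun q N D) (c : ℕ) (b : P.A) : Prop :=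
  P.hitL (D.E c) b = 0 ∧ P.hitL (D.F c) b = 0 ∧ P.hitL (D.Kg c) b = b ∧ P.hitL (D.Ki c) b = b

section

variable {c : ℕ} (h1 : 1 ≤ c) (h2 : c < N)
include h1 h2

lemma Fixed₂.hitL_mul {b : P.A} (hb : P.Fixed₂ c b) {x : D.U} (hx : x ∈ D.star₂ c) (a : P.A) :
    P.hitL x (a * b) = P.hitL x a * b ∧ P.hitL x (b * a) = b * P.hitL x a := by
  obtain ⟨hE, hF, hK, hK'⟩ := hb
  rcases hx with rfl | rfl | rfl | rfl | rfl | rfl <;>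
  simp only [hitL_smul, QslnFun.hitL_mul, P.hitL_E_mul h1 h2, P.hitL_F_mul h1 h2,
    P.hitL_Kg_mul h1 h2, P.hitL_Ki_mul h1 h2, hE, hF, hK, hK', mul_zero, zero_mul, add_zero,
    zero_add, smul_mul_assoc, mul_smul_comm, and_self]

lemma Fixed₂.hitL {b : P.A} (hb : P.Fixed₂ c b) {x : D.U} (hx : x ∈ D.star₂ c) :
    P.hitL x b = ε x • b := by
  have := (hb.hitL_mul h1 h2 hx 1).1
  rwa [one_mul, hitL_oneA, smul_mul_assoc, one_mul] at this

lemma fixed₂_of_mem_semiFix {a : P.A} (ha : a ∈ P.semiFix r) (hc : c ≠ r) : P.Fixed₂ c a := by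
  obtain ⟨hE, hF, hK⟩ := hitL_of_mem_semiFix ha h1 h2 hc
  refine ⟨hE, hF, hK, ?_⟩
  simpa using hitL_Ki_of_eigenvector (P := P) (a := a) (μ := 1) h1 h2 (by rw [hK, one_smul])

lemma fixed₂_wds (hq : (q : ℂ) ≠ 0) {S : List (ℕ × ℕ) → Prop}
    (hS : ∀ l, S l → ∀ p ∈ l, Ltr N p ∧ p.1 ≠ c ∧ p.1 ≠ c + 1) {a : P.A} (ha : a ∈ P.wds S) :
    P.Fixed₂ c a := by
  have hS' : ∀ l, S l → ∀ p ∈ l, Ltr N p := fun l hl p hp => (hS l hl p hp).1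
  have hE := hitL_E_wds h1 h2 (S' := fun _ => False) hS'
    (fun s t j h => (hS _ h (c, j) (by simp)).2.1 rfl) ha
  have hF := hitL_F_wds h1 h2 hq (S' := fun _ => False) hS'
    (fun s t j h => (hS _ h (c + 1, j) (by simp)).2.2 rfl) ha
  have hK := hitL_Kg_wds hq h1 h2 hS' (m := 0) (fun l hl => by
    rw [cnt_eq_zero fun p hp => (hS l hl p hp).2.1, cnt_eq_zero fun p hp => (hS l hl p hp).2.2,
      sub_self]) ha
  have hK' := hitL_Ki_of_eigenvector h1 h2 hK
  exact ⟨by simpa [wds] using hE, by simpa [wds] using hF, by simpa using hK, by simpa using hK'⟩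

end

lemma le_semiFix_sup (hq : (q : ℂ) ≠ 0) {W : Submodule ℂ P.A} (hW : D.Ksub r ≤ P.stabL W) :
    W ≤ (W ⊓ P.semiFix r) ⊔
      Submodule.span ℂ {x | ∃ g : D.starS r, ∃ a ∈ W, x = P.hitL (g : D.U) a - ε (g : D.U) • a} := by
  refine (le_inf_sup_of_compl (T := fun x : D.starS r => P.hitL (x : D.U)) (fun x => ε (x : D.U))
    (fun W hW => exists_isCompl_of_star (starS_adj hq) P.hitL (fun _ : Unit => LinearMap.id)
      (by simp) (by simp) hW) (W := W)
    fun x => hW (D.starS_subset x.2)).trans (sup_le_sup (inf_le_inf_left _ ?_) le_rfl)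
  intro b hb
  simp only [Submodule.mem_iInf, LinearMap.mem_ker, LinearMap.sub_apply, LinearMap.smul_apply,
    LinearMap.id_apply, sub_eq_zero] at hb
  exact fun c h1 h2 hc => ⟨hb ⟨_, c, h1, h2, hc, .inl rfl⟩, hb ⟨_, c, h1, h2, hc, .inr (.inl rfl)⟩,
    hb ⟨_, c, h1, h2, hc, .inr (.inr (.inr (.inr (.inl rfl))))⟩⟩

lemma mem_semiFix_mul_of_mem_Bmod (hq : (q : ℂ) ≠ 0) {n n' : ℕ} {b : P.A} (hb : b ∈ P.Bmod r)
    (h : b ∈ P.ltrs (Blk₁ N r) ^ n * P.ltrs (Blk₂ N r) ^ n') :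
    b ∈ (P.ltrs (Blk₁ N r) ^ n ⊓ P.semiFix r) * (P.ltrs (Blk₂ N r) ^ n' ⊓ P.semiFix r) := by
  set X := P.ltrs (Blk₁ N r) ^ n with hX
  set X' := P.ltrs (Blk₂ N r) ^ n' with hX'
  set Q := Submodule.span ℂ {x | ∃ g : D.starS r, ∃ a, x = P.hitL (g : D.U) a - ε (g : D.U) • a}
    with hQ
  have hXf : ∀ a ∈ X, ∀ c, r < c → 1 ≤ c → c < N → P.Fixed₂ c a := fun a ha c hc h1 h2 => by
    rw [hX, ltrs_pow_eq] at ha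
    refine fixed₂_wds h1 h2 hq (fun l hl p hp => ?_) ha
    have := hl.1 p hp
    exact ⟨this.1, by have := this.2.1; omega, by have := this.2.1; omega⟩
  have hXf' : ∀ a ∈ X', ∀ c, c < r → 1 ≤ c → c < N → P.Fixed₂ c a := fun a ha c hc h1 h2 => by
    rw [hX', ltrs_pow_eq] at ha
    refine fixed₂_wds h1 h2 hq (fun l hl p hp => ?_) ha
    have := hl.1 p hp
    exact ⟨this.1, by have := this.2.1; omega, by have := this.2.1; omega⟩
  have step1 : X * X' ≤ (X ⊓ P.semiFix r) * X' ⊔ Q := by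
    refine (mul_le_mul' (le_semiFix_sup hq (stabL_pow stabL_blk₁ n)) le_rfl).trans ?_
    rw [Submodule.sup_mul]
    refine sup_le_sup le_rfl (Submodule.mul_le.2 fun a ha b hb => ?_)
    induction ha using Submodule.span_induction with
    | zero => simp
    | add a a' _ _ h h' => rw [add_mul]; exact add_mem h h'
    | smul t a _ h => rw [smul_mul_assoc]; exact Q.smul_mem t h
    | mem a ha =>
      obtain ⟨⟨g, c, h1, h2, hc, hg⟩, a, ha, rfl⟩ := ha
      rcases lt_or_gt_of_ne hc with hc' | hc'
      · have := ((hXf' b hb c hc' h1 h2).hitL_mul h1 h2 hg a).1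
        dsimp only
        rw [sub_mul, ← this, smul_mul_assoc]
        exact Submodule.subset_span ⟨⟨g, c, h1, h2, hc, hg⟩, _, rfl⟩
      · have := (hXf a ha c hc' h1 h2).hitL h1 h2 hg
        simp [this]
  have step2 : (X ⊓ P.semiFix r) * X' ≤ (X ⊓ P.semiFix r) * (X' ⊓ P.semiFix r) ⊔ Q := by
    refine (mul_le_mul' le_rfl (le_semiFix_sup hq (stabL_pow stabL_blk₂ n'))).trans ?_
    rw [Submodule.mul_sup]
    refine sup_le_sup le_rfl (Submodule.mul_le.2 fun a ha b hb => ?_)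
    induction hb using Submodule.span_induction with
    | zero => simp
    | add a a' _ _ h h' => rw [mul_add]; exact add_mem h h'
    | smul t a _ h => rw [mul_smul_comm]; exact Q.smul_mem t h
    | mem b hb =>
      obtain ⟨⟨g, c, h1, h2, hc, hg⟩, b, hb, rfl⟩ := hb
      have := ((fixed₂_of_mem_semiFix h1 h2 ha.2 hc).hitL_mul h1 h2 hg b).2
      dsimp only
      rw [mul_sub, ← this, mul_smul_comm]
      exact Submodule.subset_span ⟨⟨g, c, h1, h2, hc, hg⟩, _, rfl⟩
  obtain ⟨y, hy, z, hz, rfl⟩ := Submodule.mem_sup.1 ((step1.trans (sup_le step2 le_sup_right)) h)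
  suffices z = 0 by rwa [this, add_zero]
  have hyf : ∀ g : D.starS r, P.hitL (g : D.U) y = ε (g : D.U) • y := by
    rintro ⟨g, c, h1, h2, hc, hg⟩
    refine Submodule.mul_induction_on hy (fun a ha b hb => ?_) (fun a b ha hb => ?_)
    · have := ((fixed₂_of_mem_semiFix h1 h2 ha.2 hc).hitL_mul h1 h2 hg b).2
      dsimp only
      rw [this, (fixed₂_of_mem_semiFix h1 h2 hb.2 hc).hitL h1 h2 hg, mul_smul_comm]
    · rw [map_add, ha, hb, smul_add]
  refine disjoint_of_compl (T := fun x : D.starS r => P.hitL (x : D.U)) (fun x => ε (x : D.U))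
    (fun W hW => exists_isCompl_of_star (starS_adj hq) P.hitL (fun _ : Unit => LinearMap.id)
      (by simp) (by simp) hW) (fun g => ?_) hz
  have := hitL_of_mem_Bmod hb (D.starS_subset g.2)
  rw [map_add, hyf g, smul_add] at this
  exact add_left_cancel this

lemma exists_le_span_singleton {I : Submodule ℂ P.A} (h : ∀ a ∈ I, ε a = 0 → a = 0) :
    ∃ c, I ≤ Submodule.span ℂ {c} ∧ (ε c = 0 → c = 0) := by
  by_cases hI : ∀ a ∈ I, ε a = 0
  · exact ⟨0, fun a ha => by simp [h a ha (hI a ha)], fun _ => rfl⟩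
  · push Not at hI
    obtain ⟨c, hc, hc0⟩ := hI
    refine ⟨c, fun a ha => Submodule.mem_span_singleton.2 ⟨ε a / ε c, ?_⟩, fun h => absurd h hc0⟩
    refine (sub_eq_zero.1 (h _ (sub_mem ha (I.smul_mem _ hc)) ?_)).symm
    rw [map_sub, map_smul, smul_eq_mul, div_mul_cancel₀ _ hc0, sub_self]

lemma eq_zero_of_mem_diag (hq : Transcendental ℚ q) (hr1 : 1 ≤ r) (hr2 : r < N) {n n' : ℕ}
    {b : P.A} (hb : b ∈ P.Bmod r) (h : b ∈ P.ltrs (Blk₁ N r) ^ n * P.ltrs (Blk₂ N r) ^ n')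
    (hε : ε b = 0) : b = 0 := by
  have h' := mem_semiFix_mul_of_mem_Bmod (ofReal_ne_zero_of_transcendental hq) hb h
  obtain ⟨c, hc, hc0⟩ := exists_le_span_singleton (I := P.ltrs (Blk₁ N r) ^ n ⊓ P.semiFix r)
    fun a ha => eq_zero_of_blk₁ hq hr1 hr2 (by rw [← ltrs_pow_eq]; exact ha.1) ha.2
  obtain ⟨c', hc', hc0'⟩ := exists_le_span_singleton (I := P.ltrs (Blk₂ N r) ^ n' ⊓ P.semiFix r)
    fun a ha => eq_zero_of_blk₂ hq hr1 hr2 (by rw [← ltrs_pow_eq]; exact ha.1) ha.2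
  have := (mul_le_mul' hc hc' : _ ≤ _ * _) h'
  rw [Submodule.span_mul_span, Set.singleton_mul_singleton, Submodule.mem_span_singleton] at this
  obtain ⟨t, rfl⟩ := this
  rw [map_smul, Bialgebra.counit_mul, smul_eq_mul, mul_eq_zero, mul_eq_zero] at hε
  rcases hε with h | h | h
  · simp [h]
  · simp [hc0 h]
  · simp [hc0' h]

lemma minor_mem_wds (rows : List ℕ) (hr : ∀ i ∈ rows, 1 ≤ i ∧ i ≤ N) (S : Finset ℕ)
    (hS : ∀ j ∈ S, 1 ≤ j ∧ j ≤ N) :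
    P.minor rows S ∈ P.wds fun l => (∀ p ∈ l, Ltr N p) ∧ l.map Prod.fst = rows := by
  induction rows generalizing S with
  | nil =>
    rw [minor]
    split_ifs
    · exact Submodule.subset_span ⟨[], ⟨by simp, rfl⟩, P.wd_nil⟩
    · exact zero_mem _
  | cons i rows ih =>
    refine Submodule.sum_mem _ fun j hj => Submodule.smul_mem _ _ ?_
    refine (wds_mul_wds (S := fun l => l = [(i, j)]) (S' := fun l => (∀ p ∈ l, Ltr N p) ∧
      l.map Prod.fst = rows) ?_) (Submodule.mul_mem_mul ?_ (ih (fun i hi => hr i (by simp [hi])) _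
        fun j hj => hS j (Finset.mem_of_mem_erase hj)))
    · rintro _ l rfl ⟨h, h'⟩
      have := hr i (by simp)
      have := hS j hj
      refine ⟨?_, by simp [h']⟩
      simp only [List.cons_append, List.nil_append, List.mem_cons, forall_eq_or_imp]
      exact ⟨⟨by simp_all, by simp_all, by simp_all, by simp_all⟩, h⟩
    · simpa using wd_mem_wds (P := P) (S := fun l => l = [(i, j)]) rfl

lemma one_mem_wds (hq : (q : ℂ) ≠ 0) (m : ℕ) :
    (1 : P.A) ∈ P.wds fun l => (∀ p ∈ l, Ltr N p) ∧ ∀ i ∈ Finset.Icc 1 N, cnt i l = m := by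
  induction m with
  | zero => exact wd_mem_wds (l := []) (by simp [cnt])
  | succ m ih =>
    have h := minor_mem_wds (P := P) (List.range' 1 N) (by simp; omega) (Finset.Ico 1 (1 + N))
      (by simp; omega)
    rw [P.minor_full hq] at h
    rw [← one_mul (1 : P.A)]
    refine wds_mul_wds ?_ (Submodule.mul_mem_mul ih h)
    rintro l l' ⟨hl, hm⟩ ⟨hl', h'⟩
    refine ⟨by simp only [List.mem_append]; rintro p (hp | hp); exacts [hl p hp, hl' p hp], ?_⟩
    intro i hi
    have e : cnt i l' = 1 := by
      rw [cnt, h', List.count_eq_one_of_mem List.nodup_range' (by simp at hi ⊢; omega)]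
    rw [← hm i hi, ← e, cnt, List.map_append, List.count_append]; rfl

lemma counit_offIdeal {a : P.A} (ha : a ∈ P.offIdeal r) : ε a = 0 := by
  have : P.offIdeal r ≤ LinearMap.ker (ε : P.A →ₗ[ℂ] ℂ) := by
    refine Submodule.mul_le.2 fun a _ b hb => ?_
    have h : P.ltrs (Off N r) ≤ LinearMap.ker (ε : P.A →ₗ[ℂ] ℂ) := ltrs_le.2 fun i j h => by
      rw [LinearMap.mem_ker, P.counit_u' h.1.1 h.1.2.1 h.1.2.2.1 h.1.2.2.2,
        if_neg fun e => h.2 (by rw [show i = j from e])]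
    rw [LinearMap.mem_ker, Bialgebra.counit_mul, LinearMap.mem_ker.1 (h hb), mul_zero]
  exact this ha

lemma mem_iSup_inf_Bmod (hq : (q : ℂ) ≠ 0) {ι : Type*} {W : ι → Submodule ℂ P.A}
    (hW : ∀ i, D.Ksub r ≤ P.stabL (W i)) {b : P.A} (hb : b ∈ P.Bmod r) (h : b ∈ ⨆ i, W i) :
    b ∈ ⨆ i, W i ⊓ P.Bmod r := by
  have : ⨆ i, W i ≤ (⨆ i, W i ⊓ P.Bmod r) ⊔ P.Kplus r ⊤ := iSup_le fun i =>
    (le_Bmod_sup_Kplus hq (hW i)).trans (sup_le_sup (le_iSup (fun i => W i ⊓ P.Bmod r) i)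
      (Submodule.span_mono fun x ⟨k, hk, a, _, h⟩ => ⟨k, hk, a, trivial, h⟩))
  obtain ⟨y, hy, z, hz, rfl⟩ := Submodule.mem_sup.1 (this h)
  have hy' : y ∈ P.Bmod r := (iSup_le fun i => inf_le_right : ⨆ i, W i ⊓ P.Bmod r ≤ _) hy
  rwa [eq_zero_of_mem_Bmod_of_mem_Kplus hq ((Submodule.add_mem_iff_right _ hy').1 hb) hz, add_zero]

lemma stabL_offIdeal : D.Ksub r ≤ P.stabL (P.offIdeal r) := stabL_mul stabL_top stabL_off

lemma stabL_diag (n n' : ℕ) :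
    D.Ksub r ≤ P.stabL (P.ltrs (Blk₁ N r) ^ n * P.ltrs (Blk₂ N r) ^ n') :=
  stabL_mul (stabL_pow stabL_blk₁ n) (stabL_pow stabL_blk₂ n')

open Classical in
lemma wd_mem_offIdeal_sup (hq : (q : ℂ) ≠ 0) {l : List (ℕ × ℕ)} (hl : ∀ p ∈ l, Ltr N p) :
    P.wd l ∈ P.offIdeal r ⊔ P.ltrs (Blk₁ N r) ^ ((l.map Prod.fst).filter (· ≤ r)).length *
      P.ltrs (Blk₂ N r) ^ ((l.map Prod.fst).filter (r < ·)).length := by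
  by_cases h : ∃ p ∈ l, Off N r p
  · exact Submodule.mem_sup_left (wd_mem_offIdeal hq hl h)
  push Not at h
  have h' : ∀ p ∈ l, p.1 ≤ r ↔ p.2 ≤ r := fun p hp => by
    have := h p hp
    simp only [Off, not_and, not_not] at this
    exact this (hl p hp)
  have e1 : ((l.map Prod.fst).filter (· ≤ r)).length = (l.filter (Blk₁ N r ·)).length := by
    rw [List.filter_map, List.length_map]
    refine congrArg _ (List.filter_congr fun p hp => ?_)
    exact decide_eq_decide.2 ⟨fun h => ⟨hl p hp, h, (h' p hp).1 h⟩, fun h => h.2.1⟩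
  have e2 : ((l.map Prod.fst).filter (r < ·)).length = (l.filter (Blk₂ N r ·)).length := by
    rw [List.filter_map, List.length_map]
    refine congrArg _ (List.filter_congr fun p hp => ?_)
    refine decide_eq_decide.2 ⟨fun h => ⟨hl p hp, h, ?_⟩, fun h => h.2.1⟩
    have := h' p hp
    have : r < p.1 := h
    omega
  rw [e1, e2, ← sub_add_cancel (P.wd l) (P.wd (l.filter (Blk₁ N r ·)) * P.wd (l.filter (Blk₂ N r ·)))]
  refine Submodule.add_mem_sup (wd_sub_mem_offIdeal hq l fun p hp => ?_)
    (Submodule.mul_mem_mul (wd_mem_ltrs_pow _ (by simp)) (wd_mem_ltrs_pow _ (by simp)))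
  have := h' p hp
  simp only [Blk₁, Blk₂, hl p hp, true_and]
  omega

lemma length_filter_le {l : List ℕ} {m : ℕ} (hl : ∀ i ∈ l, 1 ≤ i)
    (h : ∀ i ∈ Finset.Icc 1 r, l.count i = m) : (l.filter (· ≤ r)).length = r * m := by
  rw [← Multiset.coe_card, ← Multiset.sum_count_eq_card (s := Finset.Icc 1 r)]
  · rw [Finset.sum_congr rfl fun i hi => by
      rw [Multiset.coe_count, List.count_filter (by simpa using (Finset.mem_Icc.1 hi).2), h i hi]]
    simp
  · simpa using fun i hi hr => ⟨hl i hi, hr⟩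

lemma length_filter_gt {l : List ℕ} {m : ℕ} (hl : ∀ i ∈ l, i ≤ N)
    (h : ∀ i ∈ Finset.Icc (r + 1) N, l.count i = m) :
    (l.filter (r < ·)).length = (N - r) * m := by
  rw [← Multiset.coe_card, ← Multiset.sum_count_eq_card (s := Finset.Icc (r + 1) N)]
  · rw [Finset.sum_congr rfl fun i hi => by
      rw [Multiset.coe_count, List.count_filter (by simpa using (Finset.mem_Icc.1 hi).1), h i hi]]
    simp
  · simpa using fun i hi hr => ⟨hr, hl i hi⟩

/-- A power of the product of the two diagonal quantum minors, up to off-diagonal terms. -/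
lemma exists_sub_mem_offIdeal (hq : (q : ℂ) ≠ 0) (hr : r ≤ N) (m : ℕ) :
    ∃ y ∈ P.ltrs (Blk₁ N r) ^ (r * m) * P.ltrs (Blk₂ N r) ^ ((N - r) * m),
      y ∈ P.Bmod r ∧ 1 - y ∈ P.offIdeal r := by
  have h : (1 : P.A) ∈ P.offIdeal r ⊔
      P.ltrs (Blk₁ N r) ^ (r * m) * P.ltrs (Blk₂ N r) ^ ((N - r) * m) := by
    refine (wds_le.2 fun l hl => ?_ : P.wds _ ≤ _) (one_mem_wds hq m)
    convert wd_mem_offIdeal_sup hq hl.1 using 4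
    · refine (length_filter_le (by simpa using fun i j h => (hl.1 _ h).1) fun i hi => ?_).symm
      exact hl.2 i (by simp at hi ⊢; omega)
    · refine (length_filter_gt (by simpa using fun i j h => (hl.1 _ h).2.1) fun i hi => ?_).symm
      exact hl.2 i (by simp at hi ⊢; omega)
  have h1 : (1 : P.A) ∈ P.Bmod r := mem_Bmod.2 fun x _ => hitL_oneA _ _
  have := mem_iSup_inf_Bmod hq (W := fun b : Bool => cond b (P.offIdeal r)
    (P.ltrs (Blk₁ N r) ^ (r * m) * P.ltrs (Blk₂ N r) ^ ((N - r) * m)))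
    (by rintro (_ | _); exacts [stabL_diag _ _, stabL_offIdeal]) h1
    (by rw [iSup_bool_eq]; exact h)
  rw [iSup_bool_eq] at this
  obtain ⟨o, ho, y, hy, e⟩ := Submodule.mem_sup.1 this
  exact ⟨y, hy.1, hy.2, by rw [← e, add_sub_cancel_right]; exact ho.1⟩

lemma sub_mem_offIdeal_of_diag (hq : Transcendental ℚ q) (hr1 : 1 ≤ r) (hr2 : r < N) {n n' : ℕ}
    {b : P.A} (hb : b ∈ P.Bmod r) (h : b ∈ P.ltrs (Blk₁ N r) ^ n * P.ltrs (Blk₂ N r) ^ n') :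
    b - ε b • 1 ∈ P.offIdeal r := by
  have hq0 := ofReal_ne_zero_of_transcendental hq
  by_cases hm : ∃ m, n = r * m ∧ n' = (N - r) * m
  · obtain ⟨m, rfl, rfl⟩ := hm
    obtain ⟨y, hy, hyB, hy1⟩ := exists_sub_mem_offIdeal (P := P) hq0 hr2.le m
    have h1 : ε y = 1 := by
      have := counit_offIdeal hy1
      rw [map_sub, Bialgebra.counit_one, sub_eq_zero] at this
      exact this.symm
    have := eq_zero_of_mem_diag hq hr1 hr2 (sub_mem hb (Submodule.smul_mem _ (ε b) hyB))
      (sub_mem h (Submodule.smul_mem _ (ε b) hy)) (by simp [h1])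
    rw [sub_eq_zero.1 this, map_smul, h1, smul_eq_mul, mul_one, ← smul_sub]
    exact Submodule.smul_mem _ _ (by rw [← neg_sub]; exact neg_mem hy1)
  · have : b = 0 := by
      rw [ltrs_pow_eq, ltrs_pow_eq] at h
      have h := wds_mul_wds (S'' := fun l => ∃ l₁ l₂, l = l₁ ++ l₂ ∧
        ((∀ p ∈ l₁, Blk₁ N r p) ∧ l₁.length = n) ∧ (∀ p ∈ l₂, Blk₂ N r p) ∧ l₂.length = n')
        (fun l l' h h' => ⟨l, l', rfl, h, h'⟩) h
      have h := mem_wds_of_fixed hq (Finset.Ico 1 N) (by simp) (by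
        rintro _ ⟨l₁, l₂, rfl, h1, h2⟩ p hp
        rcases List.mem_append.1 hp with hp | hp
        exacts [(h1.1 p hp).1, (h2.1 p hp).1]) h fun c hc => by
          rw [Finset.mem_Ico] at hc
          rw [hitL_of_mem_Bmod hb (D.Kg_mem_Ksub hc.1 hc.2), UqslData.counit_Kg' hc.1 hc.2, one_smul]
      refine (Submodule.mem_bot ℂ).1 ((wds_le.2 ?_ : P.wds _ ≤ ⊥) h)
      rintro _ ⟨⟨l₁, l₂, rfl, h1, h2⟩, h3⟩
      have hb : ∀ i, 1 ≤ i → i ≤ N → cnt i (l₁ ++ l₂) = cnt 1 (l₁ ++ l₂) := fun i hi hi' =>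
        cnt_eq_of_balanced (b := N) (fun c hc hc' => h3 c (Finset.mem_Ico.2 ⟨hc, hc'⟩)) hi hi'
      have happ : ∀ i, cnt i (l₁ ++ l₂) = cnt i l₁ + cnt i l₂ := fun i => by simp [cnt]
      refine absurd ⟨cnt 1 (l₁ ++ l₂), ?_, ?_⟩ hm
      · rw [← h1.2, ← sum_cnt (s := Finset.Icc 1 r) fun p hp => Finset.mem_Icc.2
          ⟨(h1.1 p hp).1.1, (h1.1 p hp).2.1⟩, Finset.sum_congr rfl (g := fun _ => cnt 1 (l₁ ++ l₂)) ?_]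
        rotate_left
        · intro i hi
          rw [Finset.mem_Icc] at hi
          rw [← hb i hi.1 (by omega), happ, cnt_eq_zero (l := l₂) fun p hp => by
            have := (h2.1 p hp).2.1; omega, add_zero]
        simp
      · rw [← h2.2, ← sum_cnt (s := Finset.Icc (r + 1) N) fun p hp => Finset.mem_Icc.2
          ⟨(h2.1 p hp).2.1, (h2.1 p hp).1.2.1⟩, Finset.sum_congr rfl (g := fun _ => cnt 1 (l₁ ++ l₂)) ?_]
        rotate_left
        · intro i hi
          rw [Finset.mem_Icc] at hi
          rw [← hb i (by omega) hi.2, happ, cnt_eq_zero (l := l₁) fun p hp => by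
            have := (h1.1 p hp).2.1; omega, zero_add]
        simp
    simp [this]

lemma sub_mem_offIdeal (hq : Transcendental ℚ q) (hr1 : 1 ≤ r) (hr2 : r < N) {b : P.A}
    (hb : b ∈ P.Bmod r) : b - ε b • 1 ∈ P.offIdeal r := by
  have hq0 := ofReal_ne_zero_of_transcendental hq
  let W : Option (ℕ × ℕ) → Submodule ℂ P.A := fun o => o.elim (P.offIdeal r)
    fun n => P.ltrs (Blk₁ N r) ^ n.1 * P.ltrs (Blk₂ N r) ^ n.2
  have htop : b ∈ ⨆ o, W o := by
    refine (wds_le.2 fun l hl => ?_ : P.wds _ ≤ _) (P.wds_top ▸ Submodule.mem_top : b ∈ P.wds _)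
    exact (sup_le (le_iSup W none) (le_iSup W (some (_, _)))) (wd_mem_offIdeal_sup hq0 hl)
  have h := mem_iSup_inf_Bmod (r := r) hq0
    (by rintro (_ | n); exacts [stabL_offIdeal, stabL_diag _ _]) hb htop
  refine (iSup_le ?_ : _ ≤ (P.offIdeal r).comap
    (LinearMap.id - (ε : P.A →ₗ[ℂ] ℂ).smulRight (1 : P.A))) h
  rintro (_ | n) x ⟨hx, hxB⟩
  · have : x ∈ P.offIdeal r := hx
    simp [counit_offIdeal this, this]
  · exact sub_mem_offIdeal_of_diag hq hr1 hr2 hxB hx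

variable (P) in
/-- The augmentation ideal of the quantum Grassmannian. -/
def Bplus (r : ℕ) : Submodule ℂ P.A := P.Bmod r ⊓ LinearMap.ker (ε : P.A →ₗ[ℂ] ℂ)

lemma top_mul_Bplus (hq : Transcendental ℚ q) (hr1 : 1 ≤ r) (hr2 : r < N) :
    ⊤ * P.Bplus r = P.offIdeal r := by
  refine le_antisymm (Submodule.mul_le.2 fun a _ b hb => mul_mem_offIdeal a ?_) fun v hv => ?_
  · have := sub_mem_offIdeal hq hr1 hr2 hb.1
    rwa [LinearMap.mem_ker.1 hb.2, zero_smul, sub_zero] at this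
  · have := mem_span_smul_Bmod (ofReal_ne_zero_of_transcendental hq) (ι := Unit)
      (W := (P.offIdeal r).comap (LinearMap.proj ())) (v := fun _ => v)
      (fun a w hw => mul_mem_offIdeal a hw) (fun x hx w hw => stabL_offIdeal hx _ hw) hv
    suffices H : ∀ w ∈ Submodule.span P.A {w : Unit → P.A |
        w ∈ (P.offIdeal r).comap (LinearMap.proj ()) ∧ ∀ s, w s ∈ P.Bmod r},
        w () ∈ ⊤ * P.Bplus r from H _ this
    intro w hw
    induction hw using Submodule.span_induction with
    | mem w hw =>
      rw [← one_mul (w ())]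
      exact Submodule.mul_mem_mul trivial ⟨hw.2 (), counit_offIdeal hw.1⟩
    | zero => exact zero_mem _
    | add _ _ _ _ h h' => exact add_mem h h'
    | smul a w _ h =>
      have := Submodule.mul_mem_mul (M := ⊤) (Submodule.mem_top (x := a)) h
      rw [← mul_assoc] at this
      exact (mul_le_mul' le_top le_rfl : _ ≤ ⊤ * P.Bplus r) this

end QslnFun

namespace QslnFun

variable {q : ℝ} {N : ℕ} {D : UqslData q N} {P : QslnFun q N D} {r : ℕ}

lemma one_mem_Bmod : (1 : P.A) ∈ P.Bmod r := mem_Bmod.2 fun _ _ => hitL_oneA _ _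

lemma fixed_of_mem_Bmod {b : P.A} (hb : b ∈ P.Bmod r) :
    (∀ c, 1 ≤ c → c < N → c ≠ r → P.hitL (D.E c) b = 0 ∧ P.hitL (D.F c) b = 0) ∧
      ∀ c, 1 ≤ c → c < N → P.hitL (D.Kg c) b = b ∧ P.hitL (D.Ki c) b = b := by
  refine ⟨fun c h1 h2 hc => ⟨?_, ?_⟩, fun c h1 h2 => ⟨?_, ?_⟩⟩
  · rw [hitL_of_mem_Bmod hb (D.E_mem_Ksub h1 h2 hc), UqslData.counit_E' h1 h2, zero_smul]
  · rw [hitL_of_mem_Bmod hb (D.F_mem_Ksub h1 h2 hc), UqslData.counit_F' h1 h2, zero_smul]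
  · rw [hitL_of_mem_Bmod hb (D.Kg_mem_Ksub h1 h2), UqslData.counit_Kg' h1 h2, one_smul]
  · rw [hitL_of_mem_Bmod hb (D.Ki_mem_Ksub h1 h2), UqslData.counit_Ki' h1 h2, one_smul]

lemma hitL_mul_of_mem_Bmod {b : P.A} (hb : b ∈ P.Bmod r) {x : D.U} (hx : x ∈ D.Ksub r) (a : P.A) :
    P.hitL x (a * b) = P.hitL x a * b := by
  obtain ⟨hEF, hK⟩ := fixed_of_mem_Bmod hb
  let S : Subalgebra ℂ D.U :=
    { carrier := {x | ∀ a, P.hitL x (a * b) = P.hitL x a * b}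
      mul_mem' := fun {x y} hx hy a => by rw [hitL_mul, hx, hy, hitL_mul]
      add_mem' := fun {x y} hx hy a => by rw [hitL_add, hx, hy, hitL_add, add_mul]
      algebraMap_mem' := fun c a => by
        simp [Algebra.algebraMap_eq_smul_one, hitL_smul] }
  refine (UqslData.Ksub_le (S := S) ?_ ?_ ?_ ?_ : D.Ksub r ≤ S) hx a
  · intro c h1 h2 hc a
    rw [P.hitL_E_mul h1 h2, (hEF c h1 h2 hc).1, mul_zero, add_zero]
  · intro c h1 h2 hc a
    rw [P.hitL_F_mul h1 h2, (hEF c h1 h2 hc).2, (hK c h1 h2).2, mul_zero, add_zero]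
  · intro c h1 h2 a
    rw [P.hitL_Kg_mul h1 h2, (hK c h1 h2).1]
  · intro c h1 h2 a
    rw [P.hitL_Ki_mul h1 h2, (hK c h1 h2).2]

lemma mul_mem_Bmod {a b : P.A} (ha : a ∈ P.Bmod r) (hb : b ∈ P.Bmod r) : a * b ∈ P.Bmod r :=
  mem_Bmod.2 fun x hx => by
    rw [mem_fixL, hitL_mul_of_mem_Bmod hb hx, hitL_of_mem_Bmod ha hx, smul_mul_assoc]

lemma Bmod_mul_Bplus : P.Bmod r * P.Bplus r ≤ P.Bplus r :=
  Submodule.mul_le.2 fun a ha b hb => ⟨mul_mem_Bmod ha hb.1, by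
    change ε (a * b) = 0
    rw [Bialgebra.counit_mul, LinearMap.mem_ker.1 hb.2, mul_zero]⟩

lemma Bplus_pow_le_Bmod (l : ℕ) : P.Bplus r ^ l ≤ P.Bmod r := by
  induction l with
  | zero => rw [pow_zero, Submodule.one_le]; exact one_mem_Bmod
  | succ l ih =>
    rw [pow_succ]
    exact Submodule.mul_le.2 fun a ha b hb => mul_mem_Bmod (ih ha) hb.1

lemma sub_mem_Bplus {b : P.A} (hb : b ∈ P.Bmod r) : b - ε b • 1 ∈ P.Bplus r :=
  ⟨sub_mem hb (Submodule.smul_mem _ _ one_mem_Bmod), by simp⟩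

lemma pow_mul_top_le {R : Type*} [Ring R] [Algebra ℂ R] {V : Submodule ℂ R} (h : V * ⊤ ≤ ⊤ * V)
    (l : ℕ) : V ^ l * ⊤ ≤ ⊤ * V ^ l := by
  induction l with
  | zero => simp
  | succ l ih =>
    calc V ^ (l + 1) * ⊤ = V ^ l * (V * ⊤) := by rw [pow_succ, mul_assoc]
      _ ≤ V ^ l * (⊤ * V) := mul_le_mul' le_rfl h
      _ = V ^ l * ⊤ * V := (mul_assoc _ _ _).symm
      _ ≤ ⊤ * V ^ l * V := mul_le_mul' ih le_rfl
      _ = _ := by rw [mul_assoc, pow_succ]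

lemma top_mul_pow_le {R : Type*} [Ring R] [Algebra ℂ R] {V V' : Submodule ℂ R}
    (h : V ≤ ⊤ * V') (h' : V' * ⊤ ≤ ⊤ * V') (l : ℕ) : ⊤ * V ^ l ≤ ⊤ * V' ^ l := by
  induction l with
  | zero => simp
  | succ l ih =>
    calc ⊤ * V ^ (l + 1) = ⊤ * V ^ l * V := by rw [pow_succ, mul_assoc]
      _ ≤ ⊤ * V' ^ l * (⊤ * V') := mul_le_mul' ih h
      _ = ⊤ * (V' ^ l * ⊤) * V' := by simp only [mul_assoc]
      _ ≤ ⊤ * (⊤ * V' ^ l) * V' := mul_le_mul' (mul_le_mul' le_rfl (pow_mul_top_le h' l)) le_rfl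
      _ = (⊤ * ⊤) * V' ^ (l + 1) := by simp only [mul_assoc, pow_succ]
      _ ≤ _ := mul_le_mul' le_top le_rfl

lemma le_top_mul (V : Submodule ℂ P.A) : V ≤ ⊤ * V := by
  conv_lhs => rw [← one_mul V]
  exact mul_le_mul' le_top le_rfl

lemma mul_mem_top_mul {R : Type*} [Ring R] [Algebra ℂ R] {V : Submodule ℂ R} (a : R) {b : R}
    (h : b ∈ ⊤ * V) : a * b ∈ ⊤ * V := by
  have h1 : (⊤ : Submodule ℂ R) * (⊤ * V) ≤ ⊤ * V := by
    rw [← mul_assoc]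
    exact mul_le_mul' le_top le_rfl
  exact h1 (Submodule.mul_mem_mul Submodule.mem_top h)

lemma exists_sum_of_mem_mul {R : Type*} [Ring R] [Algebra ℂ R] {V W : Submodule ℂ R} {x : R}
    (h : x ∈ V * W) : ∃ (ι : Type) (_ : Fintype ι) (v w : ι → R), (∀ s, v s ∈ V) ∧ (∀ s, w s ∈ W) ∧
      x = ∑ s, v s * w s := by
  refine Submodule.mul_induction_on h (fun v hv w hw => ?_) ?_
  · exact ⟨Unit, inferInstance, fun _ => v, fun _ => w, fun _ => hv, fun _ => hw, by simp⟩
  · rintro _ _ ⟨ι, _, v, w, hv, hw, rfl⟩ ⟨ι', _, v', w', hv', hw', rfl⟩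
    refine ⟨ι ⊕ ι', inferInstance, Sum.elim v v', Sum.elim w w', ?_, ?_, by simp⟩
    · rintro (s | s); exacts [hv s, hv' s]
    · rintro (s | s); exacts [hw s, hw' s]

section

variable (hq : Transcendental ℚ q) (hr1 : 1 ≤ r) (hr2 : r < N)
include hq hr1 hr2

lemma top_mul_Bplus_pow (l : ℕ) : ⊤ * P.Bplus r ^ l = ⊤ * P.ltrs (Off N r) ^ l := by
  have hq0 := ofReal_ne_zero_of_transcendental hq
  have h := top_mul_Bplus (P := P) hq hr1 hr2
  refine le_antisymm (top_mul_pow_le ?_ ?_ l) (top_mul_pow_le ?_ ?_ l)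
  · exact (le_top_mul _).trans h.le
  · exact off_mul_top hq0
  · exact (le_top_mul _).trans h.ge
  · rw [h]
    refine Submodule.mul_le.2 fun b hb a _ => offIdeal_mul_mem hq0 ?_ a
    exact h.le (le_top_mul _ hb)

lemma mem_Bplus_pow {l : ℕ} {b : P.A} (hb : b ∈ P.Bmod r) (h : b ∈ ⊤ * P.Bplus r ^ (l + 1)) :
    b ∈ P.Bplus r ^ (l + 1) := by
  have hq0 := ofReal_ne_zero_of_transcendental hq
  have hle : ⊤ * P.Bplus r ^ (l + 1) ≤ P.Bplus r ^ (l + 1) ⊔ P.Kplus r ⊤ := by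
    have h1 : (⊤ : Submodule ℂ P.A) ≤ P.Bmod r ⊔ P.Kplus r ⊤ := by
      simpa using le_Bmod_sup_Kplus hq0 (P := P) (r := r) stabL_top
    refine (mul_le_mul' h1 le_rfl).trans ?_
    rw [Submodule.sup_mul]
    refine sup_le_sup ?_ (Submodule.mul_le.2 fun a ha b hb => ?_)
    · rw [pow_succ', ← mul_assoc]
      exact mul_le_mul' Bmod_mul_Bplus le_rfl
    · induction ha using Submodule.span_induction with
      | zero => simp
      | add a a' _ _ h h' => rw [add_mul]; exact add_mem h h'
      | smul t a _ h => rw [smul_mul_assoc]; exact Submodule.smul_mem _ t h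
      | mem a ha =>
        obtain ⟨k, hk, a, -, rfl⟩ := ha
        rw [sub_mul, ← hitL_mul_of_mem_Bmod (Bplus_pow_le_Bmod _ hb) hk, smul_mul_assoc]
        exact Submodule.subset_span ⟨k, hk, _, trivial, rfl⟩
  obtain ⟨y, hy, z, hz, rfl⟩ := Submodule.mem_sup.1 (hle h)
  have hy' := Bplus_pow_le_Bmod _ hy
  rwa [eq_zero_of_mem_Bmod_of_mem_Kplus hq0 ((Submodule.add_mem_iff_right _ hy').1 hb) hz, add_zero]

lemma stabL_top_mul_Bplus_pow (l : ℕ) : D.Ksub r ≤ P.stabL (⊤ * P.Bplus r ^ l) := by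
  rw [top_mul_Bplus_pow hq hr1 hr2]
  exact stabL_mul stabL_top (stabL_pow stabL_off l)

lemma sum_counit_smul_mem {ι : Type*} [Fintype ι] {l : ℕ} {b : ι → P.A}
    (hb : ∀ s, b s ∈ P.Bplus r ^ l) {v : ι → P.A} (hv : ∑ s, v s * b s ∈ ⊤ * P.Bplus r ^ (l + 1)) :
    ∑ s, ε (v s) • b s ∈ P.Bplus r ^ (l + 1) := by
  let W : Submodule ℂ (ι → P.A) := (⊤ * P.Bplus r ^ (l + 1)).comap
    (∑ s, (LinearMap.mulRight ℂ (b s)) ∘ₗ LinearMap.proj s)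
  have hW : ∀ v, v ∈ W ↔ ∑ s, v s * b s ∈ ⊤ * P.Bplus r ^ (l + 1) := fun v => by simp [W]
  have := mem_span_smul_Bmod (r := r) (ofReal_ne_zero_of_transcendental hq) (W := W) (v := v)
    (fun a w hw => ?_) (fun x hx w hw => ?_) ((hW v).2 hv)
  · clear hv
    induction this using Submodule.span_induction with
    | zero => simp
    | add v w _ _ h h' =>
      simp only [Pi.add_apply, map_add, add_smul, Finset.sum_add_distrib]
      exact add_mem h h'
    | smul a w _ h =>
      simp only [Pi.smul_apply, smul_eq_mul, Bialgebra.counit_mul, mul_smul, ← Finset.smul_sum]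
      exact Submodule.smul_mem _ _ h
    | mem w hw =>
      have h1 := mem_Bplus_pow hq hr1 hr2
        (Submodule.sum_mem _ fun s _ => mul_mem_Bmod (hw.2 s) (Bplus_pow_le_Bmod l (hb s)))
        ((hW w).1 hw.1)
      have h2 : ∑ s, (w s - ε (w s) • 1) * b s ∈ P.Bplus r ^ (l + 1) := by
        rw [pow_succ']
        exact Submodule.sum_mem _ fun s _ => Submodule.mul_mem_mul (sub_mem_Bplus (hw.2 s)) (hb s)
      convert sub_mem h1 h2 using 1
      rw [← Finset.sum_sub_distrib]
      exact Finset.sum_congr rfl fun s _ => by rw [sub_mul, smul_mul_assoc, one_mul]; abel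
  · rw [hW] at hw ⊢
    simp only [Pi.smul_apply, smul_eq_mul, mul_assoc, ← Finset.mul_sum]
    exact mul_mem_top_mul a hw
  · rw [hW] at hw ⊢
    have h1 : ∑ s, P.hitL x (w s) * b s = P.hitL x (∑ s, w s * b s) := by
      rw [map_sum]
      exact Finset.sum_congr rfl fun s _ =>
        (hitL_mul_of_mem_Bmod (Bplus_pow_le_Bmod l (hb s)) hx (w s)).symm
    rw [h1]
    exact (mem_stabL P).1 (stabL_top_mul_Bplus_pow hq hr1 hr2 (l + 1) hx) _ hw

lemma mem_Bplus_pow_succ {l : ℕ} {b : P.A} (hb : b ∈ P.Bplus r ^ l)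
    (h : b ∈ LinearMap.ker (ε : P.A →ₗ[ℂ] ℂ) * P.Bplus r ^ l ⊔ ⊤ * P.Bplus r ^ (l + 1)) :
    b ∈ P.Bplus r ^ (l + 1) := by
  obtain ⟨y, hy, z, hz, rfl⟩ := Submodule.mem_sup.1 h
  obtain ⟨ι, _, v, w, hv, hw, rfl⟩ := exists_sum_of_mem_mul hy
  have := sum_counit_smul_mem hq hr1 hr2 (ι := Option ι) (l := l)
    (b := fun o => o.elim (∑ s, v s * w s + z) w) (v := fun o => o.elim 1 fun s => - v s)
    (by rintro (_ | s); exacts [hb, hw s]) (by simpa using hz)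
  have hv' : ∀ s, ε (v s) = 0 := hv
  simpa [hv'] using this

end

end QslnFun

namespace QslnFun

variable {q : ℝ} {N : ℕ} {D : UqslData q N} {P : QslnFun q N D} {r : ℕ}

/-- A statistic on words which decreases under the correction terms of the quadratic relations. -/
def stat (l : List (ℕ × ℕ)) : ℕ := (l.map fun p => p.1 * p.2).sum

/-- Off-diagonal words of the same length and smaller statistic. -/
def Less (N r : ℕ) (l v : List (ℕ × ℕ)) : Prop :=
  (∀ p ∈ v, Off N r p) ∧ v.length = l.length ∧ stat v < stat l

lemma Off.exchange {i j k l : ℕ} (h : Off N r (i, j)) (h' : Off N r (k, l)) (hik : i < k)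
    (hjl : j < l) : Off N r (k, j) ∧ Off N r (i, l) := by
  simp only [Off, Ltr] at *
  omega

lemma Less.exchange {i j k l : ℕ} (h : Off N r (i, j)) (h' : Off N r (k, l)) (hik : i < k)
    (hjl : j < l) : Less N r [(i, j), (k, l)] [(k, j), (i, l)] := by
  refine ⟨?_, rfl, ?_⟩
  · simpa using h.exchange h' hik hjl
  · obtain ⟨a, rfl⟩ := Nat.exists_eq_add_of_lt hik
    obtain ⟨b, rfl⟩ := Nat.exists_eq_add_of_lt hjl
    simp only [stat, List.map_cons, List.map_nil, List.sum_cons, List.sum_nil]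
    nlinarith [Nat.zero_le (a * b)]

lemma Less.swap {p p' : ℕ × ℕ} {v : List (ℕ × ℕ)} (h : Less N r [p, p'] v) : Less N r [p', p] v :=
  ⟨h.1, h.2.1, by have := h.2.2; simp only [stat, List.map_cons, List.sum_cons] at *; omega⟩

lemma wd_pair_sub (hq : (q : ℂ) ≠ 0) {p p' : ℕ × ℕ} (h : Off N r p) (h' : Off N r p') :
    ∃ c : ℂ, P.wd [p, p'] - c • P.wd [p', p] ∈ P.wds (Less N r [p, p']) := by
  obtain ⟨i, j⟩ := p
  obtain ⟨k, l⟩ := p'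
  obtain ⟨a1, a2, a3, a4⟩ := h.1
  obtain ⟨b1, b2, b3, b4⟩ := h'.1
  dsimp only at a1 a2 a3 a4 b1 b2 b3 b4
  have key : ∀ c : ℂ, P.u i j * P.u k l = c • (P.u k l * P.u i j) →
      ∃ c : ℂ, P.wd [(i, j), (k, l)] - c • P.wd [(k, l), (i, j)] ∈
        P.wds (Less N r [(i, j), (k, l)]) := fun c hc =>
    ⟨c, by simpa [sub_eq_zero.2 hc] using zero_mem _⟩
  rcases lt_trichotomy i k with hik | rfl | hik <;> rcases lt_trichotomy j l with hjl | rfl | hjl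
  · refine ⟨1, ?_⟩
    have := Submodule.smul_mem _ ((q : ℂ) - (q : ℂ)⁻¹)
      (wd_mem_wds (P := P) (Less.exchange h h' hik hjl))
    simpa [P.u_diag hq a1 a3 hik b2 hjl b4] using this
  · exact key _ (P.u_col hq a1 a3 a4 hik b2)
  · exact key 1 (by rw [one_smul]; exact P.u_anti hq a1 b3 hik b2 hjl a4)
  · exact key _ (P.u_row hq a1 a3 a2 hjl b4)
  · exact key 1 (by rw [one_smul])
  · exact key (q : ℂ)⁻¹ (by rw [P.u_row hq a1 b3 a2 hjl a4, inv_smul_smul₀ hq])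
  · exact key 1 (by rw [one_smul]; exact (P.u_anti hq b1 a3 hik a2 hjl b4).symm)
  · exact key (q : ℂ)⁻¹ (by rw [P.u_col hq b1 a3 a4 hik a2, inv_smul_smul₀ hq])
  · refine ⟨1, ?_⟩
    have := Submodule.smul_mem _ (-((q : ℂ) - (q : ℂ)⁻¹))
      (wd_mem_wds (P := P) (Less.exchange h' h hik hjl).swap)
    rw [neg_smul] at this
    simpa [P.u_diag hq b1 b3 hik a2 hjl a4] using this

lemma stat_perm {l l' : List (ℕ × ℕ)} (h : l.Perm l') : stat l = stat l' :=
  (h.map _).sum_eq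

lemma stat_append (l l' : List (ℕ × ℕ)) : stat (l ++ l') = stat l + stat l' := by
  simp [stat]

lemma wd_perm_sub (hq : (q : ℂ) ≠ 0) {l l' : List (ℕ × ℕ)} (h : l.Perm l')
    (hl : ∀ p ∈ l, Off N r p) : ∃ c : ℂ, P.wd l - c • P.wd l' ∈ P.wds (Less N r l) := by
  induction h with
  | nil => exact ⟨1, by simp⟩
  | @cons p l l' _ ih =>
    obtain ⟨c, hc⟩ := ih fun p hp => hl p (by simp [hp])
    refine ⟨c, ?_⟩
    have h1 : P.wd [p] ∈ P.wds (fun v => v = [p]) := wd_mem_wds rfl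
    have h2 := (wds_mul_wds (P := P) (S'' := Less N r (p :: l)) ?_)
      (Submodule.mul_mem_mul h1 hc)
    · simpa [mul_sub] using h2
    · rintro _ v rfl hv
      refine ⟨?_, by simp [hv.2.1], ?_⟩
      · exact List.forall_mem_cons.2 ⟨hl p (by simp), hv.1⟩
      · have := hv.2.2
        simp only [stat, List.cons_append, List.nil_append, List.map_cons, List.sum_cons] at *
        omega
  | swap p p' l =>
    obtain ⟨c, hc⟩ := wd_pair_sub (P := P) hq (hl p' (by simp)) (hl p (by simp))
    refine ⟨c, ?_⟩
    have h1 : P.wd l ∈ P.wds (fun v => v = l) := wd_mem_wds rfl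
    have h2 := (wds_mul_wds (P := P) (S'' := Less N r (p' :: p :: l)) ?_)
      (Submodule.mul_mem_mul hc h1)
    · simpa [sub_mul, mul_assoc] using h2
    · rintro v _ hv rfl
      refine ⟨fun x hx => ?_, by simp [hv.2.1]; omega, ?_⟩
      · rcases List.mem_append.1 hx with h | h
        exacts [hv.1 x h, hl x (by simp [h])]
      · have := hv.2.2
        simp only [stat, List.map_append, List.sum_append, List.map_cons, List.sum_cons,
          List.map_nil, List.sum_nil] at *
        omega
  | @trans l l' l'' h1 h2 ih1 ih2 =>
    obtain ⟨c, hc⟩ := ih1 hl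
    obtain ⟨c', hc'⟩ := ih2 fun p hp => hl p (h1.mem_iff.2 hp)
    refine ⟨c * c', ?_⟩
    have h3 : P.wd l' - c' • P.wd l'' ∈ P.wds (Less N r l) :=
      wds_mono (fun v hv => ⟨hv.1, hv.2.1.trans h1.length_eq.symm, stat_perm h1 ▸ hv.2.2⟩) hc'
    have := add_mem hc (Submodule.smul_mem _ c h3)
    rwa [smul_sub, smul_smul, sub_add_sub_cancel] at this

variable (N r) in
/-- The roots in `Φ⁺_r`. -/
abbrev Rt : Type := ↥(Finset.Icc 1 r ×ˢ Finset.Icc r (N - 1))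

lemma Rt.le (p : Rt N r) : 1 ≤ p.1.1 ∧ p.1.1 ≤ r ∧ r ≤ p.1.2 ∧ p.1.2 ≤ N - 1 := by
  have := p.2
  simp only [Finset.mem_product, Finset.mem_Icc] at this
  omega

/-- The off-diagonal letter attached to a positive or negative root. -/
def ofRt : Rt N r ⊕ Rt N r → ℕ × ℕ
  | .inl p => (p.1.1, p.1.2 + 1)
  | .inr p => (p.1.2 + 1, p.1.1)

lemma exists_ofRt {p : ℕ × ℕ} (h : Off N r p) : ∃ x : Rt N r ⊕ Rt N r, ofRt x = p := by
  obtain ⟨i, j⟩ := p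
  simp only [Off, Ltr] at h
  by_cases hi : i ≤ r
  · refine ⟨.inl ⟨(i, j - 1), ?_⟩, ?_⟩
    · simp only [Finset.mem_product, Finset.mem_Icc]; omega
    · simp only [ofRt, Prod.mk.injEq, true_and]; omega
  · refine ⟨.inr ⟨(j, i - 1), ?_⟩, ?_⟩
    · simp only [Finset.mem_product, Finset.mem_Icc]; omega
    · simp only [ofRt, Prod.mk.injEq, and_true]; omega

lemma card_sym_Rt (hr : r < N) (l : ℕ) :
    Fintype.card (Sym (Rt N r ⊕ Rt N r) l) = Nat.choose (2 * r * (N - r) + l - 1) l := by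
  rw [Sym.card_sym_eq_choose]
  congr 3
  simp only [Fintype.card_sum, Fintype.card_coe, Finset.card_product, Nat.card_Icc]
  rw [show N - 1 + 1 - r = N - r by omega, show r + 1 - 1 = r by omega]
  ring

variable (P) in
/-- The ordered monomial in the off-diagonal letters attached to a multiset. -/
def offWd {l : ℕ} (s : Sym (Rt N r ⊕ Rt N r) l) : P.A := P.wd (s.1.toList.map ofRt)

lemma ltrs_off_pow_le (hq : (q : ℂ) ≠ 0) (l : ℕ) :
    P.ltrs (Off N r) ^ l ≤ Submodule.span ℂ (Set.range (P.offWd (r := r) (l := l))) := by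
  rw [ltrs_pow_eq]
  refine wds_le.2 fun v hv => ?_
  induction hn : stat v using Nat.strong_induction_on generalizing v with
  | _ n ih =>
    subst hn
    obtain ⟨hv1, hv2⟩ := hv
    obtain ⟨w, rfl⟩ : ∃ w : List (Rt N r ⊕ Rt N r), w.map ofRt = v := by
      have : v ∈ Set.range (List.map (ofRt (N := N) (r := r))) := by
        rw [Set.range_list_map]; exact fun p hp => exists_ofRt (hv1 p hp)
      exact this
    have hw : w.length = l := by simpa using hv2
    have hp : w.Perm (w : Multiset (Rt N r ⊕ Rt N r)).toList :=
      (Multiset.coe_eq_coe.1 (Multiset.coe_toList _)).symm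
    obtain ⟨c, hc⟩ := wd_perm_sub (P := P) hq (hp.map ofRt) hv1
    rw [← sub_add_cancel (P.wd _) (c • P.wd _)]
    refine add_mem (wds_le.2 (fun v hv => ih _ hv.2.2 v ⟨hv.1, hv.2.1.trans hv2⟩ rfl) hc)
      (Submodule.smul_mem _ _ (Submodule.subset_span ⟨⟨w, by simpa using hw⟩, rfl⟩))

lemma exists_spanning {V : Type*} [AddCommGroup V] [Module ℂ V] {X Y Z : Submodule ℂ V} {ι : Type*}
    (v : ι → V) (hX : X ≤ Submodule.span ℂ (Set.range v) ⊔ Z) (hXZ : X ⊓ Z ≤ Y) :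
    ∃ s : ι → V, (∀ i, s i ∈ X) ∧ X ≤ Submodule.span ℂ (Set.range s) ⊔ Y := by
  obtain ⟨π, hπ⟩ := (X.map Z.mkQ).subtype.exists_leftInverse_of_injective (by simp)
  have h1 : ∀ i, ∃ s ∈ X, Z.mkQ s = π (Z.mkQ (v i)) := fun i => (π (Z.mkQ (v i))).2
  choose s hs hs' using h1
  refine ⟨s, hs, fun x hx => ?_⟩
  have h2 : ∀ y ∈ Submodule.span ℂ (Set.range v) ⊔ Z, ∃ t ∈ Submodule.span ℂ (Set.range s),
      Z.mkQ t = π (Z.mkQ y) := by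
    intro _ hy'
    obtain ⟨y, hy, z, hz, rfl⟩ := Submodule.mem_sup.1 hy'
    clear hy'
    have hz' : Z.mkQ z = 0 := by simpa using hz
    rw [map_add, hz', add_zero]
    induction hy using Submodule.span_induction with
    | mem _ h => obtain ⟨i, rfl⟩ := h; exact ⟨s i, Submodule.subset_span ⟨i, rfl⟩, hs' i⟩
    | zero => exact ⟨0, zero_mem _, by simp⟩
    | add a b _ _ ha hb =>
      obtain ⟨t, ht, h⟩ := ha
      obtain ⟨t', ht', h'⟩ := hb
      exact ⟨t + t', add_mem ht ht', by rw [map_add, map_add, map_add, h, h']; rfl⟩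
    | smul c a _ ha =>
      obtain ⟨t, ht, h⟩ := ha
      exact ⟨c • t, Submodule.smul_mem _ _ ht, by rw [map_smul, map_smul, map_smul, h]; rfl⟩
  obtain ⟨t, ht, h⟩ := h2 x (hX hx)
  have h3 : π (Z.mkQ x) = (⟨Z.mkQ x, x, hx, rfl⟩ : X.map Z.mkQ) :=
    LinearMap.congr_fun hπ ⟨Z.mkQ x, x, hx, rfl⟩
  rw [h3] at h
  have htX : t ∈ X := (Submodule.span_le.2 (by rintro _ ⟨i, rfl⟩; exact hs i)) ht
  refine Submodule.mem_sup.2 ⟨t, ht, x - t, hXZ ⟨sub_mem hx htX, ?_⟩, by abel⟩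
  change x - t ∈ Z
  rw [← Submodule.Quotient.mk_eq_zero, ← Submodule.mkQ_apply, map_sub, h, sub_self]

section

variable (hq : Transcendental ℚ q) (hr1 : 1 ≤ r) (hr2 : r < N)
include hq hr1 hr2

lemma exists_spanning_Bplus_pow (l : ℕ) : ∃ s : Sym (Rt N r ⊕ Rt N r) l → P.A,
    (∀ m, s m ∈ P.Bplus r ^ l) ∧
      P.Bplus r ^ l ≤ Submodule.span ℂ (Set.range s) ⊔ P.Bplus r ^ (l + 1) := by
  refine exists_spanning
    (Z := LinearMap.ker (ε : P.A →ₗ[ℂ] ℂ) * P.Bplus r ^ l ⊔ ⊤ * P.Bplus r ^ (l + 1)) P.offWd ?_ ?_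
  · have h1 : (⊤ : Submodule ℂ P.A) ≤ 1 ⊔ LinearMap.ker (ε : P.A →ₗ[ℂ] ℂ) := fun a _ =>
      Submodule.mem_sup.2 ⟨ε a • 1, Submodule.smul_mem _ _ (Submodule.one_le.1 le_rfl), a - ε a • 1,
        by simp, by abel⟩
    refine (le_top_mul _).trans ?_
    rw [top_mul_Bplus_pow hq hr1 hr2]
    refine (mul_le_mul' h1 le_rfl).trans ?_
    rw [Submodule.sup_mul, one_mul]
    refine sup_le_sup (ltrs_off_pow_le (ofReal_ne_zero_of_transcendental hq) l)
      (le_sup_of_le_left ?_)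
    refine (mul_le_mul' le_rfl ((le_top_mul _).trans (top_mul_Bplus_pow hq hr1 hr2 l).ge)).trans ?_
    rw [← mul_assoc]
    refine mul_le_mul' (Submodule.mul_le.2 fun a ha b _ => ?_) le_rfl
    change ε (a * b) = 0
    rw [Bialgebra.counit_mul, LinearMap.mem_ker.1 ha, zero_mul]
  · exact fun b hb => mem_Bplus_pow_succ hq hr1 hr2 hb.1 hb.2

lemma exists_spanning_Bmod (k : ℕ) : ∃ s : (Σ l : Fin (k + 1), Sym (Rt N r ⊕ Rt N r) l) → P.A,
    (∀ m, s m ∈ P.Bmod r) ∧ P.Bmod r ≤ Submodule.span ℂ (Set.range s) ⊔ P.Bplus r ^ (k + 1) := by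
  choose s hs hs' using fun l => exists_spanning_Bplus_pow (P := P) hq hr1 hr2 l
  refine ⟨fun m => s m.1 m.2, fun m => Bplus_pow_le_Bmod _ (hs _ _), ?_⟩
  set W := Submodule.span ℂ (Set.range fun m : Σ l : Fin (k + 1), Sym (Rt N r ⊕ Rt N r) l =>
    s m.1 m.2) with hW
  have h1 : ∀ l ≤ k, Submodule.span ℂ (Set.range (s l)) ≤ W := fun l hl =>
    Submodule.span_mono (by rintro _ ⟨m, rfl⟩; exact ⟨⟨⟨l, by omega⟩, m⟩, rfl⟩)
  have h2 : ∀ l ≤ k, P.Bmod r ≤ W ⊔ P.Bplus r ^ (l + 1) := by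
    intro l
    induction l with
    | zero =>
      intro hl b hb
      rw [← add_sub_cancel (ε b • 1) b]
      refine add_mem (Submodule.smul_mem _ _ ?_) (Submodule.mem_sup_right ?_)
      · refine ((hs' 0).trans (sup_le_sup (h1 0 hl) le_rfl)) ?_
        rw [pow_zero]
        exact Submodule.one_le.1 le_rfl
      · simpa using sub_mem_Bplus hb
    | succ l ih =>
      intro hl
      refine (ih (by omega)).trans (sup_le le_sup_left ?_)
      exact (hs' (l + 1)).trans (sup_le_sup (h1 _ hl) le_rfl)
  exact h2 k le_rfl

end

end QslnFun

namespace UqslData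

variable {q : ℝ} {N : ℕ} (D : UqslData q N)

/-- The Cartan elements `K_a K_{a+1} ⋯ K_{a+d}`. -/
def Kv : ℕ → ℕ → D.U
  | 0, a => D.Kg a
  | d + 1, a => D.Kg a * Kv d (a + 1)

/-- The Cartan elements `K_a⁻¹ K_{a+1}⁻¹ ⋯ K_{a+d}⁻¹`. -/
def Kiv : ℕ → ℕ → D.U
  | 0, a => D.Ki a
  | d + 1, a => D.Ki a * Kiv d (a + 1)

variable {D}

lemma cartanSL_far {a c : ℕ} (h : a + 1 < c ∨ c + 1 < a) : cartanSL a c = 0 := by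
  unfold cartanSL
  rw [if_neg (by omega), if_neg (by omega)]

lemma cartanSL_next {a c : ℕ} (h : a + 1 = c ∨ c + 1 = a) : cartanSL a c = -1 := by
  unfold cartanSL
  rw [if_neg (by omega), if_pos (by omega)]

lemma Ki_mul_of_Kg_mul {c : ℕ} (h1 : 1 ≤ c) (h2 : c < N) {x : D.U} {s : ℂ} (hs : s ≠ 0)
    (h : D.Kg c * x = s • (x * D.Kg c)) : D.Ki c * x = s⁻¹ • (x * D.Ki c) := by
  have h3 : D.Ki c * (D.Kg c * x) * D.Ki c = D.Ki c * (s • (x * D.Kg c)) * D.Ki c := by rw [h]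
  rw [← mul_assoc, D.Ki_mul_Kg h1 h2, one_mul, mul_smul_comm, smul_mul_assoc, mul_assoc,
    mul_assoc, D.Kg_mul_Ki h1 h2, mul_one] at h3
  rw [h3, inv_smul_smul₀ hs]

section Comm

variable {a c d : ℕ}

lemma Kg_comm (ha : 1 ≤ a) (ha' : a < N) (hc : 1 ≤ c) (hc' : c < N) :
    Commute (D.Kg a) (D.Kg c) :=
  D.rels.2.1 a (mem_Icc_pred ha ha') c (mem_Icc_pred hc hc')

lemma Ki_comm (ha : 1 ≤ a) (ha' : a < N) (hc : 1 ≤ c) (hc' : c < N) :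
    Commute (D.Ki a) (D.Ki c) := by
  have h1 : D.Kg a * D.Kg c = (1 : ℂ) • (D.Kg c * D.Kg a) := by
    rw [one_smul]; exact Kg_comm ha ha' hc hc'
  have h2 := Ki_mul_of_Kg_mul ha ha' one_ne_zero h1
  have h3 : D.Kg c * D.Ki a = (1 : ℂ) • (D.Ki a * D.Kg c) := by rw [h2]; simp
  have h4 := Ki_mul_of_Kg_mul hc hc' one_ne_zero h3
  rw [inv_one, one_smul] at h4
  exact h4.symm

lemma Kg_E_far (ha : 1 ≤ a) (ha' : a < N) (hc : 1 ≤ c) (hc' : c < N)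
    (h : a + 1 < c ∨ c + 1 < a) : Commute (D.Kg a) (D.E c) := by
  have := D.rels.2.2.1 a (mem_Icc_pred ha ha') c (mem_Icc_pred hc hc')
  rwa [cartanSL_far h, zpow_zero, one_smul] at this

lemma Kg_E_next (ha : 1 ≤ a) (ha' : a < N) (hc : 1 ≤ c) (hc' : c < N)
    (h : a + 1 = c ∨ c + 1 = a) : D.Kg a * D.E c = (q : ℂ)⁻¹ • (D.E c * D.Kg a) := by
  have := D.rels.2.2.1 a (mem_Icc_pred ha ha') c (mem_Icc_pred hc hc')
  rwa [cartanSL_next h, zpow_neg_one] at this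

lemma Ki_F_far (ha : 1 ≤ a) (ha' : a < N) (hc : 1 ≤ c) (hc' : c < N)
    (h : a + 1 < c ∨ c + 1 < a) : Commute (D.Ki a) (D.F c) := by
  have := D.rels.2.2.2.1 a (mem_Icc_pred ha ha') c (mem_Icc_pred hc hc')
  rw [cartanSL_far h, neg_zero, zpow_zero] at this
  have h2 := Ki_mul_of_Kg_mul ha ha' one_ne_zero this
  rwa [inv_one, one_smul] at h2

lemma Ki_F_next (hq : (q : ℂ) ≠ 0) (ha : 1 ≤ a) (ha' : a < N) (hc : 1 ≤ c) (hc' : c < N)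
    (h : a + 1 = c ∨ c + 1 = a) : D.Ki a * D.F c = (q : ℂ)⁻¹ • (D.F c * D.Ki a) := by
  have := D.rels.2.2.2.1 a (mem_Icc_pred ha ha') c (mem_Icc_pred hc hc')
  rw [cartanSL_next h, neg_neg, zpow_one] at this
  exact Ki_mul_of_Kg_mul ha ha' hq this

lemma E_far (ha : 1 ≤ a) (ha' : a < N) (hc : 1 ≤ c) (hc' : c < N)
    (h : a + 1 < c) : Commute (D.E a) (D.E c) :=
  D.rels.2.2.2.2.2.2.1 a (mem_Icc_pred ha ha') c (mem_Icc_pred hc hc') (by omega)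

lemma F_far (ha : 1 ≤ a) (ha' : a < N) (hc : 1 ≤ c) (hc' : c < N)
    (h : a + 1 < c) : Commute (D.F a) (D.F c) :=
  D.rels.2.2.2.2.2.2.2.2 a (mem_Icc_pred ha ha') c (mem_Icc_pred hc hc') (by omega)

lemma commute_Ev {x : D.U} (h : ∀ c, a ≤ c → c ≤ a + d → Commute x (D.E c)) :
    Commute x (D.Ev d a) := by
  induction d generalizing a with
  | zero => exact h a le_rfl le_rfl
  | succ d ih =>
    have h1 := h a le_rfl (by omega)
    have h2 := ih (a := a + 1) fun c hc hc' => h c (by omega) (by omega)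
    exact (h1.mul_right h2).sub_right ((h2.mul_right h1).smul_right _)

lemma commute_Fv {x : D.U} (h : ∀ c, a ≤ c → c ≤ a + d → Commute x (D.F c)) :
    Commute x (D.Fv d a) := by
  induction d generalizing a with
  | zero => exact h a le_rfl le_rfl
  | succ d ih =>
    have h1 := h a le_rfl (by omega)
    have h2 := ih (a := a + 1) fun c hc hc' => h c (by omega) (by omega)
    exact (h2.mul_right h1).sub_right ((h1.mul_right h2).smul_right _)

lemma commute_Kv {x : D.U} (h : ∀ c, a ≤ c → c ≤ a + d → Commute x (D.Kg c)) :
    Commute x (D.Kv d a) := by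
  induction d generalizing a with
  | zero => exact h a le_rfl le_rfl
  | succ d ih =>
    exact (h a le_rfl (by omega)).mul_right
      (ih (a := a + 1) fun c hc hc' => h c (by omega) (by omega))

lemma commute_Kiv {x : D.U} (h : ∀ c, a ≤ c → c ≤ a + d → Commute x (D.Ki c)) :
    Commute x (D.Kiv d a) := by
  induction d generalizing a with
  | zero => exact h a le_rfl le_rfl
  | succ d ih =>
    exact (h a le_rfl (by omega)).mul_right
      (ih (a := a + 1) fun c hc hc' => h c (by omega) (by omega))

lemma Kg_mul_Ev_next (ha : 1 ≤ a) (hd : a + 1 + d < N) :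
    D.Kg a * D.Ev d (a + 1) = (q : ℂ)⁻¹ • (D.Ev d (a + 1) * D.Kg a) := by
  have h1 : D.Kg a * D.E (a + 1) = (q : ℂ)⁻¹ • (D.E (a + 1) * D.Kg a) :=
    Kg_E_next ha (by omega) (by omega) (by omega) (Or.inl rfl)
  cases d with
  | zero => exact h1
  | succ d =>
    have h2 : Commute (D.Kg a) (D.Ev d (a + 1 + 1)) := commute_Ev fun c hc hc' =>
      Kg_E_far ha (by omega) (by omega) (by omega) (by omega)
    have e1 : D.Kg a * (D.E (a + 1) * D.Ev d (a + 1 + 1)) =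
        (q : ℂ)⁻¹ • (D.E (a + 1) * D.Ev d (a + 1 + 1) * D.Kg a) := by
      rw [← mul_assoc, h1, smul_mul_assoc, mul_assoc, h2.eq, mul_assoc]
    have e2 : D.Kg a * (D.Ev d (a + 1 + 1) * D.E (a + 1)) =
        (q : ℂ)⁻¹ • (D.Ev d (a + 1 + 1) * D.E (a + 1) * D.Kg a) := by
      rw [← mul_assoc, h2.eq, mul_assoc, h1, mul_smul_comm, mul_assoc]
    simp only [Ev]
    rw [mul_sub, mul_smul_comm, e1, e2, sub_mul, smul_mul_assoc, smul_sub, smul_comm]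

lemma Fv_next_mul_Ki (hq : (q : ℂ) ≠ 0) (ha : 1 ≤ a) (hd : a + 1 + d < N) :
    D.Fv d (a + 1) * D.Ki a = (q : ℂ) • (D.Ki a * D.Fv d (a + 1)) := by
  have h1 : D.F (a + 1) * D.Ki a = (q : ℂ) • (D.Ki a * D.F (a + 1)) := by
    rw [Ki_F_next hq ha (by omega) (by omega) (by omega) (Or.inl rfl), smul_inv_smul₀ hq]
  cases d with
  | zero => exact h1
  | succ d =>
    have h2 : Commute (D.Ki a) (D.Fv d (a + 1 + 1)) := commute_Fv fun c hc hc' =>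
      Ki_F_far ha (by omega) (by omega) (by omega) (by omega)
    have e1 : D.F (a + 1) * D.Fv d (a + 1 + 1) * D.Ki a =
        (q : ℂ) • (D.Ki a * (D.F (a + 1) * D.Fv d (a + 1 + 1))) := by
      rw [mul_assoc, ← h2.eq, ← mul_assoc, h1, smul_mul_assoc, mul_assoc]
    have e2 : D.Fv d (a + 1 + 1) * D.F (a + 1) * D.Ki a =
        (q : ℂ) • (D.Ki a * (D.Fv d (a + 1 + 1) * D.F (a + 1))) := by
      rw [mul_assoc, h1, mul_smul_comm, ← mul_assoc, ← h2.eq, mul_assoc]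
    simp only [Fv]
    rw [sub_mul, smul_mul_assoc, e1, e2, mul_sub, mul_smul_comm, smul_sub, smul_comm]

lemma Kv_next_mul_E (ha : 1 ≤ a) (hd : a + 1 + d < N) :
    D.Kv d (a + 1) * D.E a = (q : ℂ)⁻¹ • (D.E a * D.Kv d (a + 1)) := by
  have h1 : D.Kg (a + 1) * D.E a = (q : ℂ)⁻¹ • (D.E a * D.Kg (a + 1)) :=
    Kg_E_next (by omega) (by omega) ha (by omega) (Or.inr rfl)
  cases d with
  | zero => exact h1
  | succ d =>
    have h2 : Commute (D.E a) (D.Kv d (a + 1 + 1)) := commute_Kv fun c hc hc' =>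
      (Kg_E_far (by omega) (by omega) ha (by omega) (by omega)).symm
    simp only [Kv]
    rw [mul_assoc, ← h2.eq, ← mul_assoc, h1, smul_mul_assoc, mul_assoc]

lemma Kiv_next_mul_F (hq : (q : ℂ) ≠ 0) (ha : 1 ≤ a) (hd : a + 1 + d < N) :
    D.Kiv d (a + 1) * D.F a = (q : ℂ)⁻¹ • (D.F a * D.Kiv d (a + 1)) := by
  have h1 : D.Ki (a + 1) * D.F a = (q : ℂ)⁻¹ • (D.F a * D.Ki (a + 1)) :=
    Ki_F_next hq (by omega) (by omega) ha (by omega) (Or.inr rfl)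
  cases d with
  | zero => exact h1
  | succ d =>
    have h2 : Commute (D.F a) (D.Kiv d (a + 1 + 1)) := commute_Kiv fun c hc hc' =>
      (Ki_F_far (by omega) (by omega) ha (by omega) (by omega)).symm
    simp only [Kiv]
    rw [mul_assoc, ← h2.eq, ← mul_assoc, h1, smul_mul_assoc, mul_assoc]

end Comm

open TensorProduct in
lemma comul_Ev (d : ℕ) {a : ℕ} (ha : 1 ≤ a) (hd : a + d < N) :
    Δ (D.Ev d a) = D.Ev d a ⊗ₜ[ℂ] 1 + D.Kv d a ⊗ₜ D.Ev d a + (1 - (q : ℂ)⁻¹ * (q : ℂ)⁻¹) •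
      ∑ t ∈ Finset.range d,
        (D.Ev t a * D.Kv (d - 1 - t) (a + t + 1)) ⊗ₜ[ℂ] D.Ev (d - 1 - t) (a + t + 1) := by
  induction d generalizing a with
  | zero => simpa [Ev, Kv] using UqslData.comul_E' ha hd
  | succ d ih =>
    have hE : Δ (D.E a) = D.E a ⊗ₜ[ℂ] 1 + D.Kg a ⊗ₜ D.E a := UqslData.comul_E' ha (by omega)
    have hKE := Kg_mul_Ev_next (D := D) ha (d := d) (by omega)
    have hKvE := Kv_next_mul_E (D := D) ha (d := d) (by omega)
    have hKK : Commute (D.Kg a) (D.Kv d (a + 1)) := commute_Kv fun c hc hc' =>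
      Kg_comm ha (by omega) (by omega) (by omega)
    have hmid : ∀ t ∈ Finset.range d,
        (D.E a ⊗ₜ[ℂ] 1 + D.Kg a ⊗ₜ D.E a) * ((D.Ev t (a + 1) * D.Kv (d - 1 - t) (a + 1 + t + 1)) ⊗ₜ[ℂ]
          D.Ev (d - 1 - t) (a + 1 + t + 1)) -
        (q : ℂ)⁻¹ • (((D.Ev t (a + 1) * D.Kv (d - 1 - t) (a + 1 + t + 1)) ⊗ₜ[ℂ]
          D.Ev (d - 1 - t) (a + 1 + t + 1)) * (D.E a ⊗ₜ[ℂ] 1 + D.Kg a ⊗ₜ D.E a)) =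
        (D.Ev (t + 1) a * D.Kv (d + 1 - 1 - (t + 1)) (a + (t + 1) + 1)) ⊗ₜ[ℂ]
          D.Ev (d + 1 - 1 - (t + 1)) (a + (t + 1) + 1) := by
      intro t ht
      rw [Finset.mem_range] at ht
      have i1 : d + 1 - 1 - (t + 1) = d - 1 - t := by omega
      have i2 : a + (t + 1) + 1 = a + 1 + t + 1 := by omega
      rw [i1, i2]
      have k1 := Kg_mul_Ev_next (D := D) ha (d := t) (by omega)
      have k2 : Commute (D.E a) (D.Ev (d - 1 - t) (a + 1 + t + 1)) := commute_Ev fun c hc hc' =>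
        E_far ha (by omega) (by omega) (by omega) (by omega)
      have k3 : Commute (D.E a) (D.Kv (d - 1 - t) (a + 1 + t + 1)) := commute_Kv fun c hc hc' =>
        (Kg_E_far (by omega) (by omega) ha (by omega) (by omega)).symm
      have k4 : Commute (D.Kg a) (D.Kv (d - 1 - t) (a + 1 + t + 1)) := commute_Kv fun c hc hc' =>
        Kg_comm ha (by omega) (by omega) (by omega)
      simp only [add_mul, mul_add, Algebra.TensorProduct.tmul_mul_tmul, one_mul, mul_one, Ev,
        smul_add, sub_mul, sub_tmul, smul_mul_assoc, smul_tmul']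
      rw [← mul_assoc (D.Kg a), k1, mul_assoc _ _ (D.E a), ← k3.eq, mul_assoc _ _ (D.Kg a), ← k4.eq,
        ← k2.eq]
      simp only [smul_mul_assoc, mul_assoc, ← smul_tmul']
      abel
    have hmid' : (D.E a ⊗ₜ[ℂ] 1 + D.Kg a ⊗ₜ D.E a) * (∑ t ∈ Finset.range d,
          (D.Ev t (a + 1) * D.Kv (d - 1 - t) (a + 1 + t + 1)) ⊗ₜ[ℂ]
          D.Ev (d - 1 - t) (a + 1 + t + 1)) -
        (q : ℂ)⁻¹ • ((∑ t ∈ Finset.range d,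
          (D.Ev t (a + 1) * D.Kv (d - 1 - t) (a + 1 + t + 1)) ⊗ₜ[ℂ]
          D.Ev (d - 1 - t) (a + 1 + t + 1)) * (D.E a ⊗ₜ[ℂ] 1 + D.Kg a ⊗ₜ D.E a)) =
        ∑ t ∈ Finset.range d, (D.Ev (t + 1) a * D.Kv (d + 1 - 1 - (t + 1)) (a + (t + 1) + 1)) ⊗ₜ[ℂ]
          D.Ev (d + 1 - 1 - (t + 1)) (a + (t + 1) + 1) := by
      rw [Finset.mul_sum, Finset.sum_mul, Finset.smul_sum, ← Finset.sum_sub_distrib]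
      exact Finset.sum_congr rfl hmid
    rw [Finset.sum_range_succ', ← hmid']
    simp only [Ev, Kv, map_sub, map_smul, Bialgebra.comul_mul, hE, ih (a := a + 1) (by omega) (by omega)]
    generalize (∑ t ∈ Finset.range d,
          (D.Ev t (a + 1) * D.Kv (d - 1 - t) (a + 1 + t + 1)) ⊗ₜ[ℂ]
          D.Ev (d - 1 - t) (a + 1 + t + 1)) = S
    generalize hG : D.E a ⊗ₜ[ℂ] 1 + D.Kg a ⊗ₜ D.E a = G
    have p1 : G * D.Ev d (a + 1) ⊗ₜ[ℂ] 1 = (D.E a * D.Ev d (a + 1)) ⊗ₜ[ℂ] 1 +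
        (q : ℂ)⁻¹ • ((D.Ev d (a + 1) * D.Kg a) ⊗ₜ D.E a) := by
      simp [← hG, add_mul, hKE, smul_tmul']
    have p2 : D.Ev d (a + 1) ⊗ₜ[ℂ] 1 * G = (D.Ev d (a + 1) * D.E a) ⊗ₜ[ℂ] 1 +
        (D.Ev d (a + 1) * D.Kg a) ⊗ₜ D.E a := by
      simp [← hG, mul_add]
    have p3 : G * D.Kv d (a + 1) ⊗ₜ[ℂ] D.Ev d (a + 1) =
        (D.E a * D.Kv d (a + 1)) ⊗ₜ[ℂ] D.Ev d (a + 1) +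
        (D.Kg a * D.Kv d (a + 1)) ⊗ₜ (D.E a * D.Ev d (a + 1)) := by
      simp [← hG, add_mul]
    have p4 : D.Kv d (a + 1) ⊗ₜ[ℂ] D.Ev d (a + 1) * G =
        (q : ℂ)⁻¹ • ((D.E a * D.Kv d (a + 1)) ⊗ₜ[ℂ] D.Ev d (a + 1)) +
        (D.Kg a * D.Kv d (a + 1)) ⊗ₜ (D.Ev d (a + 1) * D.E a) := by
      simp [← hG, mul_add, hKvE, hKK.eq, smul_tmul']
    simp only [mul_add, add_mul, p1, p2, p3, p4, sub_tmul, tmul_sub, tmul_smul, ← smul_tmul',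
      mul_smul_comm, smul_mul_assoc, add_zero, Nat.sub_zero, Nat.add_sub_cancel]
    module

open TensorProduct in
lemma comul_Fv (hq : (q : ℂ) ≠ 0) (d : ℕ) {a : ℕ} (ha : 1 ≤ a) (hd : a + d < N) :
    Δ (D.Fv d a) = D.Fv d a ⊗ₜ[ℂ] D.Kiv d a + 1 ⊗ₜ D.Fv d a + ((q : ℂ) - (q : ℂ)⁻¹) •
      ∑ t ∈ Finset.range d,
        D.Fv t a ⊗ₜ[ℂ] (D.Kiv t a * D.Fv (d - 1 - t) (a + t + 1)) := by
  induction d generalizing a with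
  | zero => simpa [Fv, Kiv] using UqslData.comul_F' ha hd
  | succ d ih =>
    have hF : Δ (D.F a) = D.F a ⊗ₜ[ℂ] D.Ki a + 1 ⊗ₜ D.F a := UqslData.comul_F' ha (by omega)
    have hKF := Fv_next_mul_Ki (D := D) hq ha (d := d) (by omega)
    have hKvF := Kiv_next_mul_F (D := D) hq ha (d := d) (by omega)
    have hKK : Commute (D.Ki a) (D.Kiv d (a + 1)) := commute_Kiv fun c hc hc' =>
      Ki_comm ha (by omega) (by omega) (by omega)
    have hmid : ∀ t ∈ Finset.range d,
        D.Fv t (a + 1) ⊗ₜ[ℂ] (D.Kiv t (a + 1) * D.Fv (d - 1 - t) (a + 1 + t + 1)) *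
          (D.F a ⊗ₜ[ℂ] D.Ki a + 1 ⊗ₜ D.F a) -
        (q : ℂ)⁻¹ • ((D.F a ⊗ₜ[ℂ] D.Ki a + 1 ⊗ₜ D.F a) *
          D.Fv t (a + 1) ⊗ₜ[ℂ] (D.Kiv t (a + 1) * D.Fv (d - 1 - t) (a + 1 + t + 1))) =
        D.Fv (t + 1) a ⊗ₜ[ℂ]
          (D.Kiv (t + 1) a * D.Fv (d + 1 - 1 - (t + 1)) (a + (t + 1) + 1)) := by
      intro t ht
      rw [Finset.mem_range] at ht
      have i1 : d + 1 - 1 - (t + 1) = d - 1 - t := by omega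
      have i2 : a + (t + 1) + 1 = a + 1 + t + 1 := by omega
      rw [i1, i2]
      have k1 := Kiv_next_mul_F (D := D) hq ha (d := t) (by omega)
      have k2 : Commute (D.F a) (D.Fv (d - 1 - t) (a + 1 + t + 1)) := commute_Fv fun c hc hc' =>
        F_far ha (by omega) (by omega) (by omega) (by omega)
      have k3 : Commute (D.Ki a) (D.Fv (d - 1 - t) (a + 1 + t + 1)) := commute_Fv fun c hc hc' =>
        Ki_F_far ha (by omega) (by omega) (by omega) (by omega)
      have k4 : Commute (D.Ki a) (D.Kiv t (a + 1)) := commute_Kiv fun c hc hc' =>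
        Ki_comm ha (by omega) (by omega) (by omega)
      have p1 : D.Kiv t (a + 1) * D.Fv (d - 1 - t) (a + 1 + t + 1) * D.Ki a =
          D.Ki a * (D.Kiv t (a + 1) * D.Fv (d - 1 - t) (a + 1 + t + 1)) := by
        rw [mul_assoc, ← k3.eq, ← mul_assoc, ← k4.eq, mul_assoc]
      have p2 : D.Kiv t (a + 1) * D.Fv (d - 1 - t) (a + 1 + t + 1) * D.F a =
          (q : ℂ)⁻¹ • (D.F a * (D.Kiv t (a + 1) * D.Fv (d - 1 - t) (a + 1 + t + 1))) := by
        rw [mul_assoc, ← k2.eq, ← mul_assoc, k1, smul_mul_assoc, mul_assoc]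
      simp only [add_mul, mul_add, Algebra.TensorProduct.tmul_mul_tmul, one_mul, mul_one, Fv, Kiv,
        sub_tmul, tmul_smul, ← smul_tmul', p1, p2, mul_assoc]
      module
    have hmid' : (∑ t ∈ Finset.range d,
          D.Fv t (a + 1) ⊗ₜ[ℂ] (D.Kiv t (a + 1) * D.Fv (d - 1 - t) (a + 1 + t + 1))) *
          (D.F a ⊗ₜ[ℂ] D.Ki a + 1 ⊗ₜ D.F a) -
        (q : ℂ)⁻¹ • ((D.F a ⊗ₜ[ℂ] D.Ki a + 1 ⊗ₜ D.F a) * ∑ t ∈ Finset.range d,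
          D.Fv t (a + 1) ⊗ₜ[ℂ] (D.Kiv t (a + 1) * D.Fv (d - 1 - t) (a + 1 + t + 1))) =
        ∑ t ∈ Finset.range d, D.Fv (t + 1) a ⊗ₜ[ℂ]
          (D.Kiv (t + 1) a * D.Fv (d + 1 - 1 - (t + 1)) (a + (t + 1) + 1)) := by
      rw [Finset.mul_sum, Finset.sum_mul, Finset.smul_sum, ← Finset.sum_sub_distrib]
      exact Finset.sum_congr rfl hmid
    rw [Finset.sum_range_succ', ← hmid']
    simp only [Fv, Kiv, map_sub, map_smul, Bialgebra.comul_mul, hF, ih (a := a + 1) (by omega) (by omega)]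
    generalize (∑ t ∈ Finset.range d,
          D.Fv t (a + 1) ⊗ₜ[ℂ] (D.Kiv t (a + 1) * D.Fv (d - 1 - t) (a + 1 + t + 1))) = S
    generalize hG : D.F a ⊗ₜ[ℂ] D.Ki a + 1 ⊗ₜ D.F a = G
    have p1 : D.Fv d (a + 1) ⊗ₜ[ℂ] D.Kiv d (a + 1) * G =
        (D.Fv d (a + 1) * D.F a) ⊗ₜ[ℂ] (D.Ki a * D.Kiv d (a + 1)) +
        (q : ℂ)⁻¹ • (D.Fv d (a + 1) ⊗ₜ[ℂ] (D.F a * D.Kiv d (a + 1))) := by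
      simp [← hG, mul_add, hKvF, hKK.eq]
    have p2 : G * D.Fv d (a + 1) ⊗ₜ[ℂ] D.Kiv d (a + 1) =
        (D.F a * D.Fv d (a + 1)) ⊗ₜ[ℂ] (D.Ki a * D.Kiv d (a + 1)) +
        D.Fv d (a + 1) ⊗ₜ[ℂ] (D.F a * D.Kiv d (a + 1)) := by
      simp [← hG, add_mul]
    have p3 : (1 : D.U) ⊗ₜ[ℂ] D.Fv d (a + 1) * G =
        (q : ℂ) • (D.F a ⊗ₜ[ℂ] (D.Ki a * D.Fv d (a + 1))) +
        (1 : D.U) ⊗ₜ[ℂ] (D.Fv d (a + 1) * D.F a) := by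
      rw [← hG, mul_add]
      simp only [Algebra.TensorProduct.tmul_mul_tmul, one_mul, hKF, tmul_smul]
    have p4 : G * (1 : D.U) ⊗ₜ[ℂ] D.Fv d (a + 1) =
        D.F a ⊗ₜ[ℂ] (D.Ki a * D.Fv d (a + 1)) + (1 : D.U) ⊗ₜ[ℂ] (D.F a * D.Fv d (a + 1)) := by
      simp [← hG, add_mul]
    simp only [mul_add, add_mul, p1, p2, p3, p4, sub_tmul, tmul_sub, tmul_smul, ← smul_tmul',
      mul_smul_comm, smul_mul_assoc, add_zero, Nat.sub_zero, Nat.add_sub_cancel]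
    module

end UqslData

namespace QslnFun

open HopfAlgebra

variable {q : ℝ} {N : ℕ} {D : UqslData q N}

section Grassmann

variable (P : QslnFun q N D) (r : ℕ)

/-- The generators `∑_{k ≤ r} S(u_{ik}) u_{kj}` of the quantum Grassmannian. -/
def grz (i j : ℕ) : P.A := ∑ k ∈ Finset.Icc 1 r, antipode ℂ (P.u i k) * P.u k j

end Grassmann

variable {P : QslnFun q N D} {r : ℕ}

lemma kap'_mul_kap (hq : (q : ℂ) ≠ 0) (c k : ℕ) : kap' q c k * kap q c k = 1 := by
  unfold kap kap'
  split_ifs <;> simp [hq]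

section Action

variable {i j c : ℕ} (hr : r < N) (hi1 : 1 ≤ i) (hi2 : i ≤ N) (hj1 : 1 ≤ j) (hj2 : j ≤ N)
  (h1 : 1 ≤ c) (h2 : c < N)

include hr hi1 hi2 hj1 hj2

lemma counit_grz : ε (P.grz r i j) = if i = j ∧ j ≤ r then 1 else 0 := by
  have hk : ∀ k ∈ Finset.Icc 1 r, ε (antipode ℂ (P.u i k) * P.u k j) =
      if k = i then (if k = j then (1 : ℂ) else 0) else 0 := by
    intro k hk
    rw [Finset.mem_Icc] at hk
    rw [Bialgebra.counit_mul, HopfAlgebra.counit_antipode, P.counit_u' hi1 hi2 hk.1 (by omega),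
      P.counit_u' hk.1 (by omega) hj1 hj2]
    by_cases e1 : i = k
    · subst e1; simp [eq_comm]
    · simp [e1, Ne.symm e1]
  rw [grz, map_sum, Finset.sum_congr rfl hk, Finset.sum_ite_eq']
  by_cases h : i = j ∧ j ≤ r
  · rw [if_pos h, if_pos (by rw [Finset.mem_Icc]; omega), if_pos h.1]
  · rw [if_neg h]
    split_ifs with h3 h4
    · rw [Finset.mem_Icc] at h3; omega
    · rfl
    · rfl

include h1 h2

lemma hitR_E_grz : P.hitR (D.E c) (P.grz r i j) =
    -(if i = c then kap' q c i • P.grz r (c + 1) j else 0) +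
      (if j = c + 1 then kap' q c i • P.grz r i c else 0) := by
  have hk : ∀ k ∈ Finset.Icc 1 r, P.hitR (D.E c) (antipode ℂ (P.u i k) * P.u k j) =
      -(if i = c then kap' q c i • (antipode ℂ (P.u (c + 1) k) * P.u k j) else 0) +
      (if j = c + 1 then kap' q c i • (antipode ℂ (P.u i k) * P.u k c) else 0) := by
    intro k hk
    rw [Finset.mem_Icc] at hk
    rw [P.hitR_E_mul h1 h2, hitR_antipode, hitR_antipode, UqslData.antipode_E h1 h2,
      UqslData.antipode_Kg h1 h2, P.hitR_E_u hk.1 (by omega) hj1 hj2 h1 h2, ← neg_one_smul ℂ, hitL_smul,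
      hitL_mul, P.hitL_Ki_u hi1 hi2 hk.1 (by omega) h1 h2, ← kap', map_smul (P.hitL (D.E c)),
      P.hitL_E_u hi1 hi2 hk.1 (by omega) h1 h2]
    split_ifs <;> simp
  rw [grz, map_sum, Finset.sum_congr rfl hk, Finset.sum_add_distrib, Finset.sum_neg_distrib]
  congr 1
  · split_ifs <;> simp [grz, Finset.smul_sum]
  · split_ifs <;> simp [grz, Finset.smul_sum]

lemma hitR_F_grz : P.hitR (D.F c) (P.grz r i j) =
    -(if i = c + 1 then ((q : ℂ) * kap' q c j) • P.grz r c j else 0) +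
      (if j = c then P.grz r i (c + 1) else 0) := by
  have hk : ∀ k ∈ Finset.Icc 1 r, P.hitR (D.F c) (antipode ℂ (P.u i k) * P.u k j) =
      -(if i = c + 1 then ((q : ℂ) * kap' q c j) • (antipode ℂ (P.u c k) * P.u k j) else 0) +
      (if j = c then antipode ℂ (P.u i k) * P.u k (c + 1) else 0) := by
    intro k hk
    rw [Finset.mem_Icc] at hk
    rw [P.hitR_F_mul h1 h2, hitR_antipode, UqslData.antipode_F h1 h2,
      P.hitR_F_u hk.1 (by omega) hj1 hj2 h1 h2, P.hitR_Ki_u hk.1 (by omega) hj1 hj2 h1 h2,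
      ← neg_one_smul ℂ, hitL_smul, hitL_mul, P.hitL_F_u hi1 hi2 hk.1 (by omega) h1 h2, ← kap']
    by_cases hi : i = c + 1
    · rw [if_pos hi, if_pos hi, P.hitL_Kg_u h1 (by omega) hk.1 (by omega) h1 h2, if_pos rfl]
      simp only [map_smul, smul_mul_assoc, mul_smul_comm, smul_smul, mul_ite, mul_zero]
      congr 1
      rw [← neg_smul]
      congr 1
      ring
    · simp [hi]
  rw [grz, map_sum, Finset.sum_congr rfl hk, Finset.sum_add_distrib, Finset.sum_neg_distrib]
  congr 1
  · split_ifs <;> simp [grz, Finset.smul_sum]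
  · split_ifs <;> simp [grz]

lemma hitR_Kg_grz : P.hitR (D.Kg c) (P.grz r i j) = (kap' q c i * kap q c j) • P.grz r i j := by
  rw [grz, map_sum, Finset.smul_sum]
  refine Finset.sum_congr rfl fun k hk => ?_
  rw [Finset.mem_Icc] at hk
  rw [P.hitR_Kg_mul h1 h2, hitR_antipode, UqslData.antipode_Kg h1 h2,
    P.hitL_Ki_u hi1 hi2 hk.1 (by omega) h1 h2, P.hitR_Kg_u hk.1 (by omega) hj1 hj2 h1 h2, ← kap, ← kap',
    map_smul, smul_mul_smul_comm]

lemma hitR_Ki_grz : P.hitR (D.Ki c) (P.grz r i j) = (kap q c i * kap' q c j) • P.grz r i j := by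
  rw [grz, map_sum, Finset.smul_sum]
  refine Finset.sum_congr rfl fun k hk => ?_
  rw [Finset.mem_Icc] at hk
  rw [P.hitR_Ki_mul h1 h2, hitR_antipode, UqslData.antipode_Ki h1 h2,
    P.hitL_Kg_u hi1 hi2 hk.1 (by omega) h1 h2, P.hitR_Ki_u hk.1 (by omega) hj1 hj2 h1 h2, ← kap, ← kap',
    map_smul, smul_mul_smul_comm]

lemma hitL_E_grz (hc : c ≠ r) : P.hitL (D.E c) (P.grz r i j) = 0 := by
  have hk : ∀ k ∈ Finset.Icc 1 r, P.hitL (D.E c) (antipode ℂ (P.u i k) * P.u k j) =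
      -(if k = c + 1 then (q : ℂ)⁻¹ • (antipode ℂ (P.u i c) * P.u (c + 1) j) else 0) +
      (if k = c then (q : ℂ)⁻¹ • (antipode ℂ (P.u i c) * P.u (c + 1) j) else 0) := by
    intro k hk
    rw [Finset.mem_Icc] at hk
    rw [P.hitL_E_mul h1 h2, hitL_antipode, hitL_antipode, UqslData.antipode_E h1 h2,
      UqslData.antipode_Kg h1 h2, P.hitL_E_u hk.1 (by omega) hj1 hj2 h1 h2, ← neg_one_smul ℂ, hitR_smul,
      hitR_mul, P.hitR_Ki_u hi1 hi2 hk.1 (by omega) h1 h2,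
      P.hitR_E_u hi1 hi2 hk.1 (by omega) h1 h2]
    by_cases e1 : k = c + 1
    · subst e1
      rw [if_pos rfl, P.hitR_Ki_u hi1 hi2 h1 (by omega) h1 h2]
      simp
    · by_cases e2 : k = c
      · subst e2; simp
      · simp [e1, e2]
  rw [grz, map_sum, Finset.sum_congr rfl hk, Finset.sum_add_distrib, Finset.sum_neg_distrib,
    Finset.sum_ite_eq', Finset.sum_ite_eq']
  simp only [Finset.mem_Icc]
  by_cases h : c + 1 ≤ r
  · rw [if_pos (by omega), if_pos (by omega), neg_add_cancel]
  · rw [if_neg (by omega), if_neg (by omega), neg_zero, add_zero]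

lemma hitL_F_grz (hq : (q : ℂ) ≠ 0) (hc : c ≠ r) : P.hitL (D.F c) (P.grz r i j) = 0 := by
  have hk : ∀ k ∈ Finset.Icc 1 r, P.hitL (D.F c) (antipode ℂ (P.u i k) * P.u k j) =
      -(if k = c then (antipode ℂ (P.u i (c + 1)) * P.u c j) else 0) +
      (if k = c + 1 then (antipode ℂ (P.u i (c + 1)) * P.u c j) else 0) := by
    intro k hk
    rw [Finset.mem_Icc] at hk
    rw [P.hitL_F_mul h1 h2, hitL_antipode, UqslData.antipode_F h1 h2,
      P.hitL_F_u hk.1 (by omega) hj1 hj2 h1 h2, P.hitL_Ki_u hk.1 (by omega) hj1 hj2 h1 h2,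
      ← neg_one_smul ℂ, hitR_smul, hitR_mul, P.hitR_Kg_u hi1 hi2 hk.1 (by omega) h1 h2,
      map_smul (P.hitR (D.F c)), P.hitR_F_u hi1 hi2 hk.1 (by omega) h1 h2]
    by_cases e1 : k = c
    · subst e1
      have hne : k ≠ k + 1 := by omega
      simp only [if_true, if_neg hne, mul_zero, neg_one_smul, map_neg, map_smul, neg_mul, smul_mul_smul_comm,
        mul_inv_cancel₀ hq, one_smul]
    · by_cases e2 : k = c + 1
      · subst e2; simp
      · simp [e1, e2]
  rw [grz, map_sum, Finset.sum_congr rfl hk, Finset.sum_add_distrib, Finset.sum_neg_distrib,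
    Finset.sum_ite_eq', Finset.sum_ite_eq']
  simp only [Finset.mem_Icc]
  by_cases h : c + 1 ≤ r
  · rw [if_pos (by omega), if_pos (by omega), neg_add_cancel]
  · rw [if_neg (by omega), if_neg (by omega), neg_zero, add_zero]

lemma hitL_K_grz (hq : (q : ℂ) ≠ 0) : P.hitL (D.Kg c) (P.grz r i j) = P.grz r i j ∧
    P.hitL (D.Ki c) (P.grz r i j) = P.grz r i j := by
  constructor
  all_goals
    rw [grz, map_sum]
    refine Finset.sum_congr rfl fun k hk => ?_
    rw [Finset.mem_Icc] at hk
  · rw [P.hitL_Kg_mul h1 h2, hitL_antipode, UqslData.antipode_Kg h1 h2,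
      P.hitR_Ki_u hi1 hi2 hk.1 (by omega) h1 h2, P.hitL_Kg_u hk.1 (by omega) hj1 hj2 h1 h2, ← kap,
      ← kap', map_smul, smul_mul_smul_comm, kap'_mul_kap hq, one_smul]
  · rw [P.hitL_Ki_mul h1 h2, hitL_antipode, UqslData.antipode_Ki h1 h2,
      P.hitR_Kg_u hi1 hi2 hk.1 (by omega) h1 h2, P.hitL_Ki_u hk.1 (by omega) hj1 hj2 h1 h2, ← kap,
      ← kap', map_smul, smul_mul_smul_comm, mul_comm, kap'_mul_kap hq, one_smul]

omit h1 h2 in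
lemma grz_mem_Bmod (hq : (q : ℂ) ≠ 0) : P.grz r i j ∈ P.Bmod r := by
  refine mem_Bmod.2 (UqslData.Ksub_le ?_ ?_ ?_ ?_)
  · intro c h1 h2 hc
    rw [mem_fixL, hitL_E_grz hr hi1 hi2 hj1 hj2 h1 h2 hc, UqslData.counit_E' h1 h2, zero_smul]
  · intro c h1 h2 hc
    rw [mem_fixL, hitL_F_grz hr hi1 hi2 hj1 hj2 h1 h2 hq hc, UqslData.counit_F' h1 h2, zero_smul]
  · intro c h1 h2
    rw [mem_fixL, (hitL_K_grz hr hi1 hi2 hj1 hj2 h1 h2 hq).1, UqslData.counit_Kg' h1 h2, one_smul]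
  · intro c h1 h2
    rw [mem_fixL, (hitL_K_grz hr hi1 hi2 hj1 hj2 h1 h2 hq).2, UqslData.counit_Ki' h1 h2, one_smul]

omit h1 h2 in
lemma grz_mem_Bplus (hq : (q : ℂ) ≠ 0) (h : i ≠ j) : P.grz r i j ∈ P.Bplus r :=
  ⟨grz_mem_Bmod hr hi1 hi2 hj1 hj2 hq, by
    change ε (P.grz r i j) = 0
    rw [counit_grz hr hi1 hi2 hj1 hj2, if_neg (by omega)]⟩

end Action

end QslnFun

namespace QslnFun

open Coalgebra

variable {q : ℝ} {N : ℕ} {D : UqslData q N}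

section ActMul

variable (P : QslnFun q N D)

/-- The map `x ⊗ y ↦ (x ▷ a) (y ▷ b)`. -/
def actMul (a b : P.A) : D.U ⊗[ℂ] D.U →ₗ[ℂ] P.A :=
  TensorProduct.lift (LinearMap.mk₂ ℂ (fun x y => P.hitR x a * P.hitR y b)
    (fun _ _ _ => by rw [hitR_add, add_mul]) (fun _ _ _ => by rw [hitR_smul, smul_mul_assoc])
    (fun _ _ _ => by rw [hitR_add, mul_add]) (fun _ _ _ => by rw [hitR_smul, mul_smul_comm]))

@[simp] lemma actMul_tmul (a b : P.A) (x y : D.U) :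
    P.actMul a b (x ⊗ₜ y) = P.hitR x a * P.hitR y b := rfl

lemma hitR_mul_comul (x : D.U) (a b : P.A) : P.hitR x (a * b) = P.actMul a b (Δ x) := by
  have h : ∀ τ : D.U ⊗[ℂ] D.U, ∑ i ∈ (reprMul a b).index, LinearMap.mul' ℂ ℂ (TensorProduct.map
      (P.pair.flip ((Coalgebra.Repr.right (ℛ ℂ a)) i.1)) (P.pair.flip ((Coalgebra.Repr.right (ℛ ℂ b)) i.2)) τ) •
        (reprMul a b).left i = P.actMul a b τ := by
    intro τ
    induction τ using TensorProduct.induction_on with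
    | zero => simp
    | add τ τ' h h' => simp only [map_add, add_smul, Finset.sum_add_distrib, h, h']
    | tmul x y =>
      simp [P.hitR_repr _ (ℛ ℂ a), P.hitR_repr _ (ℛ ℂ b), Finset.sum_mul_sum, reprMul,
        ← Finset.sum_product', smul_mul_smul_comm, smul_smul, mul_comm]
  rw [P.hitR_repr x (reprMul a b), ← h]
  refine Finset.sum_congr rfl fun i _ => ?_
  rw [← P.pair_mulA]
  rfl

lemma hitR_Ev_mul {d a : ℕ} (ha : 1 ≤ a) (hd : a + d < N) (x y : P.A) :
    P.hitR (D.Ev d a) (x * y) = P.hitR (D.Ev d a) x * y + P.hitR (D.Kv d a) x * P.hitR (D.Ev d a) y +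
      (1 - (q : ℂ)⁻¹ * (q : ℂ)⁻¹) • ∑ t ∈ Finset.range d,
        P.hitR (D.Ev t a) (P.hitR (D.Kv (d - 1 - t) (a + t + 1)) x) *
          P.hitR (D.Ev (d - 1 - t) (a + t + 1)) y := by
  rw [hitR_mul_comul, UqslData.comul_Ev d ha hd]
  simp only [map_add, map_smul, map_sum, actMul_tmul, hitR_mul, hitR_one]

lemma hitR_Fv_mul (hq : (q : ℂ) ≠ 0) {d a : ℕ} (ha : 1 ≤ a) (hd : a + d < N) (x y : P.A) :
    P.hitR (D.Fv d a) (x * y) = P.hitR (D.Fv d a) x * P.hitR (D.Kiv d a) y + x * P.hitR (D.Fv d a) y +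
      ((q : ℂ) - (q : ℂ)⁻¹) • ∑ t ∈ Finset.range d,
        P.hitR (D.Fv t a) x *
          P.hitR (D.Kiv t a) (P.hitR (D.Fv (d - 1 - t) (a + t + 1)) y) := by
  rw [hitR_mul_comul, UqslData.comul_Fv hq d ha hd]
  simp only [map_add, map_smul, map_sum, actMul_tmul, hitR_mul, hitR_one]

end ActMul

variable (P : QslnFun q N D) (r : ℕ)

/-- The `l`-th term of the `B⁺`-adic filtration of the quantum Grassmannian. -/
def fil (l : ℕ) : Submodule ℂ P.A := P.Bmod r * P.Bplus r ^ l

variable {P r}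

lemma Bmod_mul_Bmod : P.Bmod r * P.Bmod r ≤ P.Bmod r :=
  Submodule.mul_le.2 fun _ ha _ hb => mul_mem_Bmod ha hb

lemma Bplus_mul_Bmod : P.Bplus r * P.Bmod r ≤ P.Bplus r :=
  Submodule.mul_le.2 fun a ha b hb => ⟨mul_mem_Bmod ha.1 hb, by
    change ε (a * b) = 0
    rw [Bialgebra.counit_mul, LinearMap.mem_ker.1 ha.2, zero_mul]⟩

lemma le_Bmod_mul (V : Submodule ℂ P.A) : V ≤ P.Bmod r * V := by
  conv_lhs => rw [← one_mul V]
  exact mul_le_mul' (Submodule.one_le.2 one_mem_Bmod) le_rfl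

lemma fil_zero : P.fil r 0 = P.Bmod r := by rw [fil, pow_zero, mul_one]

lemma fil_succ (l : ℕ) : P.fil r (l + 1) = P.Bplus r ^ (l + 1) := by
  refine le_antisymm ?_ (le_Bmod_mul _)
  rw [fil, pow_succ', ← mul_assoc]
  exact mul_le_mul' Bmod_mul_Bplus le_rfl

lemma fil_one : P.fil r 1 = P.Bplus r := by rw [fil_succ, pow_one]

lemma fil_mul_fil (m n : ℕ) : P.fil r m * P.fil r n ≤ P.fil r (m + n) := by
  rcases m with _ | m
  · rw [fil_zero, zero_add, fil, ← mul_assoc]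
    exact mul_le_mul' Bmod_mul_Bmod le_rfl
  · rw [show m + 1 + n = (m + n) + 1 by ring, fil_succ, fil_succ, fil, pow_succ, mul_assoc,
      ← mul_assoc (P.Bplus r), show m + n + 1 = m + (1 + n) by ring, pow_add, pow_add, pow_one]
    exact mul_le_mul' le_rfl (mul_le_mul' Bplus_mul_Bmod le_rfl)

lemma fil_anti : Antitone (P.fil r) := by
  refine antitone_nat_of_succ_le fun l => ?_
  rw [fil_succ, pow_succ', fil]
  exact mul_le_mul' inf_le_left le_rfl

lemma mul_mem_fil {m n l : ℕ} {a b : P.A} (ha : a ∈ P.fil r m) (hb : b ∈ P.fil r n) (h : l ≤ m + n) :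
    a * b ∈ P.fil r l :=
  fil_anti h (fil_mul_fil m n (Submodule.mul_mem_mul ha hb))

lemma hitR_mem_Bmod (x : D.U) {a : P.A} (ha : a ∈ P.Bmod r) : P.hitR x a ∈ P.Bmod r :=
  mem_Bmod.2 fun k hk => by
    rw [mem_fixL, hitL_hitR, hitL_of_mem_Bmod ha hk, map_smul]

lemma hitR_mem_fil_zero (x : D.U) {a : P.A} (ha : a ∈ P.Bmod r) : P.hitR x a ∈ P.fil r 0 := by
  rw [fil_zero]; exact hitR_mem_Bmod x ha

lemma hitR_mem_fil_one {x : D.U} {a : P.A} (ha : a ∈ P.Bmod r) (h : P.pair x a = 0) :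
    P.hitR x a ∈ P.fil r 1 := by
  rw [fil_one]
  exact ⟨hitR_mem_Bmod x ha, by change ε _ = 0; rw [counit_hitR, h]⟩

lemma pair_Ksub_mul {k : D.U} (hk : k ∈ D.Ksub r) (x : D.U) {a : P.A} (ha : a ∈ P.Bmod r) :
    P.pair (k * x) a = ε k * P.pair x a := by
  rw [← pair_hitL, hitL_of_mem_Bmod ha hk, map_smul, smul_eq_mul]

lemma pair_Ksub {k : D.U} (hk : k ∈ D.Ksub r) {a : P.A} (ha : a ∈ P.Bmod r) :
    P.pair k a = ε k * ε a := by
  have := pair_Ksub_mul hk 1 ha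
  rwa [mul_one, P.pair_oneU] at this

lemma hitR_Ksub_mem_Bplus {k : D.U} (hk : k ∈ D.Ksub r) {a : P.A} (ha : a ∈ P.Bplus r) :
    P.hitR k a ∈ P.fil r 1 :=
  hitR_mem_fil_one ha.1 (by rw [pair_Ksub hk ha.1, LinearMap.mem_ker.1 ha.2, mul_zero])

variable (P r) in
/-- The elements of `U` lowering the `B⁺`-adic filtration by at most `n`. -/
def low (n : ℕ) : Submodule ℂ D.U where
  carrier := {x | ∀ m, ∀ a ∈ P.fil r m, P.hitR x a ∈ P.fil r (m - n)}
  add_mem' hx hy m a ha := by rw [hitR_add]; exact add_mem (hx m a ha) (hy m a ha)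
  zero_mem' m a _ := by simp
  smul_mem' c x hx m a ha := by rw [hitR_smul]; exact Submodule.smul_mem _ c (hx m a ha)

lemma mul_mem_low {m n : ℕ} {x y : D.U} (hx : x ∈ P.low r m) (hy : y ∈ P.low r n) :
    x * y ∈ P.low r (m + n) := fun l a ha => by
  rw [hitR_mul, add_comm, ← Nat.sub_sub]
  exact hx _ _ (hy _ _ ha)

lemma one_mem_low : (1 : D.U) ∈ P.low r 0 := fun l a ha => by simpa using ha

lemma low_mono {m n : ℕ} (h : m ≤ n) : P.low r m ≤ P.low r n := fun _ hx l a ha =>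
  fil_anti (by omega) (hx l a ha)

lemma pair_low {n m : ℕ} {x : D.U} (hx : x ∈ P.low r n) {a : P.A} (ha : a ∈ P.fil r m) (h : n < m) :
    P.pair x a = 0 := by
  have := fil_anti (by omega : 1 ≤ m - n) (hx m a ha)
  rw [fil_one] at this
  rw [← counit_hitR]
  exact this.2

section Low

variable {c : ℕ} (h1 : 1 ≤ c) (h2 : c < N)
include h1 h2

lemma Kg_mem_low : D.Kg c ∈ P.low r 0 := by
  intro m
  induction m with
  | zero => intro a ha; rw [fil_zero] at ha; exact hitR_mem_fil_zero _ ha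
  | succ m ih =>
    intro a ha
    rw [fil_succ, pow_succ'] at ha
    refine Submodule.mul_induction_on ha (fun v hv w hw => ?_) fun v w hv hw => ?_
    · rw [P.hitR_Kg_mul h1 h2]
      exact mul_mem_fil (hitR_Ksub_mem_Bplus (D.Kg_mem_Ksub h1 h2) hv) (ih w (le_Bmod_mul _ hw))
        (by omega)
    · rw [map_add]; exact add_mem hv hw

lemma Ki_mem_low : D.Ki c ∈ P.low r 0 := by
  intro m
  induction m with
  | zero => intro a ha; rw [fil_zero] at ha; exact hitR_mem_fil_zero _ ha
  | succ m ih =>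
    intro a ha
    rw [fil_succ, pow_succ'] at ha
    refine Submodule.mul_induction_on ha (fun v hv w hw => ?_) fun v w hv hw => ?_
    · rw [P.hitR_Ki_mul h1 h2]
      exact mul_mem_fil (hitR_Ksub_mem_Bplus (D.Ki_mem_Ksub h1 h2) hv) (ih w (le_Bmod_mul _ hw))
        (by omega)
    · rw [map_add]; exact add_mem hv hw

lemma hitR_mem_fil_E (a : P.A) (ha : a ∈ P.Bplus r) :
    P.hitR (D.E c) a ∈ P.fil r (if c = r then 0 else 1) ∧
      P.hitR (D.F c) a ∈ P.fil r (if c = r then 0 else 1) := by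
  split_ifs with h
  · exact ⟨hitR_mem_fil_zero _ ha.1, hitR_mem_fil_zero _ ha.1⟩
  · exact ⟨hitR_Ksub_mem_Bplus (D.E_mem_Ksub h1 h2 h) ha, hitR_Ksub_mem_Bplus (D.F_mem_Ksub h1 h2 h) ha⟩

lemma E_mem_low : D.E c ∈ P.low r (if c = r then 1 else 0) := by
  intro m
  induction m with
  | zero => intro a ha; rw [Nat.zero_sub]; rw [fil_zero] at ha; exact hitR_mem_fil_zero _ ha
  | succ m ih =>
    intro a ha
    rw [fil_succ, pow_succ'] at ha
    refine Submodule.mul_induction_on ha (fun v hv w hw => ?_) fun v w hv hw => ?_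
    · rw [P.hitR_E_mul h1 h2]
      have hw' : w ∈ P.fil r m := le_Bmod_mul _ hw
      refine add_mem (mul_mem_fil (hitR_mem_fil_E h1 h2 v hv).1 hw' ?_)
        (mul_mem_fil (hitR_Ksub_mem_Bplus (D.Kg_mem_Ksub h1 h2) hv) (ih w hw') ?_)
      all_goals split_ifs <;> omega
    · rw [map_add]; exact add_mem hv hw

lemma F_mem_low : D.F c ∈ P.low r (if c = r then 1 else 0) := by
  intro m
  induction m with
  | zero => intro a ha; rw [Nat.zero_sub]; rw [fil_zero] at ha; exact hitR_mem_fil_zero _ ha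
  | succ m ih =>
    intro a ha
    rw [fil_succ, pow_succ'] at ha
    refine Submodule.mul_induction_on ha (fun v hv w hw => ?_) fun v w hv hw => ?_
    · rw [P.hitR_F_mul h1 h2]
      have hw' : w ∈ P.fil r m := le_Bmod_mul _ hw
      have hv' : v ∈ P.fil r 1 := by rwa [fil_one]
      refine add_mem (mul_mem_fil (hitR_mem_fil_E h1 h2 v hv).2 (Ki_mem_low h1 h2 m w hw') ?_)
        (mul_mem_fil hv' (ih w hw') ?_)
      all_goals split_ifs <;> omega
    · rw [map_add]; exact add_mem hv hw

end Low

lemma Ev_mem_low (d : ℕ) {a : ℕ} (ha : 1 ≤ a) (hd : a + d < N) :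
    D.Ev d a ∈ P.low r (if a ≤ r ∧ r ≤ a + d then 1 else 0) := by
  induction d generalizing a with
  | zero =>
    refine low_mono ?_ (E_mem_low (c := a) ha (by omega))
    split_ifs <;> omega
  | succ d ih =>
    have h1 := E_mem_low (P := P) (r := r) (c := a) ha (by omega)
    have h2 := ih (a := a + 1) (by omega) (by omega)
    refine sub_mem (low_mono ?_ (mul_mem_low h1 h2))
      (Submodule.smul_mem _ _ (low_mono ?_ (mul_mem_low h2 h1)))
    all_goals split_ifs <;> omega

lemma Fv_mem_low (d : ℕ) {a : ℕ} (ha : 1 ≤ a) (hd : a + d < N) :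
    D.Fv d a ∈ P.low r (if a ≤ r ∧ r ≤ a + d then 1 else 0) := by
  induction d generalizing a with
  | zero =>
    refine low_mono ?_ (F_mem_low (c := a) ha (by omega))
    split_ifs <;> omega
  | succ d ih =>
    have h1 := F_mem_low (P := P) (r := r) (c := a) ha (by omega)
    have h2 := ih (a := a + 1) (by omega) (by omega)
    refine sub_mem (low_mono ?_ (mul_mem_low h2 h1))
      (Submodule.smul_mem _ _ (low_mono ?_ (mul_mem_low h1 h2)))
    all_goals split_ifs <;> omega

lemma Ev_mem_Ksub (d : ℕ) {a : ℕ} (ha : 1 ≤ a) (hd : a + d < N) (h : r < a ∨ a + d < r) :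
    D.Ev d a ∈ D.Ksub r := by
  induction d generalizing a with
  | zero => exact D.E_mem_Ksub ha (by omega) (by omega)
  | succ d ih =>
    have h1 := D.E_mem_Ksub (r := r) ha (by omega) (by omega)
    have h2 := ih (a := a + 1) (by omega) (by omega) (by omega)
    exact sub_mem (mul_mem h1 h2) (Subalgebra.smul_mem _ (mul_mem h2 h1) _)

lemma Fv_mem_Ksub (d : ℕ) {a : ℕ} (ha : 1 ≤ a) (hd : a + d < N) (h : r < a ∨ a + d < r) :
    D.Fv d a ∈ D.Ksub r := by
  induction d generalizing a with
  | zero => exact D.F_mem_Ksub ha (by omega) (by omega)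
  | succ d ih =>
    have h1 := D.F_mem_Ksub (r := r) ha (by omega) (by omega)
    have h2 := ih (a := a + 1) (by omega) (by omega) (by omega)
    exact sub_mem (mul_mem h2 h1) (Subalgebra.smul_mem _ (mul_mem h1 h2) _)

lemma counit_Ev (d : ℕ) {a : ℕ} (ha : 1 ≤ a) (hd : a + d < N) : ε (D.Ev d a) = 0 := by
  cases d with
  | zero => rw [UqslData.Ev, UqslData.counit_E' ha (by omega)]
  | succ d =>
    have := UqslData.counit_E' (D := D) ha (by omega)
    simp [UqslData.Ev, Bialgebra.counit_mul, this]

lemma counit_Fv (d : ℕ) {a : ℕ} (ha : 1 ≤ a) (hd : a + d < N) : ε (D.Fv d a) = 0 := by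
  cases d with
  | zero => rw [UqslData.Fv, UqslData.counit_F' ha (by omega)]
  | succ d =>
    have := UqslData.counit_F' (D := D) ha (by omega)
    simp [UqslData.Fv, Bialgebra.counit_mul, this]

lemma Kiv_mem_low (d : ℕ) {a : ℕ} (ha : 1 ≤ a) (hd : a + d < N) : D.Kiv d a ∈ P.low r 0 := by
  induction d generalizing a with
  | zero => exact Ki_mem_low ha (by omega)
  | succ d ih =>
    have h1 := Ki_mem_low (P := P) (r := r) ha (by omega)
    have h2 := mul_mem_low h1 (ih (a := a + 1) (by omega) (by omega))
    rwa [add_zero] at h2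

lemma Kiv_mem_Ksub (d : ℕ) {a : ℕ} (ha : 1 ≤ a) (hd : a + d < N) : D.Kiv d a ∈ D.Ksub r := by
  induction d generalizing a with
  | zero => exact D.Ki_mem_Ksub ha (by omega)
  | succ d ih =>
    exact mul_mem (D.Ki_mem_Ksub ha (by omega)) (ih (by omega) (by omega))

lemma counit_Kiv (d : ℕ) {a : ℕ} (ha : 1 ≤ a) (hd : a + d < N) : ε (D.Kiv d a) = 1 := by
  induction d generalizing a with
  | zero => exact UqslData.counit_Ki' ha (by omega)
  | succ d ih =>
    rw [UqslData.Kiv, Bialgebra.counit_mul, UqslData.counit_Ki' ha (by omega),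
      ih (by omega) (by omega), one_mul]

end QslnFun

namespace QslnFun

variable {q : ℝ} {N : ℕ} {D : UqslData q N} {P : QslnFun q N D} {r : ℕ}

lemma kap_eq_zpow (c i : ℕ) : ∃ n : ℤ, kap q c i = (q : ℂ) ^ n := by
  unfold kap
  split_ifs
  exacts [⟨1, by simp⟩, ⟨-1, by simp⟩, ⟨0, by simp⟩]

lemma kap'_eq_zpow (c i : ℕ) : ∃ n : ℤ, kap' q c i = (q : ℂ) ^ n := by
  unfold kap'
  split_ifs
  exacts [⟨-1, by simp⟩, ⟨1, by simp⟩, ⟨0, by simp⟩]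

section Torus

variable (hq : (q : ℂ) ≠ 0) (hr : r < N) {i j : ℕ} (hi1 : 1 ≤ i) (hi2 : i ≤ N) (hj1 : 1 ≤ j) (hj2 : j ≤ N)
include hq hr hi1 hi2 hj1 hj2

lemma hitR_Kv_grz (d : ℕ) {a : ℕ} (ha : 1 ≤ a) (hd : a + d < N) :
    ∃ n : ℤ, P.hitR (D.Kv d a) (P.grz r i j) = (q : ℂ) ^ n • P.grz r i j := by
  have h1 : ∀ a, 1 ≤ a → a < N → ∃ n : ℤ, P.hitR (D.Kg a) (P.grz r i j) = (q : ℂ) ^ n • P.grz r i j := by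
    intro a h1 h2
    obtain ⟨n, hn⟩ := kap'_eq_zpow (q := q) a i
    obtain ⟨m, hm⟩ := kap_eq_zpow (q := q) a j
    exact ⟨n + m, by rw [hitR_Kg_grz hr hi1 hi2 hj1 hj2 h1 h2, hn, hm, zpow_add₀ hq]⟩
  induction d generalizing a with
  | zero => exact h1 a ha (by omega)
  | succ d ih =>
    obtain ⟨n, hn⟩ := h1 a ha (by omega)
    obtain ⟨m, hm⟩ := ih (a := a + 1) (by omega) (by omega)
    exact ⟨m + n, by rw [UqslData.Kv, hitR_mul, hm, map_smul, hn, smul_smul, zpow_add₀ hq]⟩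

lemma hitR_Kiv_grz (d : ℕ) {a : ℕ} (ha : 1 ≤ a) (hd : a + d < N) :
    ∃ n : ℤ, P.hitR (D.Kiv d a) (P.grz r i j) = (q : ℂ) ^ n • P.grz r i j := by
  have h1 : ∀ a, 1 ≤ a → a < N → ∃ n : ℤ, P.hitR (D.Ki a) (P.grz r i j) = (q : ℂ) ^ n • P.grz r i j := by
    intro a h1 h2
    obtain ⟨n, hn⟩ := kap_eq_zpow (q := q) a i
    obtain ⟨m, hm⟩ := kap'_eq_zpow (q := q) a j
    exact ⟨n + m, by rw [hitR_Ki_grz hr hi1 hi2 hj1 hj2 h1 h2, hn, hm, zpow_add₀ hq]⟩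
  induction d generalizing a with
  | zero => exact h1 a ha (by omega)
  | succ d ih =>
    obtain ⟨n, hn⟩ := h1 a ha (by omega)
    obtain ⟨m, hm⟩ := ih (a := a + 1) (by omega) (by omega)
    exact ⟨m + n, by rw [UqslData.Kiv, hitR_mul, hm, map_smul, hn, smul_smul, zpow_add₀ hq]⟩

end Torus

lemma kap'_of_lt {c i : ℕ} (h : i < c) : kap' q c i = 1 := by
  unfold kap'
  rw [if_neg (by omega), if_neg (by omega)]

lemma kap'_self (c : ℕ) : kap' q c c = (q : ℂ)⁻¹ := by
  unfold kap'
  rw [if_pos rfl]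

lemma kap'_ne_zero (hq : (q : ℂ) ≠ 0) (c i : ℕ) : kap' q c i ≠ 0 := by
  intro h
  have := kap'_mul_kap hq c i
  rw [h, zero_mul] at this
  exact zero_ne_one this

section Right

variable (hr : r < N) {i j : ℕ} (hi1 : 1 ≤ i) (hi2 : i ≤ r) (hj1 : 1 ≤ j) (hj2 : j ≤ N)
include hr hi1 hi2 hj1 hj2

lemma hitR_Ev_grz_right (d : ℕ) {c : ℕ} (hc : r < c) (hd : c + d < N) :
    P.hitR (D.Ev d c) (P.grz r i j) = if j = c + d + 1 then P.grz r i c else 0 := by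
  have hE : ∀ c, r < c → c < N → ∀ j, 1 ≤ j → j ≤ N →
      P.hitR (D.E c) (P.grz r i j) = if j = c + 1 then P.grz r i c else 0 := by
    intro c h1 h2 j hj1 hj2
    rw [hitR_E_grz hr hi1 (by omega) hj1 hj2 (by omega) h2, if_neg (by omega), kap'_of_lt (by omega),
      one_smul, neg_zero, zero_add]
  induction d generalizing c j with
  | zero => exact hE c hc (by omega) j hj1 hj2
  | succ d ih =>
    have hj : j = c + 1 + d + 1 ↔ j = c + (d + 1) + 1 := by omega
    rw [UqslData.Ev, hitR_sub, hitR_smul, hitR_mul, hitR_mul, hE c hc (by omega) j hj1 hj2,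
      ih hj1 hj2 (by omega : r < c + 1) (by omega)]
    simp only [hj]
    have h1 : P.hitR (D.Ev d (c + 1)) (if j = c + 1 then P.grz r i c else 0) = 0 := by
      split_ifs
      · rw [ih (by omega) (by omega) (by omega) (by omega), if_neg (by omega)]
      · rw [map_zero]
    rw [h1, smul_zero, sub_zero]
    split_ifs
    · rw [hE c hc (by omega) _ (by omega) (by omega), if_pos rfl]
    · rw [map_zero]

lemma hitR_Fv_grz_right (hq : (q : ℂ) ≠ 0) (d : ℕ) {c : ℕ} (hc : r < c) (hd : c + d < N) :
    P.hitR (D.Fv d c) (P.grz r j i) = if j = c + d + 1 then -(q : ℂ) • P.grz r c i else 0 := by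
  have hF : ∀ c, r < c → c < N → ∀ j, 1 ≤ j → j ≤ N →
      P.hitR (D.F c) (P.grz r j i) = if j = c + 1 then -(q : ℂ) • P.grz r c i else 0 := by
    intro c h1 h2 j hj1 hj2
    rw [hitR_F_grz hr hj1 hj2 hi1 (by omega) (by omega) h2, kap'_of_lt (by omega), mul_one,
      if_neg (by omega : i ≠ c), add_zero]
    split_ifs
    · rw [neg_smul]
    · rw [neg_zero]
  induction d generalizing c j with
  | zero => exact hF c hc (by omega) j hj1 hj2
  | succ d ih =>
    have hj : j = c + 1 + d + 1 ↔ j = c + (d + 1) + 1 := by omega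
    rw [UqslData.Fv, hitR_sub, hitR_smul, hitR_mul, hitR_mul, hF c hc (by omega) j hj1 hj2,
      ih hj1 hj2 (by omega : r < c + 1) (by omega)]
    simp only [hj]
    have h1 : P.hitR (D.Fv d (c + 1)) (if j = c + 1 then -(q : ℂ) • P.grz r c i else 0) = 0 := by
      split_ifs
      · rw [map_smul, ih (by omega) (by omega) (by omega) (by omega), if_neg (by omega), smul_zero]
      · rw [map_zero]
    rw [h1, zero_sub]
    split_ifs
    · rw [map_smul, hF c hc (by omega) _ (by omega) (by omega), if_pos rfl, smul_smul, smul_smul,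
        ← neg_smul]
      congr 1
      field_simp
    · rw [map_zero, smul_zero, neg_zero]

end Right

lemma hitR_Ev_grz_left (hr : r < N) {j : ℕ} (hj1 : r < j) (hj2 : j ≤ N) (d : ℕ) {a : ℕ} (ha : 1 ≤ a)
    (hd : a + d < r) : ∃ s : ℂ, ∀ i, 1 ≤ i → i ≤ N →
      P.hitR (D.Ev d a) (P.grz r i j) = if i = a then s • P.grz r (a + d + 1) j else 0 := by
  have hE : ∀ a, 1 ≤ a → a < r → ∀ i, 1 ≤ i → i ≤ N →
      P.hitR (D.E a) (P.grz r i j) = if i = a then -(q : ℂ)⁻¹ • P.grz r (a + 1) j else 0 := by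
    intro a h1 h2 i hi1 hi2
    rw [hitR_E_grz hr hi1 hi2 (by omega) hj2 h1 (by omega), if_neg (by omega : j ≠ a + 1), add_zero]
    split_ifs with h
    · rw [h, kap'_self, neg_smul]
    · rw [neg_zero]
  induction d generalizing a with
  | zero => exact ⟨_, hE a ha hd⟩
  | succ d ih =>
    obtain ⟨s, hs⟩ := ih (a := a + 1) (by omega) (by omega)
    refine ⟨(q : ℂ)⁻¹ * (q : ℂ)⁻¹ * s, fun i hi1 hi2 => ?_⟩
    rw [UqslData.Ev, hitR_sub, hitR_smul, hitR_mul, hitR_mul, hE a ha (by omega) i hi1 hi2, hs i hi1 hi2]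
    have h1 : P.hitR (D.E a) (if i = a + 1 then s • P.grz r (a + 1 + d + 1) j else 0) = 0 := by
      split_ifs
      · rw [map_smul, hE a ha (by omega) _ (by omega) (by omega), if_neg (by omega), smul_zero]
      · rw [map_zero]
    rw [h1, zero_sub]
    split_ifs
    · rw [map_smul, hs _ (by omega) (by omega), if_pos rfl, smul_smul, smul_smul, ← neg_smul,
        show a + (d + 1) + 1 = a + 1 + d + 1 by ring]
      congr 1
      ring
    · rw [map_zero, smul_zero, neg_zero]

section Pairing

variable (hq : (q : ℂ) ≠ 0) (hr0 : 1 ≤ r) (hr : r < N) {i j : ℕ} (hi1 : 1 ≤ i) (hi2 : i ≤ r) (hj1 : r < j)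
  (hj2 : j ≤ N)
include hq hr0 hr hi1 hi2 hj1 hj2

lemma pair_E_grz : P.pair (D.E r) (P.grz r i j) ≠ 0 ↔ i = r ∧ j = r + 1 := by
  rw [← counit_hitR, hitR_E_grz hr hi1 (by omega) (by omega) hj2 hr0 hr, map_add, map_neg]
  have h1 : ε (if i = r then kap' q r i • P.grz r (r + 1) j else 0) = 0 := by
    split_ifs
    · rw [map_smul, counit_grz hr (by omega) (by omega) (by omega) hj2, if_neg (by omega), smul_zero]
    · rw [map_zero]
  rw [h1, neg_zero, zero_add]
  split_ifs with h
  · rw [map_smul, counit_grz hr (by omega) (by omega) (by omega) (by omega)]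
    split_ifs <;> simp [kap'_ne_zero hq] <;> omega
  · simp [h]

lemma pair_F_grz : P.pair (D.F r) (P.grz r j i) ≠ 0 ↔ i = r ∧ j = r + 1 := by
  rw [← counit_hitR, hitR_F_grz hr (by omega) (by omega) (by omega) (by omega) hr0 hr, map_add, map_neg]
  have h1 : ε (if i = r then P.grz r j (r + 1) else 0) = 0 := by
    split_ifs
    · rw [counit_grz hr (by omega) (by omega) (by omega) (by omega), if_neg (by omega)]
    · rw [map_zero]
  rw [h1, add_zero]
  split_ifs with h
  · rw [map_smul, counit_grz hr (by omega) (by omega) (by omega) (by omega)]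
    split_ifs <;> simp [kap'_ne_zero hq, hq] <;> omega
  · simp [h]

lemma pair_Ev_grz (d : ℕ) {a : ℕ} (ha : 1 ≤ a) (hd : a + d < N) (har : a ≤ r) (hdr : r ≤ a + d) :
    P.pair (D.Ev d a) (P.grz r i j) ≠ 0 ↔ i = a ∧ j = a + d + 1 := by
  have hz := fun i hi1 hi2 => grz_mem_Bmod (P := P) hr (i := i) (j := j) hi1 hi2 (by omega) hj2 hq
  induction d generalizing a i with
  | zero =>
    obtain rfl : a = r := by omega
    exact pair_E_grz hq hr0 hr hi1 hi2 hj1 hj2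
  | succ d ih =>
    rw [UqslData.Ev, map_sub, map_smul, LinearMap.sub_apply, LinearMap.smul_apply]
    rcases har.lt_or_eq with h | rfl
    · rw [pair_Ksub_mul (D.E_mem_Ksub ha (by omega) (by omega)) _ (hz i hi1 (by omega)),
        UqslData.counit_E' ha (by omega), zero_mul, zero_sub, ← P.pair_hitR,
        hitR_E_grz hr hi1 (by omega) (by omega) hj2 ha (by omega), if_neg (by omega : j ≠ a + 1), add_zero]
      have := ih (i := a + 1) (a := a + 1) (by omega) (by omega) (by omega) (by omega) (by omega) (by omega)
      split_ifs with hia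
      · simp only [map_neg, map_smul, smul_eq_mul, ne_eq, neg_eq_zero, mul_eq_zero, inv_eq_zero, hq,
          kap'_ne_zero hq, false_or]
        exact this.trans (by omega)
      · simp [hia]
    · rw [pair_Ksub_mul (Ev_mem_Ksub _ (by omega) (by omega) (by omega)) _ (hz i hi1 (by omega)),
        counit_Ev _ (by omega) (by omega), zero_mul, smul_zero, sub_zero, ← P.pair_hitR,
        hitR_Ev_grz_right hr hi1 hi2 (by omega) hj2 _ (by omega) (by omega)]
      split_ifs with hj
      · rw [pair_E_grz hq hr0 hr hi1 hi2 (by omega) (by omega)]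
        omega
      · simp; omega

lemma pair_Fv_grz (d : ℕ) {a : ℕ} (ha : 1 ≤ a) (hd : a + d < N) (har : a ≤ r) (hdr : r ≤ a + d) :
    P.pair (D.Fv d a) (P.grz r j i) ≠ 0 ↔ i = a ∧ j = a + d + 1 := by
  have hz := fun i hi1 hi2 => grz_mem_Bmod (P := P) hr (i := j) (j := i) (by omega) hj2 hi1 hi2 hq
  induction d generalizing a i with
  | zero =>
    obtain rfl : a = r := by omega
    exact pair_F_grz hq hr0 hr hi1 hi2 hj1 hj2
  | succ d ih =>
    rw [UqslData.Fv, map_sub, map_smul, LinearMap.sub_apply, LinearMap.smul_apply]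
    rcases har.lt_or_eq with h | rfl
    · rw [pair_Ksub_mul (D.F_mem_Ksub ha (by omega) (by omega)) _ (hz i hi1 (by omega)),
        UqslData.counit_F' ha (by omega), zero_mul, smul_zero, sub_zero, ← P.pair_hitR,
        hitR_F_grz hr (by omega) (by omega) hi1 (by omega) ha (by omega), if_neg (by omega : j ≠ a + 1),
        neg_zero, zero_add]
      have := ih (i := a + 1) (a := a + 1) (by omega) (by omega) (by omega) (by omega) (by omega) (by omega)
      split_ifs with hia
      · exact this.trans (by omega)
      · simp [hia]
    · rw [pair_Ksub_mul (Fv_mem_Ksub _ (by omega) (by omega) (by omega)) _ (hz i hi1 (by omega)),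
        counit_Fv _ (by omega) (by omega), zero_mul, zero_sub, ← P.pair_hitR,
        hitR_Fv_grz_right hr hi1 hi2 (by omega) hj2 hq _ (by omega) (by omega)]
      split_ifs with hj
      · have := pair_F_grz (P := P) hq hr0 hr hi1 hi2 (by omega : a < a + 1) (by omega)
        simp only [map_smul, smul_eq_mul, ne_eq, neg_eq_zero, mul_eq_zero, inv_eq_zero, hq, false_or]
        rw [← ne_eq, this]
        omega
      · simp; omega

end Pairing

end QslnFun

namespace QslnFun

variable {q : ℝ} {N : ℕ} {D : UqslData q N} (P : QslnFun q N D) (r : ℕ)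
  (μ : P.A →ₗ[ℂ] P.A →ₗ[ℂ] P.A) (W : Submodule ℂ P.A) (z : P.A)

/-- `u` lowers the filtration by at most `n` and kills `μ W` in filtration degree at least `n`. -/
def Kills (n : ℕ) (u : D.U) : Prop :=
  u ∈ P.low r n ∧ ∀ m, n ≤ m + 1 → ∀ w ∈ W, ∀ a ∈ P.fil r m, P.pair u (μ w a) = 0

/-- The elements of `μ W` of filtration degree at least `m`, up to higher order terms. -/
def nearW (m : ℕ) : Submodule ℂ P.A :=
  Submodule.map₂ μ W (P.fil r (m - 1)) ⊔ P.fil r (m + 1)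

/-- `X` lowers the filtration by at most one and preserves `μ W` up to higher order terms. -/
def Good (X : D.U) : Prop :=
  X ∈ P.low r 1 ∧ ∀ m, ∀ w ∈ W, ∀ a ∈ P.fil r m, P.hitR X (μ w a) ∈ P.nearW r μ W m

/-- `X` commutes with `μ z` up to the scalars `κ`, `e`, elements of `μ W` and higher order terms. -/
def Act (κ e : ℂ) (X : D.U) : Prop :=
  ∀ m, ∀ a ∈ P.fil r m, P.hitR X (μ z a) - κ • μ z (P.hitR X a) - e • a ∈ P.nearW r μ W m

/-- `⟨v, μ z a⟩ = C ⟨v', a⟩` in filtration degree at least `n`. -/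
def Peel (n : ℕ) (v v' : D.U) (C : ℂ) : Prop :=
  P.Kills r μ W n v ∧ ∀ m, n ≤ m + 1 → ∀ a ∈ P.fil r m, P.pair v (μ z a) = C * P.pair v' a

variable {P r μ W z} {n : ℕ} {u v v' X : D.U} {κ e C : ℂ}

lemma Kills.pair_eq_zero (h : P.Kills r μ W n u) {m : ℕ} (hm : n ≤ m) {a : P.A}
    (ha : a ∈ P.nearW r μ W m) : P.pair u a = 0 := by
  have : P.nearW r μ W m ≤ LinearMap.ker (P.pair u) := by
    refine sup_le (Submodule.map₂_le.2 fun w hw a ha => h.2 _ (by omega) w hw a ha) fun a ha => ?_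
    exact pair_low h.1 ha (by omega)
  exact this ha

lemma kills_one (h : ∀ w ∈ W, ∀ a, ε (μ w a) = 0) : P.Kills r μ W 0 1 :=
  ⟨one_mem_low, fun m _ w hw a _ => by rw [P.pair_oneU, h w hw]⟩

lemma Kills.mono {W' : Submodule ℂ P.A} (h : P.Kills r μ W n u) (hW : W' ≤ W) : P.Kills r μ W' n u :=
  ⟨h.1, fun m hm w hw => h.2 m hm w (hW hw)⟩

lemma Kills.mul (h : P.Kills r μ W n u) (hX : P.Good r μ W X) : P.Kills r μ W (n + 1) (u * X) :=
  ⟨mul_mem_low h.1 hX.1, fun m hm w hw a ha => by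
    rw [← pair_hitR]
    exact h.pair_eq_zero (by omega) (hX.2 m w hw a ha)⟩

lemma Kills.pow (h : P.Kills r μ W n u) (hX : P.Good r μ W X) (p : ℕ) :
    P.Kills r μ W (n + p) (u * X ^ p) := by
  induction p with
  | zero => simpa using h
  | succ p ih => rw [pow_succ, ← mul_assoc, ← add_assoc]; exact ih.mul hX

lemma Kills.list_prod {τ : Type*} (h : P.Kills r μ W n u) (X : τ → D.U) (m : τ → ℕ) (l : List τ)
    (hX : ∀ p ∈ l, m p ≠ 0 → P.Good r μ W (X p)) :
    P.Kills r μ W (n + (l.map m).sum) (u * (l.map fun p => X p ^ m p).prod) := by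
  induction l generalizing n u with
  | nil => simpa using h
  | cons p l ih =>
    rw [List.map_cons, List.map_cons, List.sum_cons, List.prod_cons, ← mul_assoc, ← add_assoc]
    refine ih ?_ fun p hp => hX p (List.mem_cons_of_mem _ hp)
    by_cases h0 : m p = 0
    · rw [h0]; simpa using h
    · exact h.pow (hX p List.mem_cons_self h0) _

lemma Act.pair_mul (hX : P.Act r μ W z κ e X) (h : P.Kills r μ W n u) {m : ℕ} (hm : n ≤ m) {a : P.A}
    (ha : a ∈ P.fil r m) :
    P.pair (u * X) (μ z a) = κ * P.pair u (μ z (P.hitR X a)) + e * P.pair u a := by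
  have := h.pair_eq_zero hm (hX m a ha)
  rw [map_sub, map_sub, map_smul, map_smul, pair_hitR, smul_eq_mul, smul_eq_mul] at this
  linear_combination this

lemma Peel.mul (h : P.Peel r μ W z n v v' C) (hX : P.Good r μ W X) (hA : P.Act r μ W z κ 0 X) :
    P.Peel r μ W z (n + 1) (v * X) (v' * X) (κ * C) := by
  refine ⟨h.1.mul hX, fun m hm a ha => ?_⟩
  rw [hA.pair_mul h.1 (by omega) ha, h.2 (m - 1) (by omega) _ (hX.1 m a ha), pair_hitR]
  ring

lemma Peel.pow (h : P.Peel r μ W z n v v' C) (hX : P.Good r μ W X) (hA : P.Act r μ W z κ 0 X) (p : ℕ) :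
    P.Peel r μ W z (n + p) (v * X ^ p) (v' * X ^ p) (κ ^ p * C) := by
  induction p with
  | zero => simpa using h
  | succ p ih =>
    have := ih.mul hX hA
    rwa [mul_assoc, mul_assoc, ← pow_succ, ← mul_assoc, ← pow_succ', add_assoc] at this

lemma Peel.main (h : P.Peel r μ W z n v v' 0) (hX : P.Good r μ W X) (hA : P.Act r μ W z κ e X) (p : ℕ) :
    P.Peel r μ W z (n + (p + 1)) (v * X ^ (p + 1)) (v * X ^ p)
      (e * ∑ s ∈ Finset.range (p + 1), κ ^ s) := by
  refine ⟨h.1.pow hX _, ?_⟩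
  induction p with
  | zero =>
    intro m hm a ha
    rw [zero_add, pow_one, hA.pair_mul h.1 (by omega) ha, h.2 (m - 1) (by omega) _ (hX.1 m a ha)]
    simp
  | succ p ih =>
    intro m hm a ha
    rw [pow_succ X (p + 1), ← mul_assoc, hA.pair_mul (h.1.pow hX (p + 1)) (by omega) ha,
      ih (m - 1) (by omega) _ (hX.1 m a ha), pair_hitR, mul_assoc v, ← pow_succ, geom_sum_succ (n := p + 1)]
    ring

lemma Peel.list_prod {τ : Type*} [DecidableEq τ] (h : P.Peel r μ W z n v v 0) (X : τ → D.U) (m : τ → ℕ)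
    (κ : τ → ℂ) (β : τ) (hκ : ∀ p, κ p ≠ 0) (hs : ∀ p, ∑ s ∈ Finset.range (p + 1), κ β ^ s ≠ 0)
    (he : e ≠ 0) (l : List τ) (hl : l.Nodup) (hX : ∀ p ∈ l, m p ≠ 0 → P.Good r μ W (X p))
    (hA : ∀ p ∈ l, m p ≠ 0 → P.Act r μ W z (κ p) (if p = β then e else 0) (X p)) :
    ∃ C : ℂ, (C ≠ 0 ↔ β ∈ l ∧ m β ≠ 0) ∧ P.Peel r μ W z (n + (l.map m).sum)
      (v * (l.map fun p => X p ^ m p).prod)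
      (v * (l.map fun p => X p ^ (m p - if p = β then 1 else 0)).prod) C := by
  induction l using List.reverseRecOn with
  | nil => exact ⟨0, by simp, by simpa using h⟩
  | append_singleton l p ih =>
    obtain ⟨C, hC, hP⟩ := ih (List.Nodup.of_append_left hl) (fun p hp => hX p (by simp [hp]))
      (fun p hp => hA p (by simp [hp]))
    have hpl : p ∉ l := fun hp => (List.nodup_append.1 hl).2.2 p hp p (by simp) rfl
    simp only [List.map_append, List.map_cons, List.map_nil, List.sum_append, List.sum_cons, List.sum_nil,
      add_zero, List.prod_append, List.prod_cons, List.prod_nil, mul_one, ← mul_assoc, ← add_assoc,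
      List.mem_append, List.mem_singleton]
    by_cases h0 : m p = 0
    · refine ⟨C, ?_, by simpa [h0] using hP⟩
      rw [hC]
      refine ⟨fun h => ⟨.inl h.1, h.2⟩, ?_⟩
      rintro ⟨h1 | rfl, h2⟩
      exacts [⟨h1, h2⟩, absurd h0 h2]
    have hXp := hX p (by simp) h0
    have hAp := hA p (by simp) h0
    by_cases hp : p = β
    · subst hp
      obtain rfl : C = 0 := by
        by_contra h1
        exact hpl (hC.1 h1).1
      have hsame : (l.map fun p' => X p' ^ (m p' - if p' = p then 1 else 0)) = l.map fun p' => X p' ^ m p' :=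
        List.map_congr_left fun p' hp' => by
          have hne : p' ≠ p := by rintro rfl; exact hpl hp'
          rw [if_neg hne, Nat.sub_zero]
      rw [if_pos rfl] at hAp
      obtain ⟨t, ht⟩ := Nat.exists_eq_succ_of_ne_zero h0
      refine ⟨e * ∑ s ∈ Finset.range (t + 1), κ p ^ s, ?_, ?_⟩
      · exact iff_of_true (mul_ne_zero he (hs t)) ⟨.inr rfl, h0⟩
      · have := hP.main hXp hAp t
        rwa [hsame, if_pos rfl, ht, Nat.succ_sub_one]
    · rw [if_neg hp] at hAp
      refine ⟨κ p ^ m p * C, ?_, ?_⟩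
      · rw [mul_ne_zero_iff, hC]
        have : β ≠ p := Ne.symm hp
        simp [this, hκ p]
      · rw [if_neg hp, Nat.sub_zero]
        exact hP.pow hXp hAp _

end QslnFun

lemma geom_sum_zpow_ne_zero {q : ℝ} (hq : Transcendental ℚ q) (n : ℤ) (p : ℕ) :
    ∑ s ∈ Finset.range (p + 1), ((q : ℂ) ^ n) ^ s ≠ 0 := by
  intro h
  have h0 : ∑ s ∈ Finset.range (p + 1), (q ^ n) ^ s = 0 := by exact_mod_cast h
  have h1 : q ^ n = -1 := by
    have h2 := geom_sum_mul (q ^ n) (p + 1)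
    rw [h0, zero_mul, eq_comm, sub_eq_zero] at h2
    rcases (pow_eq_one_iff_cases).1 h2 with h3 | h3 | h3
    · omega
    · rw [h3] at h0
      simp only [one_pow, Finset.sum_const, Finset.card_range, nsmul_eq_mul, mul_one] at h0
      exact absurd h0 (Nat.cast_ne_zero.2 p.succ_ne_zero)
    · exact h3.1
  have h2 : (q ^ 2) ^ n = 1 := by
    rw [← zpow_natCast, ← zpow_mul, mul_comm, zpow_mul, h1]
    norm_num
  have hn : n ≠ 0 := by
    rintro rfl
    norm_num at h1
  by_cases h3 : q ^ 2 = 1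
  · refine hq ⟨Polynomial.X ^ 2 - 1, (Polynomial.monic_X_pow_sub_C 1 two_ne_zero).ne_zero, ?_⟩
    simp [h3]
  · exact hn ((zpow_eq_one_iff_right₀ (sq_nonneg q) h3).1 h2)

namespace QslnFun

variable {q : ℝ} {N : ℕ} {D : UqslData q N} (P : QslnFun q N D) (r : ℕ)

/-- The span of the entries `z_{i'j}` with `i < i' ≤ r`. -/
def rowW (i j : ℕ) : Submodule ℂ P.A :=
  Submodule.span ℂ {x | ∃ i', i < i' ∧ i' ≤ r ∧ x = P.grz r i' j}

/-- The span of the entries `z_{j'i}` with `r < j' < j`. -/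
def colW (j i : ℕ) : Submodule ℂ P.A :=
  Submodule.span ℂ {x | ∃ j', r < j' ∧ j' < j ∧ x = P.grz r j' i}

/-- The span of the upper right block of the matrix `z`. -/
def blockW : Submodule ℂ P.A :=
  Submodule.span ℂ {x | ∃ i j, 1 ≤ i ∧ i ≤ r ∧ r < j ∧ j ≤ N ∧ x = P.grz r i j}

variable {P r} {i j d a : ℕ}

lemma rowW_le_blockW (hi : 1 ≤ i) (hj1 : r < j) (hj2 : j ≤ N) : P.rowW r i j ≤ P.blockW r := by
  refine Submodule.span_mono ?_
  rintro _ ⟨i', h1, h2, rfl⟩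
  exact ⟨i', j, by omega, h2, hj1, hj2, rfl⟩

lemma map_mem_nearW {μ : P.A →ₗ[ℂ] P.A →ₗ[ℂ] P.A} {W : Submodule ℂ P.A} {m : ℕ} {w y : P.A}
    (hw : w ∈ W) (hy : y ∈ P.fil r (m - 1)) : μ w y ∈ P.nearW r μ W m :=
  Submodule.mem_sup_left (Submodule.apply_mem_map₂ _ hw hy)

lemma mul_mem_nearW {μ : P.A →ₗ[ℂ] P.A →ₗ[ℂ] P.A} {W : Submodule ℂ P.A} {m k l : ℕ} {x y : P.A}
    (hx : x ∈ P.fil r k) (hy : y ∈ P.fil r l) (h : m + 1 ≤ k + l) : x * y ∈ P.nearW r μ W m :=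
  Submodule.mem_sup_right (mul_mem_fil hx hy h)

lemma hitR_mem_fil_pred {x : D.U} {n : ℕ} (hx : x ∈ P.low r n) (hn : n ≤ 1) {m : ℕ} {y : P.A}
    (hy : y ∈ P.fil r m) : P.hitR x y ∈ P.fil r (m - 1) :=
  low_mono hn hx m y hy

lemma hitR_sub_pair_mem {x : D.U} {v : P.A} (hv : v ∈ P.Bmod r) :
    P.hitR x v - P.pair x v • 1 ∈ P.fil r 1 := by
  rw [fil_one, ← counit_hitR]
  exact sub_mem_Bplus (hitR_mem_Bmod x hv)

lemma Ev_mem_low_one (ha : 1 ≤ a) (hd : a + d < N) : D.Ev d a ∈ P.low r 1 :=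
  low_mono (by split_ifs <;> omega) (Ev_mem_low d ha hd)

lemma Fv_mem_low_one (ha : 1 ≤ a) (hd : a + d < N) : D.Fv d a ∈ P.low r 1 :=
  low_mono (by split_ifs <;> omega) (Fv_mem_low d ha hd)

section Letters

variable (hq : (q : ℂ) ≠ 0) (hr0 : 1 ≤ r) (hr : r < N) (hi1 : 1 ≤ i) (hi2 : i ≤ r) (hj1 : r < j)
  (hj2 : j ≤ N) (ha : 1 ≤ a) (hd : a + d < N) (har : a ≤ r) (hdr : r ≤ a + d)
include hq hr0 hr hi1 hi2 hj1 hj2 ha hd har hdr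

lemma act_Ev {i' : ℕ} (hi' : i ≤ i') (hi'r : i' ≤ r) (h : a + (a + d) < i + j) :
    ∃ n : ℤ, P.Act r (LinearMap.mul ℂ P.A) (P.rowW r i j) (P.grz r i' j) ((q : ℂ) ^ n)
      (P.pair (D.Ev d a) (P.grz r i' j)) (D.Ev d a) := by
  have hi'1 : 1 ≤ i' := by omega
  have hz : P.grz r i' j ∈ P.Bmod r := grz_mem_Bmod hr hi'1 (by omega) (by omega) hj2 hq
  obtain ⟨n, hn⟩ := hitR_Kv_grz (P := P) hq hr hi'1 (by omega) (by omega) hj2 d ha hd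
  refine ⟨n, fun m y hy => ?_⟩
  have hs : ∀ t ∈ Finset.range d, P.hitR (D.Ev t a) (P.hitR (D.Kv (d - 1 - t) (a + t + 1)) (P.grz r i' j)) *
      P.hitR (D.Ev (d - 1 - t) (a + t + 1)) y ∈ P.nearW r (LinearMap.mul ℂ P.A) (P.rowW r i j) m := by
    intro t ht
    rw [Finset.mem_range] at ht
    obtain ⟨n', hn'⟩ := hitR_Kv_grz (P := P) hq hr hi'1 (by omega) (by omega) hj2 (d - 1 - t)
      (a := a + t + 1) (by omega) (by omega)
    rw [hn', map_smul, smul_mul_assoc]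
    refine Submodule.smul_mem _ _ ?_
    by_cases hat : a + t < r
    · obtain ⟨s, hs⟩ := hitR_Ev_grz_left (P := P) hr hj1 hj2 t ha hat
      rw [hs i' hi'1 (by omega)]
      refine map_mem_nearW (μ := LinearMap.mul ℂ P.A) ?_
        (hitR_mem_fil_pred (Ev_mem_low_one (by omega) (by omega)) le_rfl hy)
      split_ifs
      · exact Submodule.smul_mem _ _ (Submodule.subset_span ⟨_, by omega, by omega, rfl⟩)
      · exact zero_mem _
    · have h0 : P.pair (D.Ev t a) (P.grz r i' j) = 0 := by
        by_contra h0
        have := (pair_Ev_grz hq hr0 hr hi'1 hi'r hj1 hj2 t ha (by omega) har (by omega)).1 h0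
        omega
      have h1 := Ev_mem_low (P := P) (r := r) (d - 1 - t) (a := a + t + 1) (by omega) (by omega)
      rw [if_neg (by omega)] at h1
      exact mul_mem_nearW (hitR_mem_fil_one hz h0) (h1 m y hy) (by omega)
  have hmain : P.hitR (D.Ev d a) (P.grz r i' j * y) -
      (q : ℂ) ^ n • (P.grz r i' j * P.hitR (D.Ev d a) y) - P.pair (D.Ev d a) (P.grz r i' j) • y =
      (P.hitR (D.Ev d a) (P.grz r i' j) - P.pair (D.Ev d a) (P.grz r i' j) • 1) * y +
      (1 - (q : ℂ)⁻¹ * (q : ℂ)⁻¹) • ∑ t ∈ Finset.range d,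
        P.hitR (D.Ev t a) (P.hitR (D.Kv (d - 1 - t) (a + t + 1)) (P.grz r i' j)) *
          P.hitR (D.Ev (d - 1 - t) (a + t + 1)) y := by
    rw [P.hitR_Ev_mul ha hd, hn, sub_mul, smul_mul_assoc, smul_mul_assoc, one_mul]
    abel
  rw [LinearMap.mul_apply', LinearMap.mul_apply', hmain]
  exact add_mem (mul_mem_nearW (hitR_sub_pair_mem hz) hy (by omega))
    (Submodule.smul_mem _ _ (sum_mem hs))

lemma good_Ev (h : a + (a + d) < i + j) : P.Good r (LinearMap.mul ℂ P.A) (P.rowW r i j) (D.Ev d a) := by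
  refine ⟨Ev_mem_low_one ha hd, fun m w hw y hy => ?_⟩
  induction hw using Submodule.span_induction with
  | mem w hw =>
    obtain ⟨i', h1, h2, rfl⟩ := hw
    obtain ⟨n, hn⟩ := act_Ev (P := P) hq hr0 hr hi1 hi2 hj1 hj2 ha hd har hdr h1.le h2 h
    have h0 : P.pair (D.Ev d a) (P.grz r i' j) = 0 := by
      by_contra h0
      have := (pair_Ev_grz hq hr0 hr (by omega) h2 hj1 hj2 d ha hd har hdr).1 h0
      omega
    have := hn m y hy
    rw [h0, zero_smul, sub_zero] at this
    refine (Submodule.sub_mem_iff_left _ (Submodule.smul_mem _ _ ?_)).1 this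
    exact map_mem_nearW (Submodule.subset_span ⟨i', h1, h2, rfl⟩) (Ev_mem_low_one ha hd m y hy)
  | zero => simp
  | add w w' _ _ hw hw' => rw [map_add, LinearMap.add_apply, map_add]; exact add_mem hw hw'
  | smul c w _ hw => rw [map_smul, LinearMap.smul_apply, map_smul]; exact Submodule.smul_mem _ _ hw

lemma act_Fv {j' : ℕ} (hj' : j' ≤ j) (hj'r : r < j') (h : i + j ≤ a + (a + d) + 1) :
    ∃ n : ℤ, P.Act r (LinearMap.mul ℂ P.A).flip (P.colW r j i) (P.grz r j' i) ((q : ℂ) ^ n)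
      (P.pair (D.Fv d a) (P.grz r j' i)) (D.Fv d a) := by
  have hj'1 : j' ≤ N := by omega
  have hz : P.grz r j' i ∈ P.Bmod r := grz_mem_Bmod hr (by omega) hj'1 hi1 (by omega) hq
  obtain ⟨n, hn⟩ := hitR_Kiv_grz (P := P) hq hr (i := j') (j := i) (by omega) hj'1 hi1 (by omega) d ha hd
  refine ⟨n, fun m y hy => ?_⟩
  have hs : ∀ t ∈ Finset.range d, P.hitR (D.Fv t a) y *
      P.hitR (D.Kiv t a) (P.hitR (D.Fv (d - 1 - t) (a + t + 1)) (P.grz r j' i)) ∈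
        P.nearW r (LinearMap.mul ℂ P.A).flip (P.colW r j i) m := by
    intro t ht
    rw [Finset.mem_range] at ht
    by_cases hat : a + t < r
    · have h0 : P.pair (D.Fv (d - 1 - t) (a + t + 1)) (P.grz r j' i) = 0 := by
        by_contra h0
        have := (pair_Fv_grz hq hr0 hr hi1 hi2 hj'r hj'1 (d - 1 - t) (a := a + t + 1) (by omega) (by omega)
          (by omega) (by omega)).1 h0
        omega
      have h1 := Fv_mem_low (P := P) (r := r) t ha (by omega)
      rw [if_neg (by omega)] at h1
      refine mul_mem_nearW (h1 m y hy) (l := 1) ?_ (by omega)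
      rw [← hitR_mul]
      refine hitR_mem_fil_one hz ?_
      rw [pair_Ksub_mul (Kiv_mem_Ksub t ha (by omega)) _ hz, h0, mul_zero]
    · rw [hitR_Fv_grz_right hr hi1 hi2 (by omega) hj'1 hq _ (by omega) (by omega)]
      refine map_mem_nearW (μ := (LinearMap.mul ℂ P.A).flip) ?_
        (hitR_mem_fil_pred (Fv_mem_low_one (by omega) (by omega)) le_rfl hy)
      split_ifs
      · obtain ⟨n', hn'⟩ := hitR_Kiv_grz (P := P) hq hr (i := a + t + 1) (j := i) (by omega) (by omega) hi1
          (by omega) t ha (by omega)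
        rw [map_smul, hn']
        exact Submodule.smul_mem _ _ (Submodule.smul_mem _ _
          (Submodule.subset_span ⟨_, by omega, by omega, rfl⟩))
      · rw [map_zero]; exact zero_mem _
  have hmain : P.hitR (D.Fv d a) (y * P.grz r j' i) -
      (q : ℂ) ^ n • (P.hitR (D.Fv d a) y * P.grz r j' i) - P.pair (D.Fv d a) (P.grz r j' i) • y =
      y * (P.hitR (D.Fv d a) (P.grz r j' i) - P.pair (D.Fv d a) (P.grz r j' i) • 1) +
      ((q : ℂ) - (q : ℂ)⁻¹) • ∑ t ∈ Finset.range d, P.hitR (D.Fv t a) y *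
        P.hitR (D.Kiv t a) (P.hitR (D.Fv (d - 1 - t) (a + t + 1)) (P.grz r j' i)) := by
    rw [P.hitR_Fv_mul hq ha hd, hn, mul_sub, mul_smul_comm, mul_smul_comm, mul_one]
    abel
  rw [LinearMap.flip_apply, LinearMap.flip_apply, LinearMap.mul_apply', LinearMap.mul_apply', hmain]
  exact add_mem (mul_mem_nearW hy (hitR_sub_pair_mem hz) (by omega))
    (Submodule.smul_mem _ _ (sum_mem hs))

lemma good_Fv (h : i + j ≤ a + (a + d) + 1) :
    P.Good r (LinearMap.mul ℂ P.A).flip (P.colW r j i) (D.Fv d a) := by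
  refine ⟨Fv_mem_low_one ha hd, fun m w hw y hy => ?_⟩
  induction hw using Submodule.span_induction with
  | mem w hw =>
    obtain ⟨j', h1, h2, rfl⟩ := hw
    obtain ⟨n, hn⟩ := act_Fv (P := P) hq hr0 hr hi1 hi2 hj1 hj2 ha hd har hdr h2.le h1 h
    have h0 : P.pair (D.Fv d a) (P.grz r j' i) = 0 := by
      by_contra h0
      have := (pair_Fv_grz hq hr0 hr hi1 hi2 h1 (by omega) d ha hd har hdr).1 h0
      omega
    have := hn m y hy
    rw [h0, zero_smul, sub_zero] at this
    refine (Submodule.sub_mem_iff_left _ (Submodule.smul_mem _ _ ?_)).1 this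
    exact map_mem_nearW (Submodule.subset_span ⟨j', h1, h2, rfl⟩) (Fv_mem_low_one ha hd m y hy)
  | zero => simp
  | add w w' _ _ hw hw' => rw [map_add, LinearMap.add_apply, map_add]; exact add_mem hw hw'
  | smul c w _ hw => rw [map_smul, LinearMap.smul_apply, map_smul]; exact Submodule.smul_mem _ _ hw

end Letters

lemma hitR_F_blockW (hr : r < N) {c : ℕ} (h1 : 1 ≤ c) (h2 : c < N) {w : P.A} (hw : w ∈ P.blockW r) :
    P.hitR (D.F c) w ∈ P.blockW r := by
  have : P.blockW r ≤ (P.blockW r).comap (P.hitR (D.F c)) := by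
    refine Submodule.span_le.2 ?_
    rintro _ ⟨i, j, hi1, hi2, hj1, hj2, rfl⟩
    change P.hitR (D.F c) _ ∈ P.blockW r
    rw [hitR_F_grz hr hi1 (by omega) (by omega) hj2 h1 h2]
    refine add_mem (neg_mem ?_) ?_
    · split_ifs
      · exact Submodule.smul_mem _ _ (Submodule.subset_span ⟨c, j, h1, by omega, hj1, hj2, rfl⟩)
      · exact zero_mem _
    · split_ifs
      · exact Submodule.subset_span ⟨i, c + 1, hi1, hi2, by omega, by omega, rfl⟩
      · exact zero_mem _
  exact this hw

lemma hitR_Fv_blockW (hr : r < N) (d : ℕ) {a : ℕ} (ha : 1 ≤ a) (hd : a + d < N) {w : P.A}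
    (hw : w ∈ P.blockW r) : P.hitR (D.Fv d a) w ∈ P.blockW r := by
  induction d generalizing a w with
  | zero => exact hitR_F_blockW hr ha (by omega) hw
  | succ d ih =>
    rw [UqslData.Fv, hitR_sub, hitR_smul, hitR_mul, hitR_mul]
    exact sub_mem (ih (by omega) (by omega) (hitR_F_blockW hr ha (by omega) hw))
      (Submodule.smul_mem _ _ (hitR_F_blockW hr ha (by omega) (ih (by omega) (by omega) hw)))

lemma good_Fv_blockW (hq : (q : ℂ) ≠ 0) (hr : r < N) (ha : 1 ≤ a) (hd : a + d < N) :
    P.Good r (LinearMap.mul ℂ P.A) (P.blockW r) (D.Fv d a) := by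
  refine ⟨Fv_mem_low_one ha hd, fun m w hw y hy => ?_⟩
  rw [LinearMap.mul_apply', P.hitR_Fv_mul hq ha hd]
  have key : ∀ {v x : P.A}, v ∈ P.blockW r → x ∈ P.fil r (m - 1) →
      v * x ∈ P.nearW r (LinearMap.mul ℂ P.A) (P.blockW r) m :=
    fun hv hx => map_mem_nearW (μ := LinearMap.mul ℂ P.A) hv hx
  refine add_mem (add_mem ?_ ?_) (Submodule.smul_mem _ _ (sum_mem fun t ht => ?_))
  · exact key (hitR_Fv_blockW hr d ha hd hw) (hitR_mem_fil_pred (Kiv_mem_low d ha hd) zero_le_one hy)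
  · exact key hw (Fv_mem_low_one ha hd m y hy)
  · rw [Finset.mem_range] at ht
    exact key (hitR_Fv_blockW hr t ha (by omega) hw) (Kiv_mem_low t ha (by omega) (m - 1) _
      (Fv_mem_low_one (by omega) (by omega) m y hy))

lemma counit_blockW (hr : r < N) {w : P.A} (hw : w ∈ P.blockW r) : ε w = 0 := by
  have : P.blockW r ≤ LinearMap.ker (ε : P.A →ₗ[ℂ] ℂ) := by
    refine Submodule.span_le.2 ?_
    rintro _ ⟨i, j, hi1, hi2, hj1, hj2, rfl⟩
    change ε _ = 0
    rw [counit_grz hr hi1 (by omega) (by omega) hj2, if_neg (by omega)]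
  exact this hw

lemma counit_colW (hr : r < N) (hi1 : 1 ≤ i) (hi2 : i ≤ r) (hj2 : j ≤ N) {w : P.A}
    (hw : w ∈ P.colW r j i) : ε w = 0 := by
  have : P.colW r j i ≤ LinearMap.ker (ε : P.A →ₗ[ℂ] ℂ) := by
    refine Submodule.span_le.2 ?_
    rintro _ ⟨j', h1, h2, rfl⟩
    change ε _ = 0
    rw [counit_grz hr (by omega) (by omega) hi1 (by omega), if_neg (by omega)]
  exact this hw

end QslnFun

/-- The monomial `∏ F_β ^ n_β ∏ E_β ^ m_β`. -/
def UqslData.mon {q : ℝ} {N : ℕ} (D : UqslData q N) (lF lE : List (ℕ × ℕ)) (n m : ℕ × ℕ → ℕ) : D.U :=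
  (lF.map fun p => D.Fv (p.2 - p.1) p.1 ^ n p).prod * (lE.map fun p => D.Ev (p.2 - p.1) p.1 ^ m p).prod

namespace QslnFun

variable {q : ℝ} {N : ℕ} {D : UqslData q N} {P : QslnFun q N D} {r : ℕ}

section Monomials

variable (hq : Transcendental ℚ q) (hr0 : 1 ≤ r) (hr : r < N) {lF lE : List (ℕ × ℕ)}
  (hlF : ∀ p ∈ lF, inPhiR N r p) (hlE : ∀ p ∈ lE, inPhiR N r p) (n m : ℕ × ℕ → ℕ)

include hr hlF in
lemma kills_F {z : P.A} (hz : z ∈ P.blockW r) (hq : Transcendental ℚ q) (i j : ℕ)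
    (hW : P.rowW r i j ≤ P.blockW r) :
    P.Peel r (LinearMap.mul ℂ P.A) (P.rowW r i j) z (0 + (lF.map n).sum)
      (1 * (lF.map fun p => D.Fv (p.2 - p.1) p.1 ^ n p).prod)
      (1 * (lF.map fun p => D.Fv (p.2 - p.1) p.1 ^ n p).prod) 0 := by
  have h1 : P.Kills r (LinearMap.mul ℂ P.A) (P.blockW r) 0 1 := kills_one fun w hw a => by
    rw [LinearMap.mul_apply', Bialgebra.counit_mul, counit_blockW hr hw, zero_mul]
  have h2 := h1.list_prod (fun p => D.Fv (p.2 - p.1) p.1) n lF fun p hp _ => by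
    obtain ⟨h1, h2, h3, h4⟩ := hlF p hp
    exact good_Fv_blockW (ofReal_ne_zero_of_transcendental hq) hr h1 (by omega)
  exact ⟨h2.mono hW, fun M hM a ha => by rw [h2.2 M hM z hz a ha, zero_mul]⟩

include hq hr0 hr hlF hlE

lemma peel_E {β : ℕ × ℕ} (hβ : inPhiR N r β) (hnd : lE.Nodup)
    (hm : ∀ p ∈ lE, m p ≠ 0 → p.1 + p.2 ≤ β.1 + β.2) :
    ∃ C : ℂ, (C ≠ 0 ↔ β ∈ lE ∧ m β ≠ 0) ∧ ∀ M, (lF.map n).sum + (lE.map m).sum ≤ M + 1 →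
      ∀ a ∈ P.fil r M, P.pair (D.mon lF lE n m) (P.grz r β.1 (β.2 + 1) * a) =
        C * P.pair (D.mon lF lE n fun p => m p - if p = β then 1 else 0) a := by
  obtain ⟨hβ1, hβ2, hβ3, hβ4⟩ := hβ
  have hq0 := ofReal_ne_zero_of_transcendental hq
  have hz : P.grz r β.1 (β.2 + 1) ∈ P.blockW r :=
    Submodule.subset_span ⟨_, _, hβ1, hβ2, by omega, by omega, rfl⟩
  have hP := kills_F hr hlF n hz hq β.1 (β.2 + 1) (rowW_le_blockW hβ1 (by omega) (by omega))
  have hact : ∀ p, ∃ k : ℤ, inPhiR N r p → p.1 + p.2 ≤ β.1 + β.2 →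
      P.Act r (LinearMap.mul ℂ P.A) (P.rowW r β.1 (β.2 + 1)) (P.grz r β.1 (β.2 + 1)) ((q : ℂ) ^ k)
        (P.pair (D.Ev (p.2 - p.1) p.1) (P.grz r β.1 (β.2 + 1))) (D.Ev (p.2 - p.1) p.1) := by
    intro p
    by_cases h : inPhiR N r p ∧ p.1 + p.2 ≤ β.1 + β.2
    · obtain ⟨⟨h1, h2, h3, h4⟩, h5⟩ := h
      obtain ⟨k, hk⟩ := act_Ev (P := P) (i := β.1) (j := β.2 + 1) (a := p.1) (d := p.2 - p.1) hq0 hr0 hr hβ1 hβ2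
        (by omega) (by omega) h1 (by omega) h2 (by omega) le_rfl hβ2 (by omega)
      exact ⟨k, fun _ _ => hk⟩
    · exact ⟨0, fun h1 h2 => absurd ⟨h1, h2⟩ h⟩
  choose k hk using hact
  have hpair : ∀ p, inPhiR N r p →
      (P.pair (D.Ev (p.2 - p.1) p.1) (P.grz r β.1 (β.2 + 1)) ≠ 0 ↔ p = β) := by
    rintro p ⟨h1, h2, h3, h4⟩
    refine (pair_Ev_grz (P := P) hq0 hr0 hr hβ1 hβ2 (by omega) (by omega) _ h1 (by omega) h2 (by omega)).trans ?_
    rw [Prod.ext_iff]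
    omega
  obtain ⟨C, hC, hpl⟩ := hP.list_prod (fun p => D.Ev (p.2 - p.1) p.1) m (fun p => (q : ℂ) ^ k p) β
    (e := P.pair (D.Ev (β.2 - β.1) β.1) (P.grz r β.1 (β.2 + 1)))
    (fun p => zpow_ne_zero _ hq0) (fun p => geom_sum_zpow_ne_zero hq _ p)
    ((hpair β ⟨hβ1, hβ2, hβ3, hβ4⟩).2 rfl) lE hnd
    (fun p hp h0 => by
      have h5 := hm p hp h0
      obtain ⟨h1, h2, h3, h4⟩ := hlE p hp
      exact good_Ev hq0 hr0 hr hβ1 hβ2 (by omega) (by omega) h1 (by omega) h2 (by omega) (by omega))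
    (fun p hp h0 => by
      have := hk p (hlE p hp) (hm p hp h0)
      split_ifs with h
      · rwa [h] at this ⊢
      · rwa [not_not.1 (mt (hpair p (hlE p hp)).1 h)] at this)
  refine ⟨C, hC, fun M hM a ha => ?_⟩
  have := hpl.2 M (by omega) a ha
  rwa [one_mul] at this

lemma peel_F {β : ℕ × ℕ} (hβ : inPhiR N r β) (hnd : lF.Nodup) (hm0 : ∀ p ∈ lE, m p = 0)
    (hn : ∀ p ∈ lF, n p ≠ 0 → β.1 + β.2 ≤ p.1 + p.2) :
    ∃ C : ℂ, (C ≠ 0 ↔ β ∈ lF ∧ n β ≠ 0) ∧ ∀ M, (lF.map n).sum + (lE.map m).sum ≤ M + 1 →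
      ∀ a ∈ P.fil r M, P.pair (D.mon lF lE n m) (a * P.grz r (β.2 + 1) β.1) =
        C * P.pair (D.mon lF lE (fun p => n p - if p = β then 1 else 0) m) a := by
  obtain ⟨hβ1, hβ2, hβ3, hβ4⟩ := hβ
  have hq0 := ofReal_ne_zero_of_transcendental hq
  have hmon : ∀ n, D.mon lF lE n m = 1 * (lF.map fun p => D.Fv (p.2 - p.1) p.1 ^ n p).prod := fun n => by
    rw [UqslData.mon, one_mul]
    convert mul_one _
    refine List.prod_eq_one fun x hx => ?_
    obtain ⟨p, hp, rfl⟩ := List.mem_map.1 hx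
    rw [hm0 p hp, pow_zero]
  have hP : P.Peel r (LinearMap.mul ℂ P.A).flip (P.colW r (β.2 + 1) β.1) (P.grz r (β.2 + 1) β.1) 0 1 1 0 := by
    refine ⟨kills_one fun w hw a => ?_, fun M _ a _ => ?_⟩
    · rw [LinearMap.flip_apply, LinearMap.mul_apply', Bialgebra.counit_mul,
        counit_colW hr hβ1 hβ2 (by omega) hw, mul_zero]
    · rw [LinearMap.flip_apply, LinearMap.mul_apply', P.pair_oneU, Bialgebra.counit_mul,
        counit_grz hr (by omega) (by omega) hβ1 (by omega), if_neg (by omega), mul_zero, zero_mul]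
  have hact : ∀ p, ∃ k : ℤ, inPhiR N r p → β.1 + β.2 ≤ p.1 + p.2 →
      P.Act r (LinearMap.mul ℂ P.A).flip (P.colW r (β.2 + 1) β.1) (P.grz r (β.2 + 1) β.1) ((q : ℂ) ^ k)
        (P.pair (D.Fv (p.2 - p.1) p.1) (P.grz r (β.2 + 1) β.1)) (D.Fv (p.2 - p.1) p.1) := by
    intro p
    by_cases h : inPhiR N r p ∧ β.1 + β.2 ≤ p.1 + p.2
    · obtain ⟨⟨h1, h2, h3, h4⟩, h5⟩ := h
      obtain ⟨k, hk⟩ := act_Fv (P := P) (i := β.1) (j := β.2 + 1) (a := p.1) (d := p.2 - p.1) hq0 hr0 hr hβ1 hβ2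
        (by omega) (by omega) h1 (by omega) h2 (by omega) le_rfl (by omega) (by omega)
      exact ⟨k, fun _ _ => hk⟩
    · exact ⟨0, fun h1 h2 => absurd ⟨h1, h2⟩ h⟩
  choose k hk using hact
  have hpair : ∀ p, inPhiR N r p →
      (P.pair (D.Fv (p.2 - p.1) p.1) (P.grz r (β.2 + 1) β.1) ≠ 0 ↔ p = β) := by
    rintro p ⟨h1, h2, h3, h4⟩
    refine (pair_Fv_grz (P := P) hq0 hr0 hr hβ1 hβ2 (by omega) (by omega) _ h1 (by omega) h2 (by omega)).trans ?_
    rw [Prod.ext_iff]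
    omega
  obtain ⟨C, hC, hpl⟩ := hP.list_prod (fun p => D.Fv (p.2 - p.1) p.1) n (fun p => (q : ℂ) ^ k p) β
    (e := P.pair (D.Fv (β.2 - β.1) β.1) (P.grz r (β.2 + 1) β.1))
    (fun p => zpow_ne_zero _ hq0) (fun p => geom_sum_zpow_ne_zero hq _ p)
    ((hpair β ⟨hβ1, hβ2, hβ3, hβ4⟩).2 rfl) lF hnd
    (fun p hp h0 => by
      have h5 := hn p hp h0
      obtain ⟨h1, h2, h3, h4⟩ := hlF p hp
      exact good_Fv hq0 hr0 hr hβ1 hβ2 (by omega) (by omega) h1 (by omega) h2 (by omega) (by omega))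
    (fun p hp h0 => by
      have := hk p (hlF p hp) (hn p hp h0)
      split_ifs with h
      · rwa [h] at this ⊢
      · rwa [not_not.1 (mt (hpair p (hlF p hp)).1 h)] at this)
  refine ⟨C, hC, fun M hM a ha => ?_⟩
  rw [hmon, hmon]
  exact hpl.2 M (by omega) a ha

end Monomials

lemma mon_mem_low {lF lE : List (ℕ × ℕ)} (hlF : ∀ p ∈ lF, inPhiR N r p) (hlE : ∀ p ∈ lE, inPhiR N r p)
    (n m : ℕ × ℕ → ℕ) : D.mon lF lE n m ∈ P.low r ((lF.map n).sum + (lE.map m).sum) := by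
  have hgood : ∀ {X : D.U}, X ∈ P.low r 1 → P.Good r (LinearMap.mul ℂ P.A) ⊥ X := fun hX =>
    ⟨hX, fun M w hw y _ => by
      rw [(Submodule.mem_bot ℂ).1 hw, map_zero, LinearMap.zero_apply, map_zero]
      exact zero_mem _⟩
  have h0 : P.Kills r (LinearMap.mul ℂ P.A) ⊥ 0 1 := kills_one fun w hw a => by
    rw [(Submodule.mem_bot ℂ).1 hw, map_zero, LinearMap.zero_apply, map_zero]
  have h1 := h0.list_prod (fun p => D.Fv (p.2 - p.1) p.1) n lF fun p hp _ => by
    obtain ⟨h1, h2, h3, h4⟩ := hlF p hp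
    exact hgood (Fv_mem_low_one h1 (by omega))
  have h2 := h1.list_prod (fun p => D.Ev (p.2 - p.1) p.1) m lE fun p hp _ => by
    obtain ⟨h1, h2, h3, h4⟩ := hlE p hp
    exact hgood (Ev_mem_low_one h1 (by omega))
  rw [one_mul, zero_add] at h2
  exact h2.1

end QslnFun

section Peeling

variable {T V : Type*} [Fintype T] [DecidableEq T] [AddCommGroup V] [Module ℂ V]
  {φ : (T → ℕ) → V →ₗ[ℂ] ℂ} {fl : ℕ → Submodule ℂ V} {rk : T → ℕ} {op : T → V → V}
  (h0 : ∃ v ∈ fl 0, φ 0 v ≠ 0) (hop : ∀ β l, ∀ w ∈ fl l, op β w ∈ fl (l + 1))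
  (hpeel : ∀ β f, (∀ γ, rk γ < rk β → f γ = 0) → ∃ C : ℂ, (C ≠ 0 ↔ f β ≠ 0) ∧
    ∀ l, ∑ t, f t ≤ l + 1 → ∀ w ∈ fl l, φ f (op β w) = C * φ (f - Pi.single β 1) w)
include h0 hop hpeel

lemma coeff_eq_zero_of_peel (l : ℕ) (S : Finset (T → ℕ)) (c : (T → ℕ) → ℂ) (hS : ∀ f ∈ S, ∑ t, f t = l)
    (hc : ∀ w ∈ fl l, ∑ f ∈ S, c f * φ f w = 0) : ∀ f ∈ S, c f = 0 := by
  induction l generalizing S c with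
  | zero =>
    obtain ⟨v, hv, hv0⟩ := h0
    intro f hf
    have hz : ∀ f ∈ S, f = 0 := fun f hf => funext fun t =>
      (Finset.sum_eq_zero_iff.1 (hS f hf)) t (Finset.mem_univ t)
    have hS0 : S = {0} := Finset.eq_singleton_iff_unique_mem.2 ⟨hz f hf ▸ hf, hz⟩
    have := hc v hv
    rw [hS0, Finset.sum_singleton] at this
    rw [hz f hf]
    exact (mul_eq_zero.1 this).resolve_right hv0
  | succ l ih =>
    have key : ∀ n, ∀ β, rk β = n → ∀ f ∈ S, f β ≠ 0 → c f = 0 := by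
      intro n
      induction n using Nat.strong_induction_on with
      | _ n ihn =>
      intro β hβ f hf hfβ
      have hsmall : ∀ f ∈ S, c f ≠ 0 → ∀ γ, rk γ < rk β → f γ = 0 := fun f hf hcf γ hγ => by
        by_contra h
        exact hcf (ihn _ (hβ ▸ hγ) γ rfl f hf h)
      have hC : ∀ f, ∃ C : ℂ, (f ∈ S → c f ≠ 0 → (C ≠ 0 ↔ f β ≠ 0) ∧
          ∀ w ∈ fl l, φ f (op β w) = C * φ (f - Pi.single β 1) w) := by
        intro f
        by_cases h : f ∈ S ∧ c f ≠ 0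
        · obtain ⟨C, h1, h2⟩ := hpeel β f (hsmall f h.1 h.2)
          exact ⟨C, fun _ _ => ⟨h1, h2 l (hS f h.1).le⟩⟩
        · exact ⟨0, fun h1 h2 => absurd ⟨h1, h2⟩ h⟩
      choose C hC using hC
      set δ : T → ℕ := Pi.single β 1 with hδ
      have hcan : ∀ f : T → ℕ, f β ≠ 0 → f - δ + δ = f := fun f hf => by
        refine funext fun t => ?_
        by_cases ht : t = β
        · subst ht
          simp only [hδ, Pi.add_apply, Pi.sub_apply, Pi.single_eq_same]
          omega
        · simp [hδ, ht]
      have hinj : Set.InjOn (fun f : T → ℕ => f - δ) (S.filter fun f => f β ≠ 0) := by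
        intro f hf g hg hfg
        simp only [Finset.coe_filter, Set.mem_ofPred_eq] at hf hg
        rw [← hcan f hf.2, ← hcan g hg.2]
        exact congrArg (· + δ) hfg
      have := ih ((S.filter fun f => f β ≠ 0).image fun f => f - δ) (fun g => c (g + δ) * C (g + δ)) ?_ ?_
        (f - δ) (Finset.mem_image_of_mem _ (Finset.mem_filter.2 ⟨hf, hfβ⟩))
      · rw [hcan f hfβ] at this
        by_contra h
        exact (mul_ne_zero h ((hC f hf h).1.2 hfβ)) this
      · intro g hg
        obtain ⟨f, hf, rfl⟩ := Finset.mem_image.1 hg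
        rw [Finset.mem_filter] at hf
        have h1 := hS f hf.1
        rw [← hcan f hf.2] at h1
        simp only [Pi.add_apply, Finset.sum_add_distrib, hδ, Finset.sum_pi_single', Finset.mem_univ, if_true] at h1
        exact Nat.succ_injective h1
      · intro w hw
        have h1 := hc (op β w) (hop β l w hw)
        rw [Finset.sum_image hinj, ← h1, Finset.sum_filter]
        refine Finset.sum_congr rfl fun f hf => ?_
        by_cases hcf : c f = 0
        · split_ifs with h
          · rw [hcan f h, hcf]; simp
          · rw [hcf, zero_mul]
        · obtain ⟨h2, h3⟩ := hC f hf hcf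
          rw [h3 w hw]
          split_ifs with h
          · rw [hcan f h, mul_assoc]
          · rw [not_not.1 (mt h2.1 h), zero_mul, mul_zero]
    intro f hf
    have : ∃ β, f β ≠ 0 := by
      by_contra! h
      have := hS f hf
      rw [Finset.sum_eq_zero fun t _ => h t] at this
      omega
    obtain ⟨β, hβ⟩ := this
    exact key _ β rfl f hf hβ

lemma linearIndependent_of_peel (hanti : Antitone fl)
    (hlow : ∀ f l, ∑ t, f t < l → ∀ w ∈ fl l, φ f w = 0) :
    LinearIndependent ℂ fun f => (φ f).domRestrict (fl 0) := by
  rw [linearIndependent_iff']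
  intro S c hc
  have hc' : ∀ w ∈ fl 0, ∑ f ∈ S, c f * φ f w = 0 := fun w hw => by
    have := LinearMap.congr_fun hc ⟨w, hw⟩
    simpa using this
  by_contra! h
  obtain ⟨f, hf, hmax⟩ := (S.filter fun f => c f ≠ 0).exists_max_image (fun f => ∑ t, f t)
    (by obtain ⟨f, hf⟩ := h; exact ⟨f, Finset.mem_filter.2 hf⟩)
  rw [Finset.mem_filter] at hf
  refine hf.2 (coeff_eq_zero_of_peel h0 hop hpeel (∑ t, f t) (S.filter fun g => ∑ t, g t = ∑ t, f t) c
    (fun g hg => (Finset.mem_filter.1 hg).2) (fun w hw => ?_) f (Finset.mem_filter.2 ⟨hf.1, rfl⟩))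
  rw [← hc' w (hanti (Nat.zero_le _) hw), Finset.sum_filter]
  refine Finset.sum_congr rfl fun g hg => ?_
  split_ifs with hgf
  · rfl
  · by_cases hcg : c g = 0
    · rw [hcg, zero_mul]
    · have := hmax g (Finset.mem_filter.2 ⟨hg, hcg⟩)
      rw [hlow g _ (lt_of_le_of_ne this hgf) w hw, mul_zero]

end Peeling

namespace QslnFun

variable {q : ℝ} {N : ℕ} {D : UqslData q N} {P : QslnFun q N D} {r : ℕ}

lemma mem_roots_iff {p : ℕ × ℕ} : p ∈ Finset.Icc 1 r ×ˢ Finset.Icc r (N - 1) ↔ inPhiR N r p := by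
  simp only [Finset.mem_product, Finset.mem_Icc, inPhiR]
  omega

/-- Extension by zero of a function on the roots in `Φ⁺_r`. -/
def extZ (u : Rt N r → ℕ) (p : ℕ × ℕ) : ℕ :=
  if h : p ∈ Finset.Icc 1 r ×ˢ Finset.Icc r (N - 1) then u ⟨p, h⟩ else 0

@[simp] lemma extZ_coe (u : Rt N r → ℕ) (p : Rt N r) : extZ u p = u p := dif_pos p.2

lemma extZ_zero : extZ (0 : Rt N r → ℕ) = 0 := by
  funext p
  unfold extZ
  split_ifs <;> rfl

lemma extZ_sub (u : Rt N r → ℕ) (β : Rt N r) :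
    extZ (u - Pi.single β 1) = fun p => extZ u p - if p = β then 1 else 0 := by
  funext p
  unfold extZ
  split_ifs with h1 h2 h2
  · obtain rfl : (⟨p, h1⟩ : Rt N r) = β := Subtype.ext h2
    simp
  · have : (⟨p, h1⟩ : Rt N r) ≠ β := fun h => h2 (congrArg Subtype.val h)
    simp [this]
  · rfl
  · rfl

lemma sum_map_eq {l : List (ℕ × ℕ)} (hnd : l.Nodup) (hl : ∀ p, p ∈ l ↔ inPhiR N r p) (n : ℕ × ℕ → ℕ) :
    (l.map n).sum = ∑ p : Rt N r, n p := by
  rw [← List.sum_toFinset n hnd, Finset.sum_coe_sort (Finset.Icc 1 r ×ˢ Finset.Icc r (N - 1)) n]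
  congr 1
  ext p
  rw [List.mem_toFinset, hl, mem_roots_iff]

variable (D) in
/-- The monomials, indexed by functions on two copies of `Φ⁺_r`. -/
def monR (r : ℕ) (lF lE : List (ℕ × ℕ)) (f : Rt N r ⊕ Rt N r → ℕ) : D.U :=
  D.mon lF lE (extZ fun p => f (.inl p)) (extZ fun p => f (.inr p))

section

variable {lF lE : List (ℕ × ℕ)} (hlFnd : lF.Nodup) (hlF : ∀ p, p ∈ lF ↔ inPhiR N r p)
  (hlEnd : lE.Nodup) (hlE : ∀ p, p ∈ lE ↔ inPhiR N r p)
include hlFnd hlF hlEnd hlE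

lemma degree_monR (f : Rt N r ⊕ Rt N r → ℕ) :
    (lF.map (extZ fun p => f (.inl p))).sum + (lE.map (extZ fun p => f (.inr p))).sum = ∑ t, f t := by
  rw [sum_map_eq hlFnd hlF, sum_map_eq hlEnd hlE, Fintype.sum_sum_type]
  simp only [extZ_coe]

lemma monR_mem_low (f : Rt N r ⊕ Rt N r → ℕ) : monR D r lF lE f ∈ P.low r (∑ t, f t) := by
  rw [← degree_monR hlFnd hlF hlEnd hlE]
  exact mon_mem_low (fun p hp => (hlF p).1 hp) (fun p hp => (hlE p).1 hp) _ _

lemma monSpanLe_eq (k : ℕ) : monSpanLe D lF lE k =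
    Submodule.span ℂ (monR D r lF lE '' {f | ∑ t, f t ≤ k}) := by
  unfold monSpanLe
  congr 1
  ext x
  constructor
  · rintro ⟨n, m, h, rfl⟩
    refine ⟨Sum.elim (fun p => n p) (fun p => m p), ?_, ?_⟩
    · rw [sum_map_eq hlFnd hlF, sum_map_eq hlEnd hlE] at h
      simpa using h
    · have hn : ∀ n : ℕ × ℕ → ℕ, ∀ p, inPhiR N r p → extZ (fun p : Rt N r => n p) p = n p :=
        fun n p hp => dif_pos (mem_roots_iff.2 hp)
      unfold monR UqslData.mon
      congr 2
      · exact List.map_congr_left fun p hp => by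
          simp only [Sum.elim_inl]
          rw [hn n p ((hlF p).1 hp)]
      · exact List.map_congr_left fun p hp => by
          simp only [Sum.elim_inr]
          rw [hn m p ((hlE p).1 hp)]
  · rintro ⟨f, h, rfl⟩
    exact ⟨_, _, (degree_monR hlFnd hlF hlEnd hlE f).trans_le h, rfl⟩

lemma linearIndependent_monR (hq : Transcendental ℚ q) (hr0 : 1 ≤ r) (hr : r < N) :
    LinearIndependent ℂ fun f => (P.pair (monR D r lF lE f)).domRestrict (P.Bmod r) := by
  have hq0 := ofReal_ne_zero_of_transcendental hq
  have hB : ∀ p : Rt N r, inPhiR N r p := fun p => mem_roots_iff.1 p.2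
  let rk : Rt N r ⊕ Rt N r → ℕ :=
    Sum.elim (fun p => 2 * N + 1 + (p.1.1 + p.1.2)) (fun p => 2 * N - (p.1.1 + p.1.2))
  let op : Rt N r ⊕ Rt N r → P.A → P.A :=
    Sum.elim (fun p w => w * P.grz r (p.1.2 + 1) p.1.1) (fun p w => P.grz r p.1.1 (p.1.2 + 1) * w)
  have := linearIndependent_of_peel (φ := fun f => P.pair (monR D r lF lE f)) (fl := P.fil r) (rk := rk)
    (op := op) ?_ ?_ ?_ fil_anti ?_
  · rwa [fil_zero] at this
  · refine ⟨1, by rw [fil_zero]; exact one_mem_Bmod, ?_⟩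
    have h1 : monR D r lF lE 0 = 1 := by
      change D.mon lF lE (extZ 0) (extZ 0) = 1
      rw [extZ_zero, UqslData.mon]
      simp
    rw [h1, P.pair_oneU, Bialgebra.counit_one]
    exact one_ne_zero
  · rintro (p | p) l w hw
    · obtain ⟨h1, h2, h3, h4⟩ := hB p
      refine mul_mem_fil hw (n := 1) ?_ le_rfl
      rw [fil_one]
      exact grz_mem_Bplus hr (by omega) (by omega) h1 (by omega) hq0 (by omega)
    · obtain ⟨h1, h2, h3, h4⟩ := hB p
      refine mul_mem_fil (m := 1) ?_ hw (by omega)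
      rw [fil_one]
      exact grz_mem_Bplus hr h1 (by omega) (by omega) (by omega) hq0 (by omega)
  · rintro (β | β) f hf
    · obtain ⟨C, hC, h⟩ := peel_F (P := P) hq hr0 hr (fun p hp => (hlF p).1 hp) (fun p hp => (hlE p).1 hp)
        (extZ fun p => f (.inl p)) (extZ fun p => f (.inr p)) (hB β) hlFnd
        (fun p hp => by
          have hp := (hlE p).1 hp
          refine (extZ_coe _ ⟨p, mem_roots_iff.2 hp⟩).trans (hf _ ?_)
          simp only [rk, Sum.elim_inl, Sum.elim_inr]
          omega)
        (fun p hp h0 => by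
          have hp := (hlF p).1 hp
          by_contra hlt
          refine h0 ((extZ_coe _ ⟨p, mem_roots_iff.2 hp⟩).trans (hf _ ?_))
          simp only [rk, Sum.elim_inl]
          omega)
      refine ⟨C, hC.trans ?_, fun l hl w hw => ?_⟩
      · rw [extZ_coe, and_iff_right ((hlF _).2 (hB β))]
      · rw [← degree_monR hlFnd hlF hlEnd hlE] at hl
        refine (h l hl w hw).trans ?_
        rw [← extZ_sub]
        congr 3
        unfold monR
        congr 2
        · funext p
          by_cases hp : p = β
          · subst hp; simp
          · have : Sum.inl p ≠ (Sum.inl β : Rt N r ⊕ Rt N r) := fun h => hp (Sum.inl_injective h)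
            simp [hp, this]
    · obtain ⟨C, hC, h⟩ := peel_E (P := P) hq hr0 hr (fun p hp => (hlF p).1 hp) (fun p hp => (hlE p).1 hp)
        (extZ fun p => f (.inl p)) (extZ fun p => f (.inr p)) (hB β) hlEnd
        (fun p hp h0 => by
          have hp := (hlE p).1 hp
          by_contra hlt
          refine h0 ((extZ_coe _ ⟨p, mem_roots_iff.2 hp⟩).trans (hf _ ?_))
          obtain ⟨h1, h2, h3, h4⟩ := hp
          simp only [rk, Sum.elim_inr]
          omega)
      refine ⟨C, hC.trans ?_, fun l hl w hw => ?_⟩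
      · rw [extZ_coe, and_iff_right ((hlE _).2 (hB β))]
      · rw [← degree_monR hlFnd hlF hlEnd hlE] at hl
        refine (h l hl w hw).trans ?_
        rw [← extZ_sub]
        congr 3
        unfold monR
        congr 2
        · funext p
          by_cases hp : p = β
          · subst hp; simp
          · have : Sum.inr p ≠ (Sum.inr β : Rt N r ⊕ Rt N r) := fun h => hp (Sum.inr_injective h)
            simp [hp, this]
  · intro f l hl w hw
    exact pair_low (monR_mem_low hlFnd hlF hlEnd hlE f) hw hl

end

end QslnFun

namespace QslnFun

variable {q : ℝ} {N : ℕ} {D : UqslData q N} {P : QslnFun q N D} {r : ℕ}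

/-- The exponent vectors of degree at most `k`, indexed by multisets. -/
def expo (N r k : ℕ) (m : Σ l : Fin (k + 1), Sym (Rt N r ⊕ Rt N r) l) : Rt N r ⊕ Rt N r → ℕ :=
  (Sym.equivNatSumOfFintype _ _ m.2).1

lemma sum_expo {k : ℕ} (m : Σ l : Fin (k + 1), Sym (Rt N r ⊕ Rt N r) l) :
    ∑ t, expo N r k m t = m.1 :=
  (Sym.equivNatSumOfFintype _ _ m.2).2

lemma expo_injective (k : ℕ) : Function.Injective (expo N r k) := by
  rintro ⟨l, s⟩ ⟨l', s'⟩ h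
  obtain rfl : l = l' := Fin.ext (by rw [← sum_expo ⟨l, s⟩, h, sum_expo])
  have : s = s' := (Sym.equivNatSumOfFintype _ _).injective (Subtype.ext h)
  rw [this]

lemma range_expo (k : ℕ) : Set.range (expo N r k) = {f | ∑ t, f t ≤ k} := by
  ext f
  constructor
  · rintro ⟨m, rfl⟩
    exact (sum_expo m).trans_le (Nat.lt_succ_iff.1 m.1.2)
  · intro hf
    refine ⟨⟨⟨∑ t, f t, Nat.lt_succ_iff.2 hf⟩, (Sym.equivNatSumOfFintype _ _).symm ⟨f, rfl⟩⟩, ?_⟩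
    simp [expo]

lemma card_expo (hr : r < N) (k : ℕ) : Fintype.card (Σ l : Fin (k + 1), Sym (Rt N r ⊕ Rt N r) l) =
    ∑ l ∈ Finset.range (k + 1), Nat.choose (2 * r * (N - r) + l - 1) l := by
  rw [Fintype.card_sigma, ← Fin.sum_univ_eq_sum_range fun l => Nat.choose (2 * r * (N - r) + l - 1) l]
  exact Finset.sum_congr rfl fun l _ => card_sym_Rt hr l

lemma map_val_pow {Bsub : Subalgebra ℂ P.A} (hB : Subalgebra.toSubmodule Bsub = P.Bmod r) (k : ℕ) :
    ((LinearMap.ker ((Coalgebra.counit (R := ℂ) (A := P.A)) ∘ₗ Bsub.val.toLinearMap) :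
      Submodule ℂ ↥Bsub) ^ k).map Bsub.val.toLinearMap = P.Bplus r ^ k := by
  rw [Submodule.map_pow]
  congr 1
  rw [LinearMap.ker_comp, Submodule.map_comap_eq, Bplus, ← hB]
  congr 1
  ext x
  simp

lemma pair_Jsub {x : D.U} (hx : x ∈ D.Jsub r) {b : P.A} (hb : b ∈ P.Bmod r) : P.pair x b = 0 := by
  have : D.Jsub r ≤ LinearMap.ker (P.pair.flip b) := by
    refine Submodule.span_le.2 ?_
    rintro _ ⟨k, hk, hk0, u, rfl⟩
    change P.pair (k * u) b = 0
    rw [pair_Ksub_mul hk u hb, hk0, zero_mul]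
  exact this hx

end QslnFun

lemma pi_surjective_of_linearIndependent {K V J : Type*} [Field K] [AddCommGroup V] [Module K V] [Fintype J]
    {ψ : J → V →ₗ[K] K} (h : LinearIndependent K ψ) : Function.Surjective (LinearMap.pi ψ) := by
  classical
  rw [← LinearMap.range_eq_top]
  by_contra hne
  obtain ⟨c, hc0, hc⟩ := Submodule.exists_le_ker_of_lt_top _ (lt_top_iff_ne_top.2 hne)
  have hcs : ∀ x : J → K, c x = ∑ j, c (Pi.single j 1) * x j := fun x => by
    conv_lhs => rw [pi_eq_sum_univ x]
    rw [map_sum]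
    refine Finset.sum_congr rfl fun j _ => ?_
    rw [map_smul, smul_eq_mul, mul_comm]
    congr 2
    funext i
    simp [Pi.single_apply, eq_comm]
  have hz := Fintype.linearIndependent_iff.1 h (fun j => c (Pi.single j 1)) (LinearMap.ext fun v => by
    have := hc (LinearMap.mem_range_self (LinearMap.pi ψ) v)
    rw [LinearMap.mem_ker, hcs] at this
    simpa using this)
  exact hc0 (LinearMap.ext fun x => by rw [hcs x]; simp [hz])

lemma ker_pi_eq_of_spanning {K V J : Type*} [Field K] [AddCommGroup V] [Module K V] [Fintype J]
    {ψ : J → V →ₗ[K] K} (h : LinearIndependent K ψ) {I : Submodule K V} (hI : ∀ j, ∀ v ∈ I, ψ j v = 0)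
    (s : J → V) (hs : Submodule.span K (Set.range s) ⊔ I = ⊤) : LinearMap.ker (LinearMap.pi ψ) = I := by
  have hI' : ∀ v ∈ I, LinearMap.pi ψ v = 0 := fun v hv => funext fun j => hI j v hv
  have hdec : ∀ v, ∃ x : J → K, v - Fintype.linearCombination K s x ∈ I := fun v => by
    obtain ⟨w, hw, y, hy, rfl⟩ := Submodule.mem_sup.1 (hs ▸ Submodule.mem_top : v ∈ _ ⊔ I)
    rw [← Fintype.range_linearCombination] at hw
    obtain ⟨x, rfl⟩ := hw
    exact ⟨x, by rwa [add_sub_cancel_left]⟩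
  have hsurj : Function.Surjective ((LinearMap.pi ψ).comp (Fintype.linearCombination K s)) := fun y => by
    obtain ⟨v, rfl⟩ := pi_surjective_of_linearIndependent h y
    obtain ⟨x, hx⟩ := hdec v
    have := hI' _ hx
    rw [map_sub, sub_eq_zero] at this
    exact ⟨x, this.symm⟩
  have hinj := LinearMap.injective_iff_surjective.2 hsurj
  refine le_antisymm (fun v hv => ?_) hI'
  obtain ⟨x, hx⟩ := hdec v
  have h1 := hI' _ hx
  rw [map_sub, LinearMap.mem_ker.1 hv, zero_sub, neg_eq_zero] at h1
  have h2 : x = 0 := hinj (by rw [LinearMap.comp_apply, h1, map_zero])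
  rwa [h2, map_zero, sub_zero] at hx

/-- Corollary `knondeg`.  For all `k ≥ 0`, the pairing
`B/(B⁺)^{k+1} ⊗ Ū_k → ℂ` is nondegenerate; in particular
`dim B/(B⁺)^{k+1} = dim Ū_k = Σ_{l=0}^{k} C(2r(N-r)+l-1, l)`. -/
theorem pairing_BmodBplusPow_Ubark_nondegenerate
    (q : ℝ) (hq : Transcendental ℚ q)
    (N r : ℕ) (hN : 2 ≤ N) (hr1 : 1 ≤ r) (hr2 : r ≤ N - 1)
    (D : UqslData q N) (P : QslnFun q N D)
    (Bsub : Subalgebra ℂ P.A) (hB : Subalgebra.toSubmodule Bsub = P.Bmod r)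
    (lF lE : List (ℕ × ℕ))
    (hlFnd : lF.Nodup) (hlF : ∀ p, p ∈ lF ↔ inPhiR N r p)
    (hlEnd : lE.Nodup) (hlE : ∀ p, p ∈ lE ↔ inPhiR N r p)
    (k : ℕ) :
    (∀ b : ↥Bsub,
      (∀ x ∈ monSpanLe D lF lE k, P.pair x (b : P.A) = 0) →
      b ∈ (LinearMap.ker ((Coalgebra.counit (R := ℂ) (A := P.A)) ∘ₗ
            Bsub.val.toLinearMap) : Submodule ℂ ↥Bsub) ^ (k + 1)) ∧
    (∀ x ∈ monSpanLe D lF lE k,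
      (∀ b : ↥Bsub, P.pair x (b : P.A) = 0) → x ∈ D.Jsub r) ∧
    (Module.finrank ℂ
        (↥Bsub ⧸ (LinearMap.ker ((Coalgebra.counit (R := ℂ) (A := P.A)) ∘ₗ
          Bsub.val.toLinearMap) : Submodule ℂ ↥Bsub) ^ (k + 1)) =
      ∑ l ∈ Finset.range (k + 1), Nat.choose (2 * r * (N - r) + l - 1) l) ∧
    (Module.finrank ℂ
        ↥(Submodule.map (D.Jsub r).mkQ (monSpanLe D lF lE k)) =
      ∑ l ∈ Finset.range (k + 1), Nat.choose (2 * r * (N - r) + l - 1) l) := by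
  have hr : r < N := by omega
  have hmemB : ∀ b : ↥Bsub, (b : P.A) ∈ P.Bmod r := fun b => by rw [← hB]; exact b.2
  set I := (LinearMap.ker ((Coalgebra.counit (R := ℂ) (A := P.A)) ∘ₗ Bsub.val.toLinearMap) :
    Submodule ℂ ↥Bsub) ^ (k + 1) with hIdef
  have hImap : I.map Bsub.val.toLinearMap = P.Bplus r ^ (k + 1) := QslnFun.map_val_pow hB (k + 1)
  have hinj : Function.Injective Bsub.val.toLinearMap := Subtype.val_injective
  set g := fun m => QslnFun.monR D r lF lE (QslnFun.expo N r k m) with hg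
  have hspan : monSpanLe D lF lE k = Submodule.span ℂ (Set.range g) := by
    rw [QslnFun.monSpanLe_eq hlFnd hlF hlEnd hlE, ← QslnFun.range_expo, ← Set.range_comp]
    rfl
  have hgmem : ∀ m, g m ∈ monSpanLe D lF lE k := fun m => hspan ▸ Submodule.subset_span ⟨m, rfl⟩
  set ψ := fun m => (P.pair (g m)).comp Bsub.val.toLinearMap with hψ
  have hLI0 : LinearIndependent ℂ fun m => (P.pair (g m)).domRestrict (P.Bmod r) :=
    (QslnFun.linearIndependent_monR (P := P) hlFnd hlF hlEnd hlE hq hr1 hr).comp _ (QslnFun.expo_injective k)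
  have hLI : LinearIndependent ℂ ψ := by
    rw [← hB] at hLI0
    exact hLI0
  have hψI : ∀ m, ∀ v ∈ I, ψ m v = 0 := fun m v hv => by
    have h1 : (v : P.A) ∈ P.fil r (k + 1) := by
      rw [QslnFun.fil_succ, ← hImap]
      exact Submodule.mem_map_of_mem hv
    refine QslnFun.pair_low (QslnFun.monR_mem_low hlFnd hlF hlEnd hlE _) h1 ?_
    rw [QslnFun.sum_expo]
    exact m.1.2
  obtain ⟨s, hs, hs'⟩ := QslnFun.exists_spanning_Bmod (P := P) hq hr1 hr k
  have hs2 : ∀ m, s m ∈ Bsub := fun m => by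
    rw [← Subalgebra.mem_toSubmodule, hB]; exact hs m
  have htop : Submodule.span ℂ (Set.range fun m => (⟨s m, hs2 m⟩ : ↥Bsub)) ⊔ I = ⊤ := by
    refine Submodule.map_injective_of_injective hinj (le_antisymm (Submodule.map_mono le_top) ?_)
    rw [Submodule.map_sup, hImap, Submodule.map_span, ← Set.range_comp]
    refine le_trans ?_ hs'
    rintro _ ⟨b, -, rfl⟩
    exact hmemB b
  have hker := ker_pi_eq_of_spanning hLI hψI _ htop
  have hsurj := pi_surjective_of_linearIndependent hLI
  refine ⟨fun b hb => ?_, fun x hx hxb => ?_, ?_, ?_⟩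
  · rw [← hker]
    exact funext fun m => hb _ (hgmem m)
  · rw [hspan, ← Fintype.range_linearCombination] at hx
    obtain ⟨c, rfl⟩ := hx
    have hc := Fintype.linearIndependent_iff.1 hLI c (LinearMap.ext fun b => by
      have := hxb b
      rw [Fintype.linearCombination_apply, map_sum, LinearMap.sum_apply] at this
      simpa [hψ] using this)
    rw [show c = 0 from funext hc, map_zero]
    exact zero_mem _
  · rw [← QslnFun.card_expo hr k, ← Module.finrank_fintype_fun_eq_card (R := ℂ)]
    exact ((Submodule.quotEquivOfEq _ _ hker.symm).trans
      (LinearMap.quotKerEquivOfSurjective _ hsurj)).finrank_eq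
  · rw [hspan, Submodule.map_span, ← Set.range_comp, ← QslnFun.card_expo hr k]
    refine finrank_span_eq_card ?_
    let Φ : D.U →ₗ[ℂ] (↥Bsub →ₗ[ℂ] ℂ) :=
      (LinearMap.lcomp ℂ ℂ Bsub.val.toLinearMap).comp P.pair
    have hΦ : D.Jsub r ≤ LinearMap.ker Φ := fun x hx => LinearMap.ext fun b =>
      QslnFun.pair_Jsub hx (hmemB b)
    exact LinearIndependent.of_comp ((D.Jsub r).liftQ Φ hΦ) hLI
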